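/- arXiv:2408.08436 — 6 statements merged into one kernel-verified Lean document; each statement's English description precedes it below -/
import Mathlib

section
/- Let d be a nonzero integer and let Q_∞ be the quadratic form Q_∞(u_0,...,u_4) = -2d*u_0*u_1 + u_2^2 - 2*u_2*u_4 - 3*u_3^2 - u_4^2. For every prime p, there exists a 2-dimensional ℚ_p-linear subspace of ℚ_p^5 on which Q_∞ vanishes identically if and only if p ∉ {2,3}. Moreover, there exists a 2-dimensional ℝ-linear subspace of ℝ^5 on which Q_∞ vanishes identically. (That is, the quadric threefold V(Q_∞) ⊂ P^4 contains a ℚ_v-rational line exactly for the places v ∉ {2,3} of ℚ.) -/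
/-- The quadratic form `Q₀ = d(u₀² - 3u₁²) + 6u₂² + 6u₂u₃ - 6u₃u₄`. -/
def Q0 (d : ℤ) {F : Type*} [Field F] (u : Fin 5 → F) : F :=
  (d : F) * (u 0 ^ 2 - 3 * u 1 ^ 2) + 6 * u 2 ^ 2 + 6 * u 2 * u 3 - 6 * u 3 * u 4

/-- The quadratic form `Q∞ = -2d·u₀u₁ + u₂² - 2u₂u₄ - 3u₃² - u₄²`. -/
def Qinf (d : ℤ) {F : Type*} [Field F] (u : Fin 5 → F) : F :=
  -2 * (d : F) * u 0 * u 1 + u 2 ^ 2 - 2 * u 2 * u 4 - 3 * u 3 ^ 2 - u 4 ^ 2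

/-- If `-2d·u₀u₁ ⊥ ⟨1, -2, -3⟩` contains a totally isotropic plane, then `⟨1, -2, -3⟩` is
isotropic. -/
theorem exists_isotropic_of_plane {F : Type*} [Field F] {d : ℤ} (hd : (2 * d : F) ≠ 0)
    {W : Submodule F (Fin 5 → F)} (hW : Module.finrank F W = 2) (h : ∀ u ∈ W, Qinf d u = 0) :
    ∃ x y z : F, (x ≠ 0 ∨ y ≠ 0 ∨ z ≠ 0) ∧ x ^ 2 - 2 * y ^ 2 - 3 * z ^ 2 = 0 := by
  by_contra! H
  have vanishing (i : Fin 5) : ∃ u ∈ W, u ≠ 0 ∧ u i = 0 := by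
    have hlt : Module.finrank F F < Module.finrank F W := by simp [hW]
    obtain ⟨⟨u, huW⟩, hu, hne⟩ := (Submodule.ne_bot_iff _).1
      (LinearMap.ker_ne_bot_of_finrank_lt (f := (LinearMap.proj i).comp W.subtype) hlt)
    exact ⟨u, huW, by simpa using hne, by simpa using hu⟩
  have tail_eq_zero (u : Fin 5 → F) (hu : u ∈ W) (h01 : u 0 * u 1 = 0) :
      u 2 = 0 ∧ u 3 = 0 ∧ u 4 = 0 := by
    have hQ := h u hu
    rw [Qinf] at hQ
    by_contra hne
    refine H (u 2 - u 4) (u 4) (u 3) ?_ (by linear_combination hQ + 2 * (d : F) * h01)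
    by_contra! hz
    obtain ⟨h24, h4, h3⟩ := hz
    exact hne ⟨by rw [← sub_add_cancel (u 2) (u 4), h24, h4, add_zero], h3, h4⟩
  obtain ⟨u, huW, hu, hu0⟩ := vanishing 0
  obtain ⟨v, hvW, hv, hv1⟩ := vanishing 1
  obtain ⟨hu2, hu3, hu4⟩ := tail_eq_zero u huW (by simp [hu0])
  obtain ⟨hv2, hv3, hv4⟩ := tail_eq_zero v hvW (by simp [hv1])
  have hu1 : u 1 ≠ 0 := fun h1 => hu (by ext i; fin_cases i <;> simp [*])
  have hv0 : v 0 ≠ 0 := fun h0 => hv (by ext i; fin_cases i <;> simp [*])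
  have huv := h (u + v) (W.add_mem huW hvW)
  simp only [Qinf, Pi.add_apply, hu0, hv1, hu2, hu3, hu4, hv2, hv3, hv4] at huv
  exact mul_ne_zero (mul_ne_zero hd hu1) hv0 (by linear_combination -huv)

/-- If `⟨1, -2, -3⟩` is isotropic, then `Qinf d` vanishes on some plane. -/
theorem exists_plane_of_isotropic {F : Type*} [Field F] (d : ℤ) {x y z : F}
    (hne : y ≠ 0 ∨ z ≠ 0) (h : x ^ 2 - 2 * y ^ 2 - 3 * z ^ 2 = 0) :
    ∃ W : Submodule F (Fin 5 → F), Module.finrank F W = 2 ∧ ∀ u ∈ W, Qinf d u = 0 := by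
  let v : Fin 2 → Fin 5 → F := ![![1, 0, 0, 0, 0], ![0, 0, x + y, z, y]]
  have hv : LinearIndependent F v := by
    rw [LinearIndependent.pair_iff]
    intro s t hst
    have h0 := congrFun hst 0
    have h3 := congrFun hst 3
    have h4 := congrFun hst 4
    simp at h0 h3 h4
    grind
  refine ⟨Submodule.span F (Set.range v), by simpa using finrank_span_eq_card hv, ?_⟩
  intro u hu
  rw [show Set.range v = {v 0, v 1} by ext; simp [eq_comm],
    Submodule.mem_span_pair] at hu
  obtain ⟨a, b, rfl⟩ := hu
  simp only [Qinf, v, Pi.add_apply, Pi.smul_apply, smul_eq_mul, Matrix.cons_val]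
  linear_combination b ^ 2 * h

/-- If `⟨1, -2, -3⟩` is isotropic over `ℚ_p`, then it has a primitive zero over `ℤ_p`, and hence
a zero modulo every `p ^ n` with a coordinate equal to `1`. -/
theorem exists_zmod_zero_of_padic_isotropic (p : ℕ) [Fact p.Prime] (n : ℕ) {x y z : ℚ_[p]}
    (hne : x ≠ 0 ∨ y ≠ 0 ∨ z ≠ 0) (h : x ^ 2 - 2 * y ^ 2 - 3 * z ^ 2 = 0) :
    ∃ a b c : ZMod (p ^ n), (a = 1 ∨ b = 1 ∨ c = 1) ∧ a ^ 2 - 2 * b ^ 2 - 3 * c ^ 2 = 0 := by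
  obtain ⟨m, hm, hx, hy, hz, hm_mem⟩ : ∃ m : ℚ_[p], m ≠ 0 ∧ ‖x‖ ≤ ‖m‖ ∧ ‖y‖ ≤ ‖m‖ ∧ ‖z‖ ≤ ‖m‖ ∧
      (x = m ∨ y = m ∨ z = m) := by
    obtain ⟨m, hm, hmax⟩ := Set.exists_max_image ({x, y, z} : Set ℚ_[p]) (‖·‖) (by simp) (by simp)
    simp only [Set.mem_insert_iff, Set.mem_singleton_iff, forall_eq_or_imp, forall_eq] at hm hmax
    refine ⟨m, ?_, hmax.1, hmax.2.1, hmax.2.2, by tauto⟩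
    rintro rfl
    simp only [norm_zero, norm_le_zero_iff] at hmax
    tauto
  have norm_div_le (t : ℚ_[p]) (ht : ‖t‖ ≤ ‖m‖) : ‖t / m‖ ≤ 1 := by
    rw [norm_div]
    exact div_le_one_of_le₀ ht (norm_nonneg _)
  let X : ℤ_[p] := ⟨x / m, norm_div_le x hx⟩
  let Y : ℤ_[p] := ⟨y / m, norm_div_le y hy⟩
  let Z : ℤ_[p] := ⟨z / m, norm_div_le z hz⟩
  have hXYZ : X ^ 2 - 2 * Y ^ 2 - 3 * Z ^ 2 = 0 := by
    apply Subtype.coe_injective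
    push_cast
    change (x / m) ^ 2 - 2 * (y / m) ^ 2 - 3 * (z / m) ^ 2 = 0
    field_simp
    linear_combination h
  let f := PadicInt.toZModPow (p := p) n
  refine ⟨f X, f Y, f Z, ?_, by simpa [map_ofNat f] using congrArg f hXYZ⟩
  have map_eq_one (t : ℚ_[p]) (ht : ‖t‖ ≤ ‖m‖) (htm : t = m) :
      f ⟨t / m, norm_div_le t ht⟩ = 1 := by
    rw [← map_one f]
    congr 1
    apply Subtype.coe_injective
    simp [htm, hm]
  exact hm_mem.imp (map_eq_one x hx) (Or.imp (map_eq_one y hy) (map_eq_one z hz))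

/-- Approximate solutions of `c X² = e` in units lift to exact ones, for odd `p`. -/
theorem PadicInt.exists_mul_sq_eq {p : ℕ} [Fact p.Prime] {c e a : ℤ_[p]}
    (hunit : ‖2 * c * a‖ = 1) (h : ‖c * a ^ 2 - e‖ < 1) : ∃ x : ℤ_[p], c * x ^ 2 = e := by
  let F : Polynomial ℤ_[p] := .C c * .X ^ 2 - .C e
  have hF (t : ℤ_[p]) : F.aeval t = c * t ^ 2 - e := by simp [F]
  have hF' : F.derivative.aeval a = 2 * c * a := by simp [F]; ring
  obtain ⟨x, hx, -⟩ := hensels_lemma (F := F) (a := a) (by rw [hF, hF', hunit]; simpa using h)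
  exact ⟨x, sub_eq_zero.1 (by rw [← hF, hx])⟩

/-- For `p ≥ 5`, the form `⟨1, -2, -3⟩` is isotropic over `ℚ_p`. -/
theorem exists_padic_isotropic (p : ℕ) [hp : Fact p.Prime] (h2 : p ≠ 2) (h3 : p ≠ 3) :
    ∃ x y z : ℚ_[p], (y ≠ 0 ∨ z ≠ 0) ∧ x ^ 2 - 2 * y ^ 2 - 3 * z ^ 2 = 0 := by
  have natCast_ne_zero {q : ℕ} (hq : q.Prime) (hpq : p ≠ q) : (q : ZMod p) ≠ 0 := fun h0 =>
    hpq ((Nat.prime_dvd_prime_iff_eq hp.out hq).1 ((ZMod.natCast_eq_zero_iff _ _).1 h0))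
  have two_ne : (2 : ZMod p) ≠ 0 := mod_cast natCast_ne_zero Nat.prime_two h2
  have three_ne : (3 : ZMod p) ≠ 0 := mod_cast natCast_ne_zero Nat.prime_three h3
  have norm_lt (t : ℤ_[p]) (ht : PadicInt.toZMod t = 0) : ‖t‖ < 1 := by
    rwa [← RingHom.mem_ker, PadicInt.ker_toZMod, IsLocalRing.mem_maximalIdeal,
      PadicInt.mem_nonunits] at ht
  have norm_eq (t : ℤ_[p]) (ht : PadicInt.toZMod t ≠ 0) : ‖t‖ = 1 := by
    rwa [ne_eq, ← RingHom.mem_ker, PadicInt.ker_toZMod, IsLocalRing.mem_maximalIdeal,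
      mem_nonunits_iff, not_not, PadicInt.isUnit_iff] at ht
  obtain ⟨a, b, hab⟩ : ∃ a b : ZMod p, a ^ 2 - 2 * b ^ 2 - 3 = 0 := by
    obtain ⟨a, b, hab⟩ := FiniteField.exists_root_sum_quadratic
      (f := (.X ^ 2 : Polynomial (ZMod p))) (g := .C (-2) * .X ^ 2 + .C (-3))
      (by compute_degree!) (by compute_degree!)
      (by rw [ZMod.card]; exact hp.out.mod_two_eq_one_iff_ne_two.2 h2)
    exact ⟨a, b, by simp at hab; linear_combination hab⟩
  obtain ⟨A, rfl⟩ := ZMod.ringHom_surjective (PadicInt.toZMod (p := p)) a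
  obtain ⟨B, rfl⟩ := ZMod.ringHom_surjective (PadicInt.toZMod (p := p)) b
  suffices ∃ X Y : ℤ_[p], X ^ 2 - 2 * Y ^ 2 - 3 = 0 by
    obtain ⟨X, Y, hXY⟩ := this
    exact ⟨X, Y, 1, by simp, by exact_mod_cast congrArg ((↑) : ℤ_[p] → ℚ_[p]) hXY⟩
  by_cases hA : PadicInt.toZMod A = 0
  · have hB : PadicInt.toZMod B ≠ 0 := by
      intro hB
      apply three_ne
      simpa [hA, hB] using hab
    obtain ⟨Y, hY⟩ := PadicInt.exists_mul_sq_eq (c := 2) (e := A ^ 2 - 3) (a := B)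
      (norm_eq _ (by simp [map_ofNat PadicInt.toZMod, two_ne, hB]))
      (norm_lt _ (by simp only [map_sub, map_mul, map_pow, map_ofNat]; linear_combination -hab))
    exact ⟨A, Y, by linear_combination -hY⟩
  · obtain ⟨X, hX⟩ := PadicInt.exists_mul_sq_eq (c := 1) (e := 2 * B ^ 2 + 3) (a := A)
      (norm_eq _ (by simp [map_ofNat PadicInt.toZMod, two_ne, hA]))
      (norm_lt _ (by
        simp only [map_sub, map_add, map_mul, map_pow, map_ofNat, map_one]
        linear_combination hab))
    exact ⟨X, B, by linear_combination hX⟩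

/-- For a nonzero integer `d`, the quadric threefold `V(Q∞) ⊂ ℙ⁴` contains a `ℚ_p`-rational
line (a 2-dimensional `ℚ_p`-subspace of `ℚ_p⁵` on which `Q∞` vanishes identically) if and only
if `p ∉ {2,3}`; moreover it contains an `ℝ`-rational line. -/
theorem stmt1 (d : ℤ) (hd : d ≠ 0) :
    (∀ (p : ℕ) [Fact p.Prime],
      ((∃ W : Submodule ℚ_[p] (Fin 5 → ℚ_[p]), Module.finrank ℚ_[p] W = 2 ∧
          ∀ u ∈ W, Qinf d u = 0) ↔ p ∉ ({2, 3} : Set ℕ))) ∧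
    ∃ W : Submodule ℝ (Fin 5 → ℝ), Module.finrank ℝ W = 2 ∧ ∀ u ∈ W, Qinf d u = 0 := by
  refine ⟨fun p _ => ⟨?_, fun hp => ?_⟩, ?_⟩
  · rintro ⟨W, hW, hQ⟩ hp
    obtain ⟨x, y, z, hne, h⟩ := exists_isotropic_of_plane (by simp [hd]) hW hQ
    rcases hp with rfl | rfl
    · exact absurd (exists_zmod_zero_of_padic_isotropic 2 3 hne h) (by decide +kernel)
    · exact absurd (exists_zmod_zero_of_padic_isotropic 3 2 hne h) (by decide +kernel)
  · simp only [Set.mem_insert_iff, Set.mem_singleton_iff, not_or] at hp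
    obtain ⟨x, y, z, hne, h⟩ := exists_padic_isotropic p hp.1 hp.2
    exact exists_plane_of_isotropic d hne h
  · exact exists_plane_of_isotropic d (x := √2) (y := 1) (z := 0) (by simp) (by norm_num)
end

section
/- Let d be a nonzero integer and let Q_0 = d(u_0^2 - 3u_1^2) + 6u_2^2 + 6u_2u_3 - 6u_3u_4 and Q_∞ = -2d*u_0u_1 + u_2^2 - 2u_2u_4 - 3u_3^2 - u_4^2, viewed as quadratic forms on ℚ_3^5. Then for every b ∈ ℚ_3 with |b|_3 ≤ 1 (i.e., b ∈ ℤ_3), there is no 2-dimensional ℚ_3-linear subspace of ℚ_3^5 on which the quadratic form b·Q_0 + Q_∞ vanishes identically. (That is, the quadric V(bQ_0 + Q_∞) ⊂ P^4_{ℚ_3} contains no ℚ_3-rational lines.) -/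
theorem exists_mem_ne_zero_apply_eq_zero {K V : Type*} [Field K] [AddCommGroup V] [Module K V]
    (W : Submodule K V) (hW : 1 < Module.finrank K W) (f : V →ₗ[K] K) :
    ∃ u ∈ W, u ≠ 0 ∧ f u = 0 := by
  have : Module.Finite K W := Module.finite_of_finrank_pos (by omega)
  have h : LinearMap.ker (f.comp W.subtype) ≠ ⊥ :=
    LinearMap.ker_ne_bot_of_finrank_lt (by simpa using hW)
  obtain ⟨u, hu, hu0⟩ := Submodule.exists_mem_ne_zero_of_ne_bot h
  exact ⟨u, u.2, by simpa using hu0, hu⟩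

theorem PadicInt.exists_sq_eq_one_add_three_mul (c : ℤ_[3]) : ∃ s : ℤ_[3], s ^ 2 = 1 + 3 * c := by
  have h2 : ‖(2 : ℤ_[3])‖ = 1 := by
    exact_mod_cast (PadicInt.norm_natCast_eq_one_iff (p := 3) (n := 2)).mpr (by norm_num)
  have h3 : ‖(3 : ℤ_[3])‖ = 3⁻¹ := by simpa using PadicInt.norm_p (p := 3)
  have h : ‖(Polynomial.X ^ 2 - Polynomial.C (1 + 3 * c) : Polynomial ℤ_[3]).aeval (1 : ℤ_[3])‖ <
      ‖(Polynomial.X ^ 2 - Polynomial.C (1 + 3 * c) : Polynomial ℤ_[3]).derivative.aeval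
        (1 : ℤ_[3])‖ ^ 2 := by
    simp [one_add_one_eq_two, h2, h3]
    have := c.norm_le_one
    linarith
  obtain ⟨s, hs, -⟩ := hensels_lemma h
  exact ⟨s, by simpa [sub_eq_zero] using hs⟩

theorem exists_sq_eq_one_add_three_mul_sq {b : ℚ_[3]} (hb : ‖b‖ ≤ 1) :
    ∃ s : ℚ_[3], s ^ 2 = 1 + 3 * b ^ 2 ∧ s + 1 ≠ 0 := by
  obtain ⟨b, rfl⟩ : ∃ b' : ℤ_[3], (b' : ℚ_[3]) = b := ⟨⟨b, hb⟩, rfl⟩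
  obtain ⟨s, hs⟩ := PadicInt.exists_sq_eq_one_add_three_mul (b ^ 2)
  have hs' : (s : ℚ_[3]) ^ 2 = 1 + 3 * b ^ 2 := by exact_mod_cast congrArg ((↑) : ℤ_[3] → ℚ_[3]) hs
  by_cases h : (s : ℚ_[3]) + 1 = 0
  · refine ⟨-s, by rw [neg_sq, hs'], ?_⟩
    rw [eq_neg_of_add_eq_zero_left h]
    norm_num
  · exact ⟨s, hs', h⟩

theorem PadicInt.toZMod_three_eq_zero_iff (x : ℤ_[3]) : PadicInt.toZMod x = 0 ↔ 3 ∣ x := by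
  rw [← RingHom.mem_ker, PadicInt.ker_toZMod, PadicInt.maximalIdeal_eq_span_p,
    Ideal.mem_span_singleton]
  simp

theorem ne_zero_of_sq_eq_one_add_three_mul_sq {b s : ℚ_[3]} (hb : ‖b‖ ≤ 1)
    (hs : s ^ 2 = 1 + 3 * b ^ 2) : s ≠ 0 := by
  rintro rfl
  obtain ⟨b, rfl⟩ : ∃ b' : ℤ_[3], (b' : ℚ_[3]) = b := ⟨⟨b, hb⟩, rfl⟩
  have h : (3 : ℤ_[3]) ∣ 1 := ⟨-b ^ 2, by
    have : (0 : ℤ_[3]) ^ 2 = 1 + 3 * b ^ 2 := PadicInt.ext (by push_cast; exact hs)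
    linear_combination -this⟩
  rw [← PadicInt.toZMod_three_eq_zero_iff, map_one] at h
  exact one_ne_zero h

theorem PadicInt.three_dvd_of_sq_add_sq_eq {b x a c : ℤ_[3]}
    (h : x ^ 2 + a ^ 2 = 3 * ((2 * b + 1) * a ^ 2 + 4 * b * a * c + (3 * b ^ 2 - 1) * c ^ 2)) :
    3 ∣ x ∧ 3 ∣ a ∧ 3 ∣ c := by
  have h30 : (3 : ZMod 3) = 0 := rfl
  have hmod := congrArg PadicInt.toZMod h
  simp only [map_add, map_mul, map_pow, map_ofNat, h30, zero_mul] at hmod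
  have aux : ∀ p q : ZMod 3, p ^ 2 + q ^ 2 = 0 → p = 0 ∧ q = 0 := by decide
  obtain ⟨hx, ha⟩ := aux _ _ hmod
  rw [PadicInt.toZMod_three_eq_zero_iff] at hx ha
  refine ⟨hx, ha, ?_⟩
  obtain ⟨k, rfl⟩ := hx
  obtain ⟨l, rfl⟩ := ha
  have h3 : (3 : ℤ_[3]) ≠ 0 := by norm_num
  have hp : Prime (3 : ℤ_[3]) := by simpa using PadicInt.prime_p (p := 3)
  refine hp.dvd_of_dvd_pow (n := 2)
    ⟨3 * (2 * b + 1) * l ^ 2 + 4 * b * l * c + b ^ 2 * c ^ 2 - k ^ 2 - l ^ 2, ?_⟩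
  apply mul_left_cancel₀ h3
  linear_combination h

theorem Padic.eq_zero_of_sq_add_sq_eq {b x a c : ℚ_[3]} (hb : ‖b‖ ≤ 1)
    (h : x ^ 2 + a ^ 2 = 3 * ((2 * b + 1) * a ^ 2 + 4 * b * a * c + (3 * b ^ 2 - 1) * c ^ 2)) :
    x = 0 ∧ a = 0 ∧ c = 0 := by
  obtain ⟨t, ht, hx, ha, hc⟩ : ∃ t, (t = x ∨ t = a ∨ t = c) ∧ ‖x‖ ≤ ‖t‖ ∧ ‖a‖ ≤ ‖t‖ ∧ ‖c‖ ≤ ‖t‖ := by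
    rcases le_total ‖x‖ ‖a‖ with h1 | h1 <;> rcases le_total ‖a‖ ‖c‖ with h2 | h2 <;>
      rcases le_total ‖x‖ ‖c‖ with h3 | h3
    all_goals first
      | exact ⟨x, by simp, le_refl _, by linarith, by linarith⟩
      | exact ⟨a, by simp, by linarith, le_refl _, by linarith⟩
      | exact ⟨c, by simp, by linarith, by linarith, le_refl _⟩
  rcases eq_or_ne t 0 with rfl | ht0
  · simpa using And.intro hx (And.intro ha hc)
  exfalso
  have scale : ∀ z : ℚ_[3], ‖z‖ ≤ ‖t‖ → ∃ w : ℤ_[3], z = w * t := fun z hz =>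
    ⟨⟨z / t, by rw [norm_div]; exact div_le_one_of_le₀ hz (norm_nonneg t)⟩,
      (div_mul_cancel₀ z ht0).symm⟩
  obtain ⟨b, rfl⟩ : ∃ b' : ℤ_[3], (b' : ℚ_[3]) = b := ⟨⟨b, hb⟩, rfl⟩
  obtain ⟨x, rfl⟩ := scale x hx
  obtain ⟨a, rfl⟩ := scale a ha
  obtain ⟨c, rfl⟩ := scale c hc
  have h' : x ^ 2 + a ^ 2 =
      3 * ((2 * b + 1) * a ^ 2 + 4 * b * a * c + (3 * b ^ 2 - 1) * c ^ 2) := by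
    have : (x : ℚ_[3]) ^ 2 + a ^ 2 =
        3 * ((2 * b + 1) * a ^ 2 + 4 * b * a * c + (3 * b ^ 2 - 1) * c ^ 2) := by
      apply mul_right_cancel₀ (pow_ne_zero 2 ht0)
      linear_combination h
    exact PadicInt.ext (by push_cast; exact this)
  have unit : ∀ w : ℤ_[3], t = w * t → ¬ 3 ∣ w := by
    intro w hw hdvd
    have : w = 1 := by
      have : (w : ℚ_[3]) = 1 := mul_right_cancel₀ ht0 (by rw [← hw, one_mul])
      exact PadicInt.ext (by push_cast; exact this)
    rw [this, ← PadicInt.toZMod_three_eq_zero_iff, map_one] at hdvd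
    exact one_ne_zero hdvd
  obtain ⟨h1, h2, h3⟩ := PadicInt.three_dvd_of_sq_add_sq_eq h'
  rcases ht with ht | ht | ht
  exacts [unit x ht h1, unit a ht h2, unit c ht h3]

theorem ternary_anisotropic {b a c e : ℚ_[3]} (hb : ‖b‖ ≤ 1)
    (h : (6 * b + 1) * a ^ 2 + 6 * b * a * c - 2 * a * e - 3 * c ^ 2 - 6 * b * c * e - e ^ 2 = 0) :
    a = 0 ∧ c = 0 ∧ e = 0 := by
  obtain ⟨h1, rfl, rfl⟩ := Padic.eq_zero_of_sq_add_sq_eq (x := e + a + 3 * b * c) (a := a) (c := c)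
    hb (by linear_combination -h)
  exact ⟨rfl, rfl, by simpa using h1⟩


instance : Fact (Nat.Prime 3) := ⟨by norm_num⟩

/-- For every `b ∈ ℤ₃` (i.e. `b ∈ ℚ₃` with `‖b‖ ≤ 1`), the quadric `V(bQ₀ + Q∞) ⊂ ℙ⁴`
contains no `ℚ₃`-rational line: there is no 2-dimensional `ℚ₃`-linear subspace of `ℚ₃⁵`
on which `b·Q₀ + Q∞` vanishes identically. -/
theorem stmt2 (d : ℤ) (hd : d ≠ 0) (b : ℚ_[3]) (hb : ‖b‖ ≤ 1) :
    ¬ ∃ W : Submodule ℚ_[3] (Fin 5 → ℚ_[3]), Module.finrank ℚ_[3] W = 2 ∧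
        ∀ u ∈ W, b * Q0 d u + Qinf d u = 0 := by
  rintro ⟨W, hW, hQ⟩
  obtain ⟨s, hs, hs1⟩ := exists_sq_eq_one_add_three_mul_sq hb
  set x : (Fin 5 → ℚ_[3]) →ₗ[ℚ_[3]] ℚ_[3] :=
    b • LinearMap.proj 0 - (1 + s) • LinearMap.proj 1 with hx
  set y : (Fin 5 → ℚ_[3]) →ₗ[ℚ_[3]] ℚ_[3] :=
    (s + 1) • LinearMap.proj 0 + (3 * b) • LinearMap.proj 1 with hy
  have hx' : ∀ u, x u = b * u 0 - (1 + s) * u 1 := fun u => by simp [hx]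
  have hy' : ∀ u, y u = (s + 1) * u 0 + 3 * b * u 1 := fun u => by simp [hy]
  have hd' : (d : ℚ_[3]) ≠ 0 := by exact_mod_cast hd
  have key : ∀ u ∈ W, d * (x u * y u) + (s + 1) * ((6 * b + 1) * u 2 ^ 2 + 6 * b * u 2 * u 3
      - 2 * u 2 * u 4 - 3 * u 3 ^ 2 - 6 * b * u 3 * u 4 - u 4 ^ 2) = 0 := by
    intro u hu
    have h := hQ u hu
    simp only [Q0, Qinf] at h
    rw [hx', hy']
    linear_combination (s + 1) * h - d * u 0 * u 1 * hs
  have tail : ∀ u ∈ W, x u * y u = 0 → u 2 = 0 ∧ u 3 = 0 ∧ u 4 = 0 := by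
    intro u hu h0
    have h := key u hu
    rw [h0, mul_zero, zero_add] at h
    exact ternary_anisotropic hb ((mul_eq_zero.mp h).resolve_left hs1)
  have hxy : ∀ u ∈ W, x u = 0 → y u = 0 → u = 0 := by
    intro u hu h1 h2
    obtain ⟨h2', h3', h4'⟩ := tail u hu (by rw [h1, zero_mul])
    rw [hx'] at h1
    rw [hy'] at h2
    have hs0 : s ≠ 0 := by
      rintro rfl
      exact ne_zero_of_sq_eq_one_add_three_mul_sq hb hs rfl
    have hne : 2 * s * (s + 1) ≠ 0 := mul_ne_zero (mul_ne_zero two_ne_zero hs0) hs1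
    have h0' : u 0 = 0 := by
      refine (mul_eq_zero.mp ?_).resolve_left hne
      linear_combination 3 * b * h1 + (1 + s) * h2 + u 0 * hs
    have h1' : u 1 = 0 := by
      refine (mul_eq_zero.mp ?_).resolve_left hne
      linear_combination -(s + 1) * h1 + b * h2 + u 1 * hs
    ext i
    fin_cases i <;> assumption
  obtain ⟨u, hu, hu0, hxu⟩ := exists_mem_ne_zero_apply_eq_zero W (by omega) x
  obtain ⟨v, hv, hv0, hyv⟩ := exists_mem_ne_zero_apply_eq_zero W (by omega) y
  obtain ⟨u2, u3, u4⟩ := tail u hu (by rw [hxu, zero_mul])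
  obtain ⟨v2, v3, v4⟩ := tail v hv (by rw [hyv, mul_zero])
  have h := key (u + v) (W.add_mem hu hv)
  simp only [map_add, hxu, hyv, Pi.add_apply, u2, u3, u4, v2, v3, v4] at h
  have h' : d * (x v * y u) = 0 := by linear_combination h
  rcases mul_eq_zero.mp ((mul_eq_zero.mp h').resolve_left hd') with h'' | h''
  · exact hv0 (hxy v hv h'' hyv)
  · exact hu0 (hxy u hu hxu h'')
end

section
/- Let d be an integer with d ≡ 5 (mod 12) and suppose that for every prime p dividing d, every finite field extension L of ℚ_p, and every θ ∈ L satisfying θ^3 + 3θ^2 + 3θ - 9 = 0 and generating L over ℚ_p, the element θ is a square in L. Then for every pair (a,b) ∈ ℚ × ℚ with (a,b) ≠ (0,0), there is no 2-dimensional ℚ-linear subspace of ℚ^5 on which the quadratic form b·Q_0 + a·Q_∞ vanishes identically. (That is, no quadric hypersurface in P^4_ℚ containing the surface X_d contains a line defined over ℚ.) -/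
open Module

/-- The part of `b Q₀ + a Q∞` involving the last three variables. -/
def tern {R : Type*} [CommRing R] (a b x y z : R) : R :=
  b * (6 * x ^ 2 + 6 * x * y - 6 * y * z) + a * (x ^ 2 - 2 * x * z - 3 * y ^ 2 - z ^ 2)

theorem tern_smul {R : Type*} [CommRing R] (a b c x y z : R) :
    tern a b (c * x) (c * y) (c * z) = c ^ 2 * tern a b x y z := by
  unfold tern; ring

theorem exists_mem_ne_zero_of_functional {K M : Type*} [Field K] [AddCommGroup M] [Module K M]
    [FiniteDimensional K M] (V : Submodule K M) (hV : 2 ≤ finrank K V) (φ : M →ₗ[K] K) :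
    ∃ v ∈ V, v ≠ 0 ∧ φ v = 0 := by
  have h := LinearMap.finrank_range_add_finrank_ker (φ.domRestrict V)
  have h1 : finrank K (LinearMap.range (φ.domRestrict V)) ≤ 1 := by
    simpa using Submodule.finrank_le (LinearMap.range (φ.domRestrict V))
  have h2 : 0 < finrank K (LinearMap.ker (φ.domRestrict V)) := by omega
  have := Module.finrank_pos_iff.1 h2
  obtain ⟨⟨⟨v, hv⟩, hk⟩, hne⟩ := exists_ne (0 : LinearMap.ker (φ.domRestrict V))
  refine ⟨v, hv, ?_, by simpa using hk⟩
  rintro rfl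
  exact hne rfl

theorem isSquare_det_of_isotropic_pair {K : Type*} [Field K] (A : Matrix (Fin 4) (Fin 4) K)
    (hA : A.transpose = A) (w : Fin 2 → Fin 4 → K) (hw : LinearIndependent K w)
    (h : ∀ i j, w i ⬝ᵥ A.mulVec (w j) = 0) : IsSquare A.det := by
  obtain ⟨x, hx⟩ := exists_linearIndependent_snoc_of_lt_finrank hw (by simp)
  obtain ⟨y, hy⟩ := exists_linearIndependent_snoc_of_lt_finrank hx (by simp)
  set P : Matrix (Fin 4) (Fin 4) K := Fin.snoc (Fin.snoc w x : Fin 3 → Fin 4 → K) y with hP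
  have hdet : P.det ≠ 0 := by
    have : IsUnit P := Matrix.linearIndependent_rows_iff_isUnit.1 hy
    exact ((Matrix.isUnit_iff_isUnit_det P).1 this).ne_zero
  have hG : ∀ i j, (P * A * P.transpose) i j = P i ⬝ᵥ A.mulVec (P j) := by
    intro i j
    rw [Matrix.mul_assoc, Matrix.mul_apply_eq_vecMul]
    simp [Matrix.vecMul, Matrix.mul_apply, Matrix.mulVec, dotProduct]
  have hsymm : ∀ i j, (P * A * P.transpose) i j = (P * A * P.transpose) j i := by
    intro i j
    conv_rhs => rw [← Matrix.transpose_apply (P * A * P.transpose)]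
    rw [Matrix.transpose_mul, Matrix.transpose_mul, hA, Matrix.transpose_transpose,
      Matrix.mul_assoc]
  have hP0 : P 0 = w 0 := rfl
  have hP1 : P 1 = w 1 := rfl
  generalize hGG : P * A * P.transpose = G at hG hsymm
  have h00 : G 0 0 = 0 := by rw [hG, hP0, h]
  have h01 : G 0 1 = 0 := by rw [hG, hP0, hP1, h]
  have h11 : G 1 1 = 0 := by rw [hG, hP1, h]
  have hGdet : G.det = (G 0 2 * G 1 3 - G 0 3 * G 1 2) ^ 2 := by
    have hGe : G = !![0, 0, G 0 2, G 0 3; 0, 0, G 1 2, G 1 3;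
        G 0 2, G 1 2, G 2 2, G 2 3; G 0 3, G 1 3, G 2 3, G 3 3] := by
      ext i j
      fin_cases i <;> fin_cases j <;>
        first
        | rfl
        | exact h00
        | exact h01
        | exact h11
        | exact (hsymm _ _).trans h01
        | exact hsymm _ _
    conv_lhs => rw [hGe]
    rw [Matrix.det_succ_row_zero]
    simp [Fin.sum_univ_succ, Matrix.det_fin_three, Fin.succAbove]
    ring
  refine ⟨(G 0 2 * G 1 3 - G 0 3 * G 1 2) / P.det, ?_⟩
  have : P.det * A.det * P.det = (G 0 2 * G 1 3 - G 0 3 * G 1 2) ^ 2 := by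
    rw [← hGdet, ← hGG, Matrix.det_mul, Matrix.det_mul, Matrix.det_transpose]
  field_simp
  linear_combination this

theorem isSquare_of_isotropic_plane {K : Type*} [Field K] (h2 : (2 : K) ≠ 0) (α a b : K)
    (V : Submodule K (Fin 4 → K)) (hV : 2 ≤ finrank K V)
    (h : ∀ v ∈ V, α * v 0 ^ 2 + b * tern a b (v 1) (v 2) (v 3) = 0) :
    IsSquare (α * (6 * b ^ 3 * (a ^ 3 + 3 * a ^ 2 * b + 3 * a * b ^ 2 - 9 * b ^ 3))) := by
  obtain ⟨f, hf⟩ := exists_linearIndependent_of_le_finrank hV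
  let A : Matrix (Fin 4) (Fin 4) K := !![α, 0, 0, 0;
    0, b * (6 * b + a), b * (3 * b), b * (-a);
    0, b * (3 * b), b * (-3 * a), b * (-3 * b);
    0, b * (-a), b * (-3 * b), b * (-a)]
  have hA : A.transpose = A := by
    ext i j; fin_cases i <;> fin_cases j <;> rfl
  have hdet : A.det = α * (6 * b ^ 3 * (a ^ 3 + 3 * a ^ 2 * b + 3 * a * b ^ 2 - 9 * b ^ 3)) := by
    rw [Matrix.det_succ_row_zero]
    simp [A, Fin.sum_univ_succ, Matrix.det_fin_three, Fin.succAbove]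
    left; ring
  rw [← hdet]
  have hq : ∀ v : Fin 4 → K, v ⬝ᵥ A.mulVec v =
      α * v 0 ^ 2 + b * tern a b (v 1) (v 2) (v 3) := by
    intro v
    simp [A, Matrix.mulVec, dotProduct, Fin.sum_univ_succ, tern]
    ring
  refine isSquare_det_of_isotropic_pair A hA (fun i => (f i : Fin 4 → K))
    (hf.map' V.subtype (Submodule.ker_subtype V)) fun i j => ?_
  have h1 : (f i : Fin 4 → K) ⬝ᵥ A.mulVec (f i) = 0 := by rw [hq]; exact h _ (f i).2
  have h3 : (f j : Fin 4 → K) ⬝ᵥ A.mulVec (f j) = 0 := by rw [hq]; exact h _ (f j).2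
  have h4 : ((f i : Fin 4 → K) + (f j : Fin 4 → K)) ⬝ᵥ
      A.mulVec ((f i : Fin 4 → K) + (f j : Fin 4 → K)) = 0 := by
    rw [hq]; exact h _ (V.add_mem (f i).2 (f j).2)
  have h5 : (f j : Fin 4 → K) ⬝ᵥ A.mulVec (f i) = (f i : Fin 4 → K) ⬝ᵥ A.mulVec (f j) := by
    rw [Matrix.dotProduct_mulVec, ← Matrix.mulVec_transpose, hA, dotProduct_comm]
  rw [Matrix.mulVec_add, add_dotProduct, dotProduct_add, dotProduct_add, h1, h3, h5] at h4
  have : (2 : K) * ((f i : Fin 4 → K) ⬝ᵥ A.mulVec (f j)) = 0 := by linear_combination h4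
  exact (mul_eq_zero.1 this).resolve_left h2

theorem exists_reduction {n : ℕ} (p : ℕ) [Fact p.Prime] (W : Submodule ℚ (Fin n → ℚ)) :
    ∃ V : Submodule (ZMod p) (Fin n → ZMod p), finrank ℚ W ≤ finrank (ZMod p) V ∧
      ∀ v ∈ V, ∃ w : Fin n → ℤ, (fun i => (w i : ℚ)) ∈ W ∧ ∀ i, (w i : ZMod p) = v i := by
  let ι : (Fin n → ℤ) →ₗ[ℤ] (Fin n → ℚ) := (Int.castAddHom ℚ).toIntLinearMap.compLeft (Fin n)
  let ρ : (Fin n → ℤ) →ₗ[ℤ] (Fin n → ZMod p) :=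
    (Int.castAddHom (ZMod p)).toIntLinearMap.compLeft (Fin n)
  have hι : ∀ w, ι w = fun i => (w i : ℚ) := fun w => rfl
  have hρ : ∀ w i, ρ w i = (w i : ZMod p) := fun w i => rfl
  let Λ : Submodule ℤ (Fin n → ℤ) := (W.restrictScalars ℤ).comap ι
  have hΛ : ∀ w, w ∈ Λ ↔ ι w ∈ W := fun w => Iff.rfl
  obtain ⟨r, ⟨B⟩⟩ := Submodule.nonempty_basis_of_pid (Pi.basisFun ℤ (Fin n)) Λ
  have hr : finrank ℚ W ≤ r := by
    have hle : W ≤ Submodule.span ℚ (Set.range fun i => ι (B i)) := by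
      intro w hw
      obtain ⟨⟨m, hm⟩, hint⟩ := IsLocalization.exist_integer_multiples_of_finite
        (nonZeroDivisors ℤ) w
      choose z hz using hint
      have hm0 : (m : ℚ) ≠ 0 := by exact_mod_cast nonZeroDivisors.ne_zero hm
      have hzw : ι z = (m : ℚ) • w := by
        ext i
        have := hz i
        simpa [hι] using this
      have hzΛ : z ∈ Λ := by
        rw [hΛ, hzw]; exact W.smul_mem _ hw
      have hsum := B.sum_repr ⟨z, hzΛ⟩
      have hz' : ι z = ∑ i, (B.repr ⟨z, hzΛ⟩ i : ℚ) • ι (B i) := by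
        have h1 := congrArg (fun x : Λ => ι x) hsum
        simp only [AddSubmonoidClass.coe_finsetSum, map_sum] at h1
        rw [← h1]
        refine Finset.sum_congr rfl fun i _ => ?_
        ext k
        simp [hι]
      have : w = (m : ℚ)⁻¹ • ι z := by rw [hzw, smul_smul, inv_mul_cancel₀ hm0, one_smul]
      rw [this, hz']
      exact Submodule.smul_mem _ _ (Submodule.sum_mem _ fun i _ =>
        Submodule.smul_mem _ _ (Submodule.subset_span ⟨i, rfl⟩))
    refine (Submodule.finrank_mono hle).trans ?_
    simpa [Set.finrank] using finrank_range_le_card (R := ℚ) fun i => ι (B i)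
  have hli : LinearIndependent (ZMod p) fun i => ρ (B i) := by
    rw [Fintype.linearIndependent_iff]
    intro g hg
    choose c hc using fun i => ZMod.intCast_surjective (g i)
    have hu : ∀ k, (p : ℤ) ∣ (∑ i, c i • (B i : Fin n → ℤ)) k := by
      intro k
      rw [← ZMod.intCast_zmod_eq_zero_iff_dvd]
      simpa [hρ, hc] using congrFun hg k
    choose u hu using hu
    have hpu : (∑ i, c i • (B i : Fin n → ℤ)) = (p : ℤ) • u := by
      ext k; rw [hu]; rfl
    have hmem : (p : ℤ) • u ∈ Λ := by
      rw [← hpu]; exact Submodule.sum_mem _ fun i _ => Λ.smul_mem _ (B i).2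
    have hp0 : (p : ℚ) ≠ 0 := by exact_mod_cast (Fact.out : p.Prime).ne_zero
    have humem : u ∈ Λ := by
      have h1 : (p : ℚ)⁻¹ • ι ((p : ℤ) • u) ∈ W := W.smul_mem _ hmem
      have h2 : (p : ℚ)⁻¹ • ι ((p : ℤ) • u) = ι u := by
        ext k; simp [hι, hp0]
      rwa [h2] at h1
    have heq : (∑ i, c i • B i) = (p : ℤ) • (⟨u, humem⟩ : Λ) := by
      apply Subtype.ext
      simpa using hpu
    intro i
    have h3 := congrArg (fun x => B.repr x i) heq
    simp only [map_sum, map_smul, Basis.repr_self, Finsupp.coe_finsetSum, Finset.sum_apply,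
      Finsupp.smul_apply, Finsupp.single_apply, smul_eq_mul] at h3
    simp at h3
    rw [← hc, h3]
    simp
  refine ⟨Submodule.span (ZMod p) (Set.range fun i => ρ (B i)), ?_, ?_⟩
  · rw [finrank_span_eq_card hli]; simpa using hr
  · intro v hv
    obtain ⟨g, rfl⟩ := (Submodule.mem_span_range_iff_exists_fun _).1 hv
    choose c hc using fun i => ZMod.intCast_surjective (g i)
    refine ⟨∑ i, c i • (B i : Fin n → ℤ), ?_, fun k => ?_⟩
    · exact Submodule.sum_mem Λ fun i _ => Λ.smul_mem _ (B i).2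
    · simp [hρ, hc]

theorem finrank_le_finrank_range_domRestrict {K M N : Type*} [Field K] [AddCommGroup M]
    [Module K M] [AddCommGroup N] [Module K N] (V : Submodule K M) (π : M →ₗ[K] N)
    (h : ∀ v ∈ V, π v = 0 → v = 0) :
    finrank K V ≤ finrank K (LinearMap.range (π.domRestrict V)) := by
  refine (LinearMap.finrank_range_of_inj (f := π.domRestrict V) ?_).ge
  rw [← LinearMap.ker_eq_bot, LinearMap.ker_eq_bot']
  intro v hv
  exact Subtype.ext (h v v.2 hv)

theorem two_ne_zero_and_three_ne_zero {p : ℕ} (hp : p.Prime) (hp2 : p ≠ 2) (hp3 : p ≠ 3) :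
    (2 : ZMod p) ≠ 0 ∧ (3 : ZMod p) ≠ 0 := by
  constructor
  · intro h
    have : p ∣ 2 := by rw [← ZMod.natCast_eq_zero_iff]; exact_mod_cast h
    exact hp2 ((Nat.prime_dvd_prime_iff_eq hp Nat.prime_two).1 this)
  · intro h
    have : p ∣ 3 := by rw [← ZMod.natCast_eq_zero_iff]; exact_mod_cast h
    exact hp3 ((Nat.prime_dvd_prime_iff_eq hp Nat.prime_three).1 this)

theorem isSquare_of_dvd_norm {p : ℕ} [Fact p.Prime] (hp2 : p ≠ 2) (hp3 : p ≠ 3)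
    {α β a b : ℤ} (hβ : ¬ (p : ℤ) ∣ β) (hb : ¬ (p : ℤ) ∣ b)
    (hN : (p : ℤ) ∣ a ^ 2 + 3 * b ^ 2) (W : Submodule ℚ (Fin 5 → ℚ)) (hW : 2 ≤ finrank ℚ W)
    (h : ∀ v ∈ W, (α : ℚ) * v 0 ^ 2 + p * β * v 1 ^ 2
      + b * tern (a : ℚ) b (v 2) (v 3) (v 4) = 0) :
    IsSquare (α : ZMod p) := by
  have hp : p.Prime := Fact.out
  have hpZ : Prime (p : ℤ) := Nat.prime_iff_prime_int.1 hp
  obtain ⟨h2, h3⟩ := two_ne_zero_and_three_ne_zero hp hp2 hp3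
  obtain ⟨V, hV, hlift⟩ := exists_reduction p W
  have hint : ∀ w : Fin 5 → ℤ, (fun i => (w i : ℚ)) ∈ W →
      α * w 0 ^ 2 + p * β * w 1 ^ 2 + b * tern a b (w 2) (w 3) (w 4) = 0 := by
    intro w hw
    have := h _ hw
    unfold tern at this ⊢
    exact_mod_cast this
  let π : (Fin 5 → ZMod p) →ₗ[ZMod p] (Fin 4 → ZMod p) :=
    LinearMap.funLeft (ZMod p) (ZMod p) ![0, 2, 3, 4]
  have hinj : ∀ v ∈ V, π v = 0 → v = 0 := by
    intro v hv h0
    obtain ⟨w, hw, hwv⟩ := hlift v hv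
    have v0 : v 0 = 0 := congrFun h0 0
    have v2 : v 2 = 0 := congrFun h0 1
    have v3 : v 3 = 0 := congrFun h0 2
    have v4 : v 4 = 0 := congrFun h0 3
    obtain ⟨x0, e0⟩ := (ZMod.intCast_zmod_eq_zero_iff_dvd (w 0) p).1 ((hwv 0).trans v0)
    obtain ⟨x2, e2⟩ := (ZMod.intCast_zmod_eq_zero_iff_dvd (w 2) p).1 ((hwv 2).trans v2)
    obtain ⟨x3, e3⟩ := (ZMod.intCast_zmod_eq_zero_iff_dvd (w 3) p).1 ((hwv 3).trans v3)
    obtain ⟨x4, e4⟩ := (ZMod.intCast_zmod_eq_zero_iff_dvd (w 4) p).1 ((hwv 4).trans v4)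
    have e := hint w hw
    rw [e0, e2, e3, e4, tern_smul] at e
    have hd : (p : ℤ) ∣ β * w 1 ^ 2 := by
      refine ⟨-(α * x0 ^ 2 + b * tern a b x2 x3 x4), ?_⟩
      apply mul_left_cancel₀ hpZ.ne_zero
      linear_combination e
    have hd1 := hpZ.dvd_of_dvd_pow ((hpZ.dvd_or_dvd hd).resolve_left hβ)
    have v1 : v 1 = 0 := by
      rw [← hwv 1]; exact (ZMod.intCast_zmod_eq_zero_iff_dvd _ _).2 hd1
    ext i
    fin_cases i <;> assumption
  have hsq := isSquare_of_isotropic_plane h2 (α : ZMod p) (a : ZMod p) (b : ZMod p)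
    (LinearMap.range (π.domRestrict V))
    (hW.trans (hV.trans (finrank_le_finrank_range_domRestrict V π hinj))) (by
      rintro _ ⟨⟨v, hv⟩, rfl⟩
      obtain ⟨w, hw, hwv⟩ := hlift v hv
      have e := congrArg (Int.cast : ℤ → ZMod p) (hint w hw)
      unfold tern at e ⊢
      push_cast at e
      simp only [hwv, CharP.cast_eq_zero] at e
      simp [π, LinearMap.funLeft_apply]
      linear_combination e)
  have hb' : (b : ZMod p) ≠ 0 := by rwa [Ne, ZMod.intCast_zmod_eq_zero_iff_dvd]
  have hN' : (a : ZMod p) ^ 2 + 3 * (b : ZMod p) ^ 2 = 0 := by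
    have := (ZMod.intCast_zmod_eq_zero_iff_dvd _ p).2 hN
    exact_mod_cast this
  have ha' : (a : ZMod p) ≠ 0 := by
    intro ha
    rw [ha] at hN'
    have : (3 : ZMod p) * (b : ZMod p) ^ 2 = 0 := by linear_combination hN'
    simp [h3, hb'] at this
  obtain ⟨s, hs⟩ := hsq
  have h6 : (6 : ZMod p) ≠ 0 := by
    have := mul_ne_zero h2 h3
    norm_num at this
    exact this
  refine ⟨s / (6 * a * b ^ 2), ?_⟩
  field_simp
  linear_combination hs - (α : ZMod p) * (6 * b ^ 3 * (a + 3 * b) - 36 * b ^ 4) * hN'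

theorem isSquare_or_of_plane {p : ℕ} [Fact p.Prime] (hp2 : p ≠ 2) (hp3 : p ≠ 3)
    {γ n a b : ℤ} (hγ : ¬ (p : ℤ) ∣ γ) (hb : ¬ (p : ℤ) ∣ b)
    (W : Submodule ℚ (Fin 5 → ℚ)) (hW : 2 ≤ finrank ℚ W)
    (h : ∀ v ∈ W, (p : ℚ) * γ * (v 0 ^ 2 - n * v 1 ^ 2)
      + b * tern (a : ℚ) b (v 2) (v 3) (v 4) = 0) :
    IsSquare (n : ZMod p) ∨
      ((a : ZMod p) ^ 3 + 3 * a ^ 2 * b + 3 * a * b ^ 2 - 9 * b ^ 3 = 0 ∧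
        IsSquare (-3 * ((a : ZMod p) ^ 2 - 3 * b ^ 2))) := by
  have hp : p.Prime := Fact.out
  have hpZ : Prime (p : ℤ) := Nat.prime_iff_prime_int.1 hp
  obtain ⟨h2, h3⟩ := two_ne_zero_and_three_ne_zero hp hp2 hp3
  obtain ⟨V, hV, hlift⟩ := exists_reduction p W
  have hb' : (b : ZMod p) ≠ 0 := by rwa [Ne, ZMod.intCast_zmod_eq_zero_iff_dvd]
  have hint : ∀ w : Fin 5 → ℤ, (fun i => (w i : ℚ)) ∈ W →
      p * γ * (w 0 ^ 2 - n * w 1 ^ 2) + b * tern a b (w 2) (w 3) (w 4) = 0 := by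
    intro w hw
    have := h _ hw
    unfold tern at this ⊢
    exact_mod_cast this
  have hmod : ∀ v ∈ V, tern (a : ZMod p) b (v 2) (v 3) (v 4) = 0 := by
    intro v hv
    obtain ⟨w, hw, hwv⟩ := hlift v hv
    have e := congrArg (Int.cast : ℤ → ZMod p) (hint w hw)
    unfold tern at e ⊢
    push_cast at e
    simp only [hwv, CharP.cast_eq_zero] at e
    apply mul_left_cancel₀ hb'
    linear_combination e
  by_cases hz : ∃ v ∈ V, v ≠ 0 ∧ v 2 = 0 ∧ v 3 = 0 ∧ v 4 = 0
  · left
    obtain ⟨v, hv, hne, v2, v3, v4⟩ := hz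
    obtain ⟨w, hw, hwv⟩ := hlift v hv
    obtain ⟨x2, e2⟩ := (ZMod.intCast_zmod_eq_zero_iff_dvd (w 2) p).1 ((hwv 2).trans v2)
    obtain ⟨x3, e3⟩ := (ZMod.intCast_zmod_eq_zero_iff_dvd (w 3) p).1 ((hwv 3).trans v3)
    obtain ⟨x4, e4⟩ := (ZMod.intCast_zmod_eq_zero_iff_dvd (w 4) p).1 ((hwv 4).trans v4)
    have e := hint w hw
    rw [e2, e3, e4, tern_smul] at e
    have hd : (p : ℤ) ∣ γ * (w 0 ^ 2 - n * w 1 ^ 2) := by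
      refine ⟨-(b * tern a b x2 x3 x4), ?_⟩
      apply mul_left_cancel₀ hpZ.ne_zero
      linear_combination e
    have hd' := (ZMod.intCast_zmod_eq_zero_iff_dvd _ p).2 ((hpZ.dvd_or_dvd hd).resolve_left hγ)
    push_cast at hd'
    rw [hwv, hwv] at hd'
    have v1 : v 1 ≠ 0 := by
      intro v1
      have v0 : v 0 = 0 := by
        rw [v1] at hd'
        exact pow_eq_zero_iff two_ne_zero |>.1 (by linear_combination hd')
      apply hne
      ext i
      fin_cases i <;> assumption
    refine ⟨v 0 / v 1, ?_⟩
    field_simp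
    linear_combination -hd'
  · have hz' : ∀ v ∈ V, v 2 = 0 → v 3 = 0 → v 4 = 0 → v = 0 := by
      intro v hv v2 v3 v4
      by_contra hne
      exact hz ⟨v, hv, hne, v2, v3, v4⟩
    right
    have hF : (a : ZMod p) ^ 3 + 3 * a ^ 2 * b + 3 * a * b ^ 2 - 9 * b ^ 3 = 0 := by
      by_contra hF
      obtain ⟨c, hc⟩ := FiniteField.exists_nonsquare (F := ZMod p) (by
        rwa [ZMod.ringChar_zmod_n])
      have h6 : (6 : ZMod p) ≠ 0 := by
        have := mul_ne_zero h2 h3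
        norm_num at this
        exact this
      have hne : 6 * (b : ZMod p) ^ 3 *
          ((a : ZMod p) ^ 3 + 3 * a ^ 2 * b + 3 * a * b ^ 2 - 9 * b ^ 3) ≠ 0 :=
        mul_ne_zero (mul_ne_zero h6 (pow_ne_zero _ hb')) hF
      let π : (Fin 5 → ZMod p) →ₗ[ZMod p] (Fin 4 → ZMod p) :=
        LinearMap.pi ![0, LinearMap.proj 2, LinearMap.proj 3, LinearMap.proj 4]
      have hsq := isSquare_of_isotropic_plane h2 (c / (6 * (b : ZMod p) ^ 3 *
          ((a : ZMod p) ^ 3 + 3 * a ^ 2 * b + 3 * a * b ^ 2 - 9 * b ^ 3))) (a : ZMod p)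
        (b : ZMod p) (LinearMap.range (π.domRestrict V))
        (hW.trans (hV.trans (finrank_le_finrank_range_domRestrict V π fun v hv h0 =>
          hz' v hv (congrFun h0 1) (congrFun h0 2) (congrFun h0 3)))) (by
          rintro _ ⟨⟨v, hv⟩, rfl⟩
          have := hmod v hv
          simp [π, this])
      rw [div_mul_cancel₀ _ hne] at hsq
      exact hc hsq
    refine ⟨hF, ?_⟩
    obtain ⟨v, hv, hne, hv2⟩ := exists_mem_ne_zero_of_functional V (hW.trans hV)
      (LinearMap.proj 2 : (Fin 5 → ZMod p) →ₗ[ZMod p] ZMod p)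
    replace hv2 : v 2 = 0 := hv2
    have e := hmod v hv
    rw [hv2] at e
    unfold tern at e
    have ha' : (a : ZMod p) ≠ 0 := by
      intro ha
      rw [ha] at hF
      have : (3 : ZMod p) ^ 2 * (b : ZMod p) ^ 3 = 0 := by linear_combination -hF
      simp [h3, hb'] at this
    have hsq : -3 * ((a : ZMod p) ^ 2 - 3 * b ^ 2) * v 3 ^ 2 = (a * v 4 + 3 * b * v 3) ^ 2 := by
      linear_combination (a : ZMod p) * e
    have v3 : v 3 ≠ 0 := by
      intro v3
      rw [v3] at hsq
      have : (a : ZMod p) * v 4 = 0 :=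
        pow_eq_zero_iff two_ne_zero |>.1 (by linear_combination -hsq)
      exact hne (hz' v hv hv2 v3 ((mul_eq_zero.1 this).resolve_left ha'))
    refine ⟨(a * v 4 + 3 * b * v 3) / v 3, ?_⟩
    field_simp
    linear_combination hsq

theorem three_dvd_of_plane {d a b : ℤ} (hd : ¬ 3 ∣ d)
    (W : Submodule ℚ (Fin 5 → ℚ)) (hW : 2 ≤ finrank ℚ W)
    (h : ∀ v ∈ W, (d : ℚ) * (b * (v 0 ^ 2 - 3 * v 1 ^ 2) - 2 * a * v 0 * v 1)
      + tern (a : ℚ) b (v 2) (v 3) (v 4) = 0) : 3 ∣ a := by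
  by_contra ha
  have haniso : ∀ x z : ZMod 3, x ^ 2 - 2 * x * z - z ^ 2 = 0 → x = 0 ∧ z = 0 := by decide
  have h2 : (-2 : ZMod 3) ≠ 0 := by decide
  have : Fact (Nat.Prime 3) := ⟨Nat.prime_three⟩
  have hpZ : Prime (3 : ℤ) := Int.prime_three
  obtain ⟨V, hV, hlift⟩ := exists_reduction 3 W
  replace hV := hW.trans hV
  have ha' : (a : ZMod 3) ≠ 0 := by rwa [Ne, ZMod.intCast_zmod_eq_zero_iff_dvd]
  have hd' : (d : ZMod 3) ≠ 0 := by rwa [Ne, ZMod.intCast_zmod_eq_zero_iff_dvd]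
  have hint : ∀ w : Fin 5 → ℤ, (fun i => (w i : ℚ)) ∈ W →
      d * (b * (w 0 ^ 2 - 3 * w 1 ^ 2) - 2 * a * w 0 * w 1) + tern a b (w 2) (w 3) (w 4) = 0 := by
    intro w hw
    have := h _ hw
    unfold tern at this ⊢
    exact_mod_cast this
  have h3 : (3 : ZMod 3) = 0 := rfl
  have hmod : ∀ v ∈ V, (d : ZMod 3) * v 0 * (b * v 0 - 2 * a * v 1)
      + a * (v 2 ^ 2 - 2 * v 2 * v 4 - v 4 ^ 2) = 0 := by
    intro v hv
    obtain ⟨w, hw, hwv⟩ := hlift v hv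
    have e := congrArg (Int.cast : ℤ → ZMod 3) (hint w hw)
    unfold tern at e
    push_cast at e
    simp only [hwv] at e
    linear_combination e + (d * b * v 1 ^ 2 - 2 * b * (v 2 ^ 2 + v 2 * v 3 - v 3 * v 4)
      + a * v 3 ^ 2) * h3
  have hne3 : ∀ v ∈ V, v 0 = 0 → v 1 = 0 → v 2 = 0 → v 4 = 0 → v = 0 := by
    intro v hv v0 v1 v2 v4
    obtain ⟨w, hw, hwv⟩ := hlift v hv
    obtain ⟨x0, e0⟩ := (ZMod.intCast_zmod_eq_zero_iff_dvd (w 0) 3).1 ((hwv 0).trans v0)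
    obtain ⟨x1, e1⟩ := (ZMod.intCast_zmod_eq_zero_iff_dvd (w 1) 3).1 ((hwv 1).trans v1)
    obtain ⟨x2, e2⟩ := (ZMod.intCast_zmod_eq_zero_iff_dvd (w 2) 3).1 ((hwv 2).trans v2)
    obtain ⟨x4, e4⟩ := (ZMod.intCast_zmod_eq_zero_iff_dvd (w 4) 3).1 ((hwv 4).trans v4)
    have e := hint w hw
    rw [e0, e1, e2, e4] at e
    unfold tern at e
    push_cast at e
    have hdv : (3 : ℤ) ∣ a * w 3 ^ 2 := by
      refine ⟨d * (b * (x0 ^ 2 - 3 * x1 ^ 2) - 2 * a * x0 * x1) + b * (6 * x2 ^ 2 + 2 * x2 * w 3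
        - 2 * w 3 * x4) + a * (x2 ^ 2 - 2 * x2 * x4 - x4 ^ 2), ?_⟩
      linarith
    have hd1 := hpZ.dvd_of_dvd_pow ((hpZ.dvd_or_dvd hdv).resolve_left ha)
    have v3 : v 3 = 0 := by
      rw [← hwv 3]; exact (ZMod.intCast_zmod_eq_zero_iff_dvd _ 3).2 hd1
    ext i
    fin_cases i <;> assumption
  obtain ⟨v, hv, hvne, v0⟩ := exists_mem_ne_zero_of_functional V hV
    (LinearMap.proj 0 : (Fin 5 → ZMod 3) →ₗ[ZMod 3] ZMod 3)
  replace v0 : v 0 = 0 := v0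
  have ev := hmod v hv
  rw [v0] at ev
  obtain ⟨v2, v4⟩ := haniso (v 2) (v 4) (mul_left_cancel₀ ha' (by linear_combination ev))
  have v1 : v 1 ≠ 0 := fun v1 => hvne (hne3 v hv v0 v1 v2 v4)
  obtain ⟨u, hu, hune, hu0⟩ := exists_mem_ne_zero_of_functional V hV
    ((b : ZMod 3) • LinearMap.proj 0 - (2 * a : ZMod 3) • LinearMap.proj 1 :
      (Fin 5 → ZMod 3) →ₗ[ZMod 3] ZMod 3)
  replace hu0 : (b : ZMod 3) * u 0 - 2 * a * u 1 = 0 := hu0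
  have eu := hmod u hu
  obtain ⟨u2, u4⟩ := haniso (u 2) (u 4) (mul_left_cancel₀ ha' (by
    linear_combination eu - (d : ZMod 3) * u 0 * hu0))
  have euv := hmod (u + v) (V.add_mem hu hv)
  simp only [Pi.add_apply, v0, v2, v4, u2, u4] at euv
  have hprod : (-2 : ZMod 3) * a * d * v 1 * u 0 = 0 := by
    linear_combination euv - (d : ZMod 3) * u 0 * hu0
  have u0 : u 0 = 0 := (mul_eq_zero.1 hprod).resolve_left
    (mul_ne_zero (mul_ne_zero (mul_ne_zero h2 ha') hd') v1)
  have u1 : u 1 = 0 := by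
    have : (-2 : ZMod 3) * a * u 1 = 0 := by rw [u0] at hu0; linear_combination hu0
    exact (mul_eq_zero.1 this).resolve_left (mul_ne_zero h2 ha')
  exact hune (hne3 u hu u0 u1 u2 u4)

theorem isSquare_of_isRoot {p : ℕ} [Fact p.Prime] (hp2 : p ≠ 2) (hp3 : p ≠ 3)
    (hloc : ∀ θ : ℚ_[p], θ ^ 3 + 3 * θ ^ 2 + 3 * θ - 9 = 0 → ∃ s : ℚ_[p], s ^ 2 = θ)
    (t : ZMod p) (ht : t ^ 3 + 3 * t ^ 2 + 3 * t - 9 = 0) : IsSquare t := by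
  have hp : p.Prime := Fact.out
  obtain ⟨h2, h3⟩ := two_ne_zero_and_three_ne_zero hp hp2 hp3
  by_cases h1 : t = -1
  · subst h1
    have h10 : (10 : ZMod p) = 0 := by linear_combination -ht
    have h5 : (5 : ZMod p) = 0 := by
      apply mul_left_cancel₀ h2
      linear_combination h10
    exact ⟨2, by linear_combination -h5⟩
  · obtain ⟨x, hx⟩ := ZMod.ringHom_surjective (PadicInt.toZMod (p := p)) t
    have hnorm : ∀ y : ℤ_[p], ‖y‖ < 1 ↔ PadicInt.toZMod y = 0 := by
      intro y
      rw [← RingHom.mem_ker, PadicInt.ker_toZMod, PadicInt.mem_nonunits.symm]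
      rfl
    let F : Polynomial ℤ_[p] := Polynomial.X ^ 3 + 3 * Polynomial.X ^ 2 + 3 * Polynomial.X - 9
    have hF : ∀ y : ℤ_[p], Polynomial.aeval y F = y ^ 3 + 3 * y ^ 2 + 3 * y - 9 := by
      intro y; simp [F]
    have hF' : ∀ y : ℤ_[p], Polynomial.aeval y (Polynomial.derivative F) = 3 * (y + 1) ^ 2 := by
      intro y; simp [F]; ring
    have hder : ‖Polynomial.aeval x (Polynomial.derivative F)‖ = 1 := by
      refine le_antisymm (PadicInt.norm_le_one _) (not_lt.1 ?_)
      rw [hnorm, hF']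
      simp only [map_mul, map_pow, map_add, map_one, hx, map_ofNat]
      refine mul_ne_zero h3 (pow_ne_zero _ fun h => h1 ?_)
      linear_combination h
    obtain ⟨z, hz, hzx, -, -⟩ := hensels_lemma (F := F) (a := x) (by
      rw [hder, one_pow, hnorm, hF]
      simpa only [map_sub, map_add, map_mul, map_pow, map_ofNat, hx] using ht)
    rw [hder, hnorm, map_sub, sub_eq_zero, hx] at hzx
    rw [hF] at hz
    obtain ⟨s, hs⟩ := hloc (z : ℚ_[p]) (by exact_mod_cast congrArg (Subtype.val) hz)
    have hs1 : ‖s‖ ≤ 1 := by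
      have : ‖s‖ ^ 2 ≤ 1 := by rw [← norm_pow, hs]; exact z.2
      exact (sq_le_one_iff₀ (norm_nonneg _)).1 this
    let y : ℤ_[p] := ⟨s, hs1⟩
    have hy : z = y * y := Subtype.ext (by rw [← hs, sq]; rfl)
    exact ⟨PadicInt.toZMod y, by rw [← hzx, hy, map_mul]⟩

theorem exists_plane_linear_change (W : Submodule ℚ (Fin 5 → ℚ)) {q r s t : ℚ}
    (hdet : q * t - r * s ≠ 0) :
    ∃ W' : Submodule ℚ (Fin 5 → ℚ), finrank ℚ W ≤ finrank ℚ W' ∧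
      ∀ v ∈ W', ∃ u ∈ W, v 0 = q * u 0 + r * u 1 ∧ v 1 = s * u 0 + t * u 1 ∧
        v 2 = u 2 ∧ v 3 = u 3 ∧ v 4 = u 4 := by
  let φ : (Fin 5 → ℚ) →ₗ[ℚ] (Fin 5 → ℚ) :=
    LinearMap.pi ![q • LinearMap.proj 0 + r • LinearMap.proj 1,
      s • LinearMap.proj 0 + t • LinearMap.proj 1,
      LinearMap.proj 2, LinearMap.proj 3, LinearMap.proj 4]
  refine ⟨_, finrank_le_finrank_range_domRestrict W φ fun v _ h0 => ?_, ?_⟩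
  · have e0 : q * v 0 + r * v 1 = 0 := congrFun h0 0
    have e1 : s * v 0 + t * v 1 = 0 := congrFun h0 1
    have v2 : v 2 = 0 := congrFun h0 2
    have v3 : v 3 = 0 := congrFun h0 3
    have v4 : v 4 = 0 := congrFun h0 4
    have v0 : v 0 = 0 := mul_left_cancel₀ hdet (by linear_combination t * e0 - r * e1)
    have v1 : v 1 = 0 := mul_left_cancel₀ hdet (by linear_combination q * e1 - s * e0)
    ext i
    fin_cases i <;> assumption
  · rintro _ ⟨⟨u, hu⟩, rfl⟩
    exact ⟨u, hu, rfl, rfl, rfl, rfl, rfl⟩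

theorem jacobiSym_eq_one_of_forall_isSquare {a : ℤ} {n : ℕ}
    (h : ∀ (p : ℕ) [Fact p.Prime], p ∣ n → (a : ZMod p) ≠ 0 ∧ IsSquare (a : ZMod p)) :
    jacobiSym a n = 1 := by
  apply List.prod_eq_one
  intro x hx
  obtain ⟨p, hp, rfl⟩ := List.mem_pmap.1 hx
  have : Fact p.Prime := ⟨Nat.prime_of_mem_primeFactorsList hp⟩
  obtain ⟨h0, h1⟩ := h p (Nat.dvd_of_mem_primeFactorsList hp)
  exact (legendreSym.eq_one_iff p h0).2 h1

theorem jacobiSym_mul_swap {m n : ℕ} (hm : Odd m) (hn : Odd n) (hmn : m.Coprime n) :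
    jacobiSym m n * jacobiSym n m = if m % 4 = 3 ∧ n % 4 = 3 then -1 else 1 := by
  have h := jacobiSym.quadratic_reciprocity_if (Nat.odd_iff.1 hm) (Nat.odd_iff.1 hn)
  have h1 : jacobiSym n m ^ 2 = 1 := jacobiSym.sq_one (by simpa using hmn.symm)
  rw [← h]
  split_ifs
  · linear_combination -h1
  · linear_combination h1

theorem jacobiSym_natCast_mul_sign {g n : ℕ} {d : ℤ} (hg : Odd g) (hn : Odd n)
    (hd : (g * d : ℤ) % 4 = 1) (hgn : g.Coprime n) (hgd : g.Coprime d.natAbs)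
    (hnd : n.Coprime d.natAbs) :
    jacobiSym (g * d) n * jacobiSym (g * n) d.natAbs * jacobiSym (-(n * d)) g = 1 := by
  have hodd : Odd d.natAbs := by
    rw [Int.natAbs_odd, ← Int.not_even_iff_odd]
    rintro ⟨k, rfl⟩
    have : (g * (k + k) : ℤ) = 2 * (g * k) := by ring
    omega
  have h1 := jacobiSym_mul_swap hg hn hgn
  have h2 := jacobiSym_mul_swap hg hodd hgd
  have h3 := jacobiSym_mul_swap hn hodd hnd
  have hneg : -((n : ℤ) * d) = n * -d := by ring
  rw [hneg]
  simp only [jacobiSym.mul_left]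
  have hχ : ∀ {m : ℕ}, Odd m → jacobiSym (-1) m = if m % 4 = 3 then -1 else 1 := by
    intro m hm
    rw [jacobiSym.at_neg_one hm, ZMod.χ₄_nat_eq_if_mod_four]
    have := Nat.odd_iff.1 hm
    split_ifs <;> omega
  have hg4 : g % 4 = 1 ∨ g % 4 = 3 := by have := Nat.odd_iff.1 hg; omega
  have hn4 : n % 4 = 1 ∨ n % 4 = 3 := by have := Nat.odd_iff.1 hn; omega
  have hgd4 : (g : ℤ) % 4 = d % 4 := by
    have hmul := Int.mul_emod g d 4
    have hd4 : d % 4 = 1 ∨ d % 4 = 3 := by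
      have := Nat.odd_iff.1 hodd; omega
    rw [hd] at hmul
    have hg4' : (g : ℤ) % 4 = 1 ∨ (g : ℤ) % 4 = 3 := by omega
    rcases hd4 with h | h <;> rcases hg4' with h' | h' <;> rw [h, h'] at hmul <;> omega
  have hns : jacobiSym (-1) g ^ 2 = 1 := jacobiSym.sq_one (by simp)
  rcases Int.natAbs_eq d with hde | hde
  · have e1 : jacobiSym (-d) g = jacobiSym (-1) g * jacobiSym d.natAbs g := by
      rw [← jacobiSym.mul_left, ← hde]; simp
    have e2 : jacobiSym d n = jacobiSym d.natAbs n := by rw [← hde]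
    rw [e1, e2]
    have key : (jacobiSym g n * jacobiSym n g) * (jacobiSym g d.natAbs * jacobiSym d.natAbs g)
        * (jacobiSym n d.natAbs * jacobiSym d.natAbs n) * jacobiSym (-1) g = 1 := by
      rw [h1, h2, h3, hχ hg]
      have : g % 4 = d.natAbs % 4 := by omega
      rw [← this]
      rcases hg4 with h | h <;> rcases hn4 with h' | h' <;> simp [h, h']
    linear_combination key
  · have e1 : jacobiSym (-d) g = jacobiSym d.natAbs g := by
      congr 1; omega
    have e2 : jacobiSym d n = jacobiSym (-1) n * jacobiSym d.natAbs n := by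
      rw [← jacobiSym.mul_left]; congr 1; omega
    rw [e1, e2]
    have key : (jacobiSym g n * jacobiSym n g) * (jacobiSym g d.natAbs * jacobiSym d.natAbs g)
        * (jacobiSym n d.natAbs * jacobiSym d.natAbs n) * jacobiSym (-1) n = 1 := by
      rw [h1, h2, h3, hχ hn]
      have : (g % 4 = 1 ∧ d.natAbs % 4 = 3) ∨ (g % 4 = 3 ∧ d.natAbs % 4 = 1) := by omega
      rcases this with ⟨h, h''⟩ | ⟨h, h''⟩ <;> rcases hn4 with h' | h' <;> simp [h, h', h'']
    linear_combination key

theorem three_not_dvd_of_isSquare_mod {n : ℕ} {d : ℤ} (hn : Squarefree n) (hd : Squarefree d)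
    (hn2 : Odd n) (hd12 : d % 12 = 5)
    (hnd : ∀ (p : ℕ) [Fact p.Prime], p ≠ 3 → p ∣ n → ¬ (p : ℤ) ∣ d → IsSquare (d : ZMod p))
    (hdn : ∀ (p : ℕ) [Fact p.Prime], (p : ℤ) ∣ d → ¬ p ∣ n → IsSquare (n : ZMod p))
    (hboth : ∀ (p : ℕ) [Fact p.Prime] (k : ℕ) (l : ℤ), n = p * k → d = p * l →
      IsSquare (-(k * l : ℤ) : ZMod p)) : ¬ 3 ∣ n := by
  intro h3
  have hn0 : n ≠ 0 := hn.ne_zero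
  obtain ⟨n', hn'⟩ := Nat.gcd_dvd_left n d.natAbs
  obtain ⟨d', hd'⟩ : (Nat.gcd n d.natAbs : ℤ) ∣ d := Int.natCast_dvd.2 (Nat.gcd_dvd_right _ _)
  have hg0 : 0 < Nat.gcd n d.natAbs := Nat.gcd_pos_of_pos_left _ (Nat.pos_of_ne_zero hn0)
  have hcop : n'.Coprime d'.natAbs := by
    have h := Nat.gcd_mul_left (Nat.gcd n d.natAbs) n' d'.natAbs
    rw [← hn', ← Int.natAbs_natCast (Nat.gcd n d.natAbs), ← Int.natAbs_mul, ← hd',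
      Int.natAbs_natCast] at h
    exact (Nat.eq_of_mul_eq_mul_left hg0 (by rw [mul_one]; exact h)).symm
  generalize Nat.gcd n d.natAbs = g at *
  have hgn : g.Coprime n' := by
    rw [hn'] at hn; exact Nat.coprime_of_squarefree_mul hn
  have hgd : g.Coprime d'.natAbs := by
    have h : Squarefree d.natAbs := Int.squarefree_natAbs.2 hd
    rw [hd', Int.natAbs_mul, Int.natAbs_natCast] at h
    exact Nat.coprime_of_squarefree_mul h
  have hodd : Odd g ∧ Odd n' := by rw [hn'] at hn2; exact Nat.odd_mul.1 hn2
  have h3g : ¬ 3 ∣ g := by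
    rintro ⟨k, rfl⟩
    have : d = 3 * (k * d') := by rw [hd']; push_cast; ring
    omega
  obtain ⟨k, hk⟩ : 3 ∣ n' := by
    rw [hn'] at h3
    exact (Nat.prime_three.dvd_mul.1 h3).resolve_left h3g
  have h3k : ¬ 3 ∣ k := by
    rintro ⟨l, rfl⟩
    have := hn 3 ⟨g * l, by rw [hn', hk]; ring⟩
    norm_num at this
  have hcast : ∀ {p : ℕ} [Fact p.Prime] {m m' : ℕ}, m.Coprime m' → p ∣ m → (m' : ZMod p) ≠ 0 := by
    intro p _ m m' h hp h0
    rw [ZMod.natCast_eq_zero_iff] at h0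
    exact (Fact.out : p.Prime).one_lt.ne' (Nat.dvd_one.1 (h ▸ Nat.dvd_gcd hp h0))
  have hcastZ : ∀ {p : ℕ} [Fact p.Prime] {m : ℕ} {x : ℤ}, m.Coprime x.natAbs → p ∣ m →
      (x : ZMod p) ≠ 0 := by
    intro p _ m x h hp h0
    rw [ZMod.intCast_zmod_eq_zero_iff_dvd, Int.natCast_dvd] at h0
    exact (Fact.out : p.Prime).one_lt.ne' (Nat.dvd_one.1 (h ▸ Nat.dvd_gcd hp h0))
  have j1 : jacobiSym (g * d') k = 1 := by
    apply jacobiSym_eq_one_of_forall_isSquare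
    intro p _ hp
    have hpn' : p ∣ n' := hk ▸ hp.mul_left 3
    have hne : ((g * d' : ℤ) : ZMod p) ≠ 0 := by
      push_cast
      exact mul_ne_zero (hcast hgn.symm hpn') (hcastZ hcop hpn')
    refine ⟨hne, ?_⟩
    rw [← hd'] at hne ⊢
    refine hnd p ?_ (hn' ▸ hpn'.mul_left g) (by rwa [← ZMod.intCast_zmod_eq_zero_iff_dvd])
    rintro rfl
    exact h3k hp
  have j3 : jacobiSym (g * d') 3 = -1 := by
    rw [← hd', jacobiSym.mod_left, show d % ((3 : ℕ) : ℤ) = 2 by push_cast; omega]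
    norm_num
  have j2 : jacobiSym (g * n') d'.natAbs = 1 := by
    apply jacobiSym_eq_one_of_forall_isSquare
    intro p _ hp
    have hne : ((g * n' : ℤ) : ZMod p) ≠ 0 := by
      push_cast
      exact mul_ne_zero (hcast hgd.symm hp) (hcast hcop.symm hp)
    refine ⟨hne, ?_⟩
    have e : (g * n' : ℤ) = (n : ℕ) := by rw [hn']; push_cast; rfl
    rw [e, Int.cast_natCast] at hne ⊢
    exact hdn p (hd' ▸ (Int.natCast_dvd.2 hp).mul_left _)
      (by rwa [← ZMod.natCast_eq_zero_iff])
  have j4 : jacobiSym (-(n' * d')) g = 1 := by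
    apply jacobiSym_eq_one_of_forall_isSquare
    intro p _ hp
    refine ⟨?_, ?_⟩
    · push_cast
      exact neg_ne_zero.2 (mul_ne_zero (hcast hgn hp) (hcastZ hgd hp))
    · obtain ⟨c, rfl⟩ := hp
      obtain ⟨s, hs⟩ := hboth p (c * n') (c * d') (by rw [hn']; ring)
        (by rw [hd']; push_cast; ring)
      have hc : (c : ZMod p) ≠ 0 := by
        rw [hn', mul_assoc] at hn
        have := Nat.coprime_of_squarefree_mul hn
        exact hcast this.coprime_mul_right_right dvd_rfl
      refine ⟨s / c, ?_⟩
      push_cast at hs ⊢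
      field_simp
      linear_combination hs
  have hmain := jacobiSym_natCast_mul_sign hodd.1 hodd.2 (d := d') (by rw [← hd']; omega) hgn hgd
    hcop
  rw [j2, j4, hk, jacobiSym.mul_right' _ (by norm_num) (by rintro rfl; simp at h3k), j1, j3]
    at hmain
  norm_num at hmain

theorem exists_isCoprime_smul {a b : ℚ} (hab : (a, b) ≠ (0, 0)) :
    ∃ (c : ℚ) (m n : ℤ), c ≠ 0 ∧ IsCoprime m n ∧ a = c * m ∧ b = c * n := by
  by_cases hb : b = 0
  · refine ⟨a, 1, 0, ?_, isCoprime_one_left, by simp, by simp [hb]⟩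
    rintro rfl
    exact hab (by rw [hb])
  · have hd : ((a / b).den : ℚ) ≠ 0 := by exact_mod_cast (a / b).den_nz
    refine ⟨b / (a / b).den, (a / b).num, (a / b).den, div_ne_zero hb hd, ?_, ?_, ?_⟩
    · rw [Int.isCoprime_iff_gcd_eq_one]
      exact (a / b).reduced
    · have h := Rat.num_div_den (a / b)
      have : a = b * (a / b) := by field_simp
      conv_lhs => rw [this, ← h]
      ring
    · simp [hd]

theorem exists_squarefree_mul_sq {d : ℤ} (hd : d % 12 = 5) :
    ∃ e m : ℤ, d = e * m ^ 2 ∧ Squarefree e ∧ m ≠ 0 ∧ e % 12 = 5 := by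
  obtain ⟨e, m, hem, he⟩ := Nat.sq_mul_squarefree d.natAbs
  have hs : d = d.sign * e * (m : ℤ) ^ 2 := by
    conv_lhs => rw [← Int.sign_mul_natAbs d, ← hem]
    push_cast; ring
  have hd0 : d ≠ 0 := by rintro rfl; norm_num at hd
  refine ⟨d.sign * e, m, hs, ?_, ?_, ?_⟩
  · rw [← Int.squarefree_natAbs, Int.natAbs_mul, Int.natAbs_sign_of_ne_zero hd0, one_mul]
    simpa using he
  · rintro h
    rw [h] at hs
    exact hd0 (by rw [hs]; ring)
  · generalize d.sign * (e : ℤ) = f at hs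
    have key : ∀ f m : ZMod 12, f * m ^ 2 = 5 → f = 5 := by decide
    have hd' : ((d : ℤ) : ZMod 12) = ((5 : ℤ) : ZMod 12) := by
      rw [ZMod.intCast_eq_intCast_iff']; exact hd
    have := key f m (by rw [hs] at hd'; exact_mod_cast hd')
    exact (ZMod.intCast_eq_intCast_iff' f 5 12).1 (by exact_mod_cast this)

theorem odd_of_mul_sq_eq_norm {a b m n : ℤ} (hab : IsCoprime a b) (hn : Squarefree n)
    (h : n * m ^ 2 = a ^ 2 + 3 * b ^ 2) : Odd n := by
  by_contra hodd
  rw [Int.not_odd_iff_even, even_iff_two_dvd] at hodd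
  obtain ⟨k, rfl⟩ := hodd
  have hk : k % 2 = 1 := by
    by_contra hk
    have : (2 : ℤ) * 2 ∣ 2 * k := mul_dvd_mul_left 2 (by omega)
    have := Int.isUnit_iff.1 (hn 2 this)
    omega
  obtain ⟨j, rfl⟩ : ∃ j, k = 2 * j + 1 := ⟨k / 2, by omega⟩
  have key : ∀ a b j m : ZMod 8, 2 * (2 * j + 1) * m ^ 2 = a ^ 2 + 3 * b ^ 2 →
      4 * a = 0 ∧ 4 * b = 0 := by decide +kernel
  have hz := key a b j m (by exact_mod_cast congrArg (Int.cast : ℤ → ZMod 8) h)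
  have ha : (8 : ℤ) ∣ 4 * a := (ZMod.intCast_zmod_eq_zero_iff_dvd _ 8).1 (by exact_mod_cast hz.1)
  have hb : (8 : ℤ) ∣ 4 * b := (ZMod.intCast_zmod_eq_zero_iff_dvd _ 8).1 (by exact_mod_cast hz.2)
  have := Int.isUnit_iff.1 (hab.isUnit_of_dvd' (show 2 ∣ a by omega) (show 2 ∣ b by omega))
  omega

/-- The pencil member with coprime integral parameters `(a, b)`, `3 ∣ a`, contains no rational line:
a plane would make `d` and `a ^ 2 + 3 * b ^ 2` violate quadratic reciprocity. -/
theorem false_of_plane {d e M a b : ℤ} (hdM : d = e * M ^ 2) (he : Squarefree e) (hM : M ≠ 0)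
    (he12 : e % 12 = 5)
    (hroot : ∀ (p : ℕ) [Fact p.Prime], (p : ℤ) ∣ d → ∀ t : ZMod p,
      t ^ 3 + 3 * t ^ 2 + 3 * t - 9 = 0 → IsSquare t)
    (hab : IsCoprime a b) (h3a : 3 ∣ a)
    (W : Submodule ℚ (Fin 5 → ℚ)) (hW : 2 ≤ finrank ℚ W)
    (h : ∀ v ∈ W, (d : ℚ) * (b * (v 0 ^ 2 - 3 * v 1 ^ 2) - 2 * a * v 0 * v 1)
      + tern (a : ℚ) b (v 2) (v 3) (v 4) = 0) : False := by
  have h3b : ¬ 3 ∣ b := by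
    intro h3b
    have := Int.isUnit_iff.1 (hab.isUnit_of_dvd' h3a h3b)
    omega
  have hb0 : b ≠ 0 := by rintro rfl; simp at h3b
  have hN0 : 0 < a ^ 2 + 3 * b ^ 2 := by positivity
  obtain ⟨n, m, hnm, hn⟩ := Nat.sq_mul_squarefree (a ^ 2 + 3 * b ^ 2).natAbs
  have hN : (n : ℤ) * (m : ℤ) ^ 2 = a ^ 2 + 3 * b ^ 2 := by
    rw [← Int.natAbs_of_nonneg hN0.le, ← hnm]; push_cast; ring
  have hm0 : m ≠ 0 := by rintro rfl; simp at hN; omega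
  have hnodd : Odd n := by
    exact_mod_cast odd_of_mul_sq_eq_norm hab (Int.squarefree_natCast.2 hn) hN
  have hbM : (b : ℚ) * M * (M * m) ≠ 0 := by
    have hm0' : (m : ℤ) ≠ 0 := by exact_mod_cast hm0
    exact_mod_cast mul_ne_zero (mul_ne_zero hb0 hM) (mul_ne_zero hM hm0')
  have hNQ : (n : ℚ) * (m : ℚ) ^ 2 = a ^ 2 + 3 * b ^ 2 := by exact_mod_cast hN
  have hdQ : (d : ℚ) = e * M ^ 2 := by exact_mod_cast hdM
  have hne : ∀ {p : ℕ} [Fact p.Prime], (p : ℤ) ∣ e → p ≠ 2 ∧ p ≠ 3 := by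
    intro p _ hp
    constructor <;> rintro rfl <;> push_cast at hp <;> omega
  have hndvd_b : ∀ {p : ℕ} [Fact p.Prime], p ∣ n → ¬ (p : ℤ) ∣ b := by
    intro p _ hp hpb
    have hpZ : Prime (p : ℤ) := Nat.prime_iff_prime_int.1 Fact.out
    have h1 : (p : ℤ) ∣ a ^ 2 + 3 * b ^ 2 := by
      rw [← hN]; exact (Int.natCast_dvd_natCast.2 hp).mul_right _
    have h2 : (p : ℤ) ∣ a ^ 2 := by
      rwa [Int.dvd_add_left ((dvd_pow hpb two_ne_zero).mul_left 3)] at h1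
    exact hpZ.not_isUnit (hab.isUnit_of_dvd' (hpZ.dvd_of_dvd_pow h2) hpb)
  have hndvd_N : ∀ {p : ℕ}, p ∣ n → (p : ℤ) ∣ a ^ 2 + 3 * b ^ 2 := by
    intro p hp
    rw [← hN]; exact (Int.natCast_dvd_natCast.2 hp).mul_right _
  have hsq_n : ∀ {p k : ℕ} [Fact p.Prime], n = p * k → ¬ (p : ℤ) ∣ k := by
    rintro p k _ hk hpk
    obtain ⟨l, rfl⟩ := Int.natCast_dvd_natCast.1 hpk
    have := hn p ⟨l, by rw [hk]; ring⟩
    exact (Fact.out : p.Prime).one_lt.ne' (Nat.isUnit_iff.1 this)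
  have hsq_e : ∀ {p : ℕ} {l : ℤ} [Fact p.Prime], e = p * l → ¬ (p : ℤ) ∣ l := by
    rintro p l _ hl ⟨c, rfl⟩
    have hpZ : Prime (p : ℤ) := Nat.prime_iff_prime_int.1 Fact.out
    exact hpZ.not_isUnit (he p ⟨c, by rw [hl]; ring⟩)
  refine three_not_dvd_of_isSquare_mod hn he hnodd he12 ?_ ?_ ?_ ?_
  · intro p _ hp3 hpn hpe
    have hp2 : p ≠ 2 := by
      rintro rfl
      exact (Nat.not_even_iff_odd.2 hnodd) (even_iff_two_dvd.2 hpn)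
    have hpZ : Prime (p : ℤ) := Nat.prime_iff_prime_int.1 Fact.out
    obtain ⟨k, hk⟩ := hpn
    obtain ⟨W', hW', hv⟩ := exists_plane_linear_change W (q := b * M) (r := -(a * M)) (s := 0)
      (t := M * m) (by simpa using hbM)
    refine isSquare_of_dvd_norm hp2 hp3 (α := e) (β := -(e * k)) (fun hd => ?_)
      (hndvd_b ⟨k, hk⟩) (hndvd_N ⟨k, hk⟩) W' (hW.trans hW') fun v hvW => ?_
    · rw [dvd_neg] at hd
      exact (hpZ.dvd_or_dvd hd).elim hpe (hsq_n hk)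
    · obtain ⟨u, hu, e0, e1, e2, e3, e4⟩ := hv v hvW
      have hu' := h u hu
      have hkQ : (n : ℚ) = p * k := by exact_mod_cast hk
      rw [e0, e1, e2, e3, e4]
      rw [hkQ] at hNQ
      rw [hdQ] at hu'
      push_cast
      linear_combination b * hu' - e * M ^ 2 * u 1 ^ 2 * hNQ
  · intro p _ hpe hpn
    have hpZ : Prime (p : ℤ) := Nat.prime_iff_prime_int.1 Fact.out
    obtain ⟨hp2, hp3⟩ := hne hpe
    obtain ⟨h2, h3⟩ := two_ne_zero_and_three_ne_zero (p := p) Fact.out hp2 hp3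
    have hNp : (n : ZMod p) * (m : ZMod p) ^ 2 = a ^ 2 + 3 * b ^ 2 := by
      exact_mod_cast congrArg (Int.cast : ℤ → ZMod p) hN
    by_cases hpb : (p : ℤ) ∣ b
    · have hb : (b : ZMod p) = 0 := (ZMod.intCast_zmod_eq_zero_iff_dvd _ _).2 hpb
      have ha : (a : ZMod p) ≠ 0 := by
        rw [Ne, ZMod.intCast_zmod_eq_zero_iff_dvd]
        exact fun hpa => hpZ.not_isUnit (hab.isUnit_of_dvd' hpa hpb)
      rw [hb] at hNp
      have hm : (m : ZMod p) ≠ 0 := by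
        intro hm
        rw [hm] at hNp
        exact ha (pow_eq_zero_iff two_ne_zero |>.1 (by linear_combination -hNp))
      refine ⟨a / m, ?_⟩
      field_simp
      linear_combination hNp
    · have hb : (b : ZMod p) ≠ 0 := by rwa [Ne, ZMod.intCast_zmod_eq_zero_iff_dvd]
      obtain ⟨l, hl⟩ := hpe
      obtain ⟨W', hW', hv⟩ := exists_plane_linear_change W (q := b * M) (r := -(a * M)) (s := 0)
        (t := M * m) (by simpa using hbM)
      have hcase := isSquare_or_of_plane hp2 hp3 (γ := l) (n := n) (a := a) (hsq_e hl) hpb W'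
        (hW.trans hW') fun v hvW => by
          obtain ⟨u, hu, e0, e1, e2, e3, e4⟩ := hv v hvW
          have hu' := h u hu
          have hlQ : (e : ℚ) = p * l := by exact_mod_cast hl
          rw [e0, e1, e2, e3, e4]
          rw [hdQ, hlQ] at hu'
          push_cast
          linear_combination b * hu' - p * l * M ^ 2 * u 1 ^ 2 * hNQ
      rcases hcase with hsq | ⟨hF, c, hc⟩
      · simpa using hsq
      · obtain ⟨r, hr⟩ := hroot p (by rw [hdM, hl, mul_assoc]; exact dvd_mul_right _ _) (a / b) (by
          field_simp; linear_combination hF)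
        have ha : (a : ZMod p) = b * r ^ 2 := by
          rw [sq, ← hr]; field_simp
        have ha0 : (a : ZMod p) ≠ 0 := by
          intro ha
          rw [ha] at hF
          have : (3 : ZMod p) ^ 2 * (b : ZMod p) ^ 3 = 0 := by linear_combination -hF
          simp [h3, hb] at this
        have hr0 : r ≠ 0 := by
          rintro rfl
          exact ha0 (by rw [ha]; ring)
        have hNc : (a : ZMod p) ^ 2 + 3 * b ^ 2 = (c / r) ^ 2 := by
          field_simp
          apply mul_left_cancel₀ hb
          linear_combination hF - ((a : ZMod p) ^ 2 + 3 * b ^ 2) * ha + b * hc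
        have hm : (m : ZMod p) ≠ 0 := by
          intro hm
          rw [hm] at hNp
          have hN0 : (a : ZMod p) ^ 2 + 3 * b ^ 2 = 0 := by linear_combination -hNp
          have : (2 : ZMod p) * 3 ^ 2 * b ^ 3 = 0 := by
            linear_combination (a + 3 * b : ZMod p) * hN0 - hF
          simp [h2, h3, hb] at this
        refine ⟨c / r / m, ?_⟩
        rw [hNc] at hNp
        field_simp at hNp ⊢
        linear_combination hNp
  · intro p _ k l hk hl
    obtain ⟨hp2, hp3⟩ := hne ⟨l, hl⟩
    have hpQ : (p : ℚ) ≠ 0 := by exact_mod_cast (Fact.out : p.Prime).ne_zero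
    obtain ⟨W', hW', hv⟩ := exists_plane_linear_change W (q := 0) (r := p * M * m) (s := b * M)
      (t := -(a * M)) (by
        intro h0
        apply mul_ne_zero hpQ hbM
        linear_combination -h0)
    have hsq := isSquare_of_dvd_norm hp2 hp3 (α := -(k * l)) (β := l) (hsq_e hl)
      (hndvd_b ⟨k, hk⟩) (hndvd_N ⟨k, hk⟩) W' (hW.trans hW') fun v hvW => by
        obtain ⟨u, hu, e0, e1, e2, e3, e4⟩ := hv v hvW
        have hu' := h u hu
        have hkQ : (n : ℚ) = p * k := by exact_mod_cast hk
        have hlQ : (e : ℚ) = p * l := by exact_mod_cast hl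
        rw [e0, e1, e2, e3, e4]
        rw [hkQ] at hNQ
        rw [hdQ, hlQ] at hu'
        push_cast
        linear_combination b * hu' - p * l * M ^ 2 * u 1 ^ 2 * hNQ
    simpa using hsq
  · by_contra h3n
    obtain ⟨a', rfl⟩ := h3a
    have h3 : Prime (3 : ℤ) := Int.prime_three
    have hnm3 : (3 : ℤ) ∣ n * (m : ℤ) ^ 2 := ⟨3 * a' ^ 2 + b ^ 2, by rw [hN]; ring⟩
    have h3m := h3.dvd_of_dvd_pow ((h3.dvd_or_dvd hnm3).resolve_left fun h => h3n (by
      exact_mod_cast h))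
    obtain ⟨m', hm'⟩ := h3m
    apply h3b
    refine h3.dvd_of_dvd_pow (n := 2) ⟨n * m' ^ 2 - a' ^ 2, ?_⟩
    rw [hm'] at hN
    linarith

/-- If `d ≡ 5 (mod 12)` and, for every prime `p ∣ d`, every root `θ` of
`T³ + 3T² + 3T - 9` lying in a finite extension `L/ℚ_p` that it generates is a square in `L`,
then no quadric in the pencil spanned by `Q₀` and `Q∞` (i.e. no quadric in `ℙ⁴_ℚ` containing
the surface `X_d`) contains a line defined over `ℚ`. -/
theorem stmt3 (d : ℤ) (hd : d ≡ 5 [ZMOD 12])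
    (hloc : ∀ (p : ℕ) [Fact p.Prime], (p : ℤ) ∣ d →
      ∀ (L : Type) [Field L] [Algebra ℚ_[p] L] [FiniteDimensional ℚ_[p] L],
        ∀ θ : L, θ ^ 3 + 3 * θ ^ 2 + 3 * θ - 9 = 0 → Algebra.adjoin ℚ_[p] {θ} = ⊤ →
          ∃ s : L, s ^ 2 = θ) :
    ∀ a b : ℚ, (a, b) ≠ (0, 0) →
      ¬ ∃ W : Submodule ℚ (Fin 5 → ℚ), Module.finrank ℚ W = 2 ∧
          ∀ u ∈ W, b * Q0 d u + a * Qinf d u = 0 := by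
  rintro a b hab ⟨W, hW, hq⟩
  have hd12 : d % 12 = 5 := hd
  obtain ⟨c, m, n, hc, hmn, rfl, rfl⟩ := exists_isCoprime_smul hab
  obtain ⟨e, M, hdM, he, hM, he12⟩ := exists_squarefree_mul_sq hd12
  have h : ∀ v ∈ W, (d : ℚ) * (n * (v 0 ^ 2 - 3 * v 1 ^ 2) - 2 * m * v 0 * v 1)
      + tern (m : ℚ) n (v 2) (v 3) (v 4) = 0 := by
    intro v hv
    have := hq v hv
    apply mul_left_cancel₀ hc
    unfold Q0 Qinf at this
    unfold tern
    linear_combination this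
  refine false_of_plane hdM he hM he12 (fun p _ hp => ?_) hmn
    (three_dvd_of_plane (by omega) W hW.ge h) W hW.ge h
  refine isSquare_of_isRoot ?_ ?_ fun θ hθ => hloc p hp ℚ_[p] θ hθ ?_
  · rintro rfl; push_cast at hp; omega
  · rintro rfl; push_cast at hp; omega
  · exact eq_top_iff.2 fun x _ => Subalgebra.algebraMap_mem _ x
end

section
/- Let d be an integer with d ≡ 5 (mod 12) and suppose that for every prime p dividing d, every finite field extension L of ℚ_p, and every θ ∈ L satisfying θ^3 + 3θ^2 + 3θ - 9 = 0 and generating L over ℚ_p, the element θ is a square in L. Then for every field K equipped with a ℚ-algebra structure of dimension at most 2 over ℚ, there is no nonzero vector x ∈ K^5 with Q_0(x) = 0 and Q_∞(x) = 0. (That is, the quartic del Pezzo surface X_d has no closed points of degree dividing 2.) -/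
open Polynomial in
/-- If the class of `X` is a square modulo every irreducible factor of a separable polynomial `f`,
then it is a square modulo `f`. -/
lemma exists_dvd_sq_sub_X {k : Type*} [Field k] {f : k[X]} (hf : f.Separable)
    (hirr : ∀ g : k[X], Irreducible g → g ∣ f → ∃ S : k[X], g ∣ S ^ 2 - X) :
    ∃ S : k[X], f ∣ S ^ 2 - X := by
  suffices H : ∀ g : k[X], g ∣ f → ∃ S : k[X], g ∣ S ^ 2 - X from H f dvd_rfl
  intro g
  induction g using WfDvdMonoid.induction_on_irreducible with
  | zero => exact fun h => absurd (zero_dvd_iff.mp h) hf.ne_zero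
  | unit u hu => exact fun _ => ⟨0, hu.dvd⟩
  | mul a i _ hi ih =>
    intro h
    obtain ⟨S, hS⟩ := hirr i hi (dvd_of_mul_right_dvd h)
    obtain ⟨T, hT⟩ := ih (dvd_of_mul_left_dvd h)
    have hc : IsCoprime i a := (hf.of_dvd h).isCoprime
    obtain ⟨u, v, huv⟩ := id hc
    refine ⟨u * i * T + v * a * S, hc.mul_dvd ?_ ?_⟩
    · obtain ⟨c, hc⟩ := hS
      refine ⟨(u * T - u * S) * (u * i * T + v * a * S + S) + c, ?_⟩
      linear_combination hc + S * (u * i * T + v * a * S + S) * huv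
    · obtain ⟨c, hc⟩ := hT
      refine ⟨(v * S - v * T) * (u * i * T + v * a * S + T) + c, ?_⟩
      linear_combination hc + T * (u * i * T + v * a * S + T) * huv

open Polynomial in
/-- The coordinates, in the basis `1, θ, θ²`, of a square root of `θ` in `k[θ]`, where
`θ³ + 3θ² + 3θ - 9 = 0`. -/
lemma exists_sqrt_coordinates {k : Type} [Field k] [CharZero k]
    (h : ∀ (L : Type) [Field L] [Algebra k L] [FiniteDimensional k L],
        ∀ θ : L, θ ^ 3 + 3 * θ ^ 2 + 3 * θ - 9 = 0 → Algebra.adjoin k {θ} = ⊤ →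
          ∃ s : L, s ^ 2 = θ) :
    ∃ s₀ s₁ s₂ : k, s₀ ^ 2 + 18 * s₁ * s₂ - 27 * s₂ ^ 2 = 0 ∧
      2 * s₀ * s₁ - 6 * s₁ * s₂ + 18 * s₂ ^ 2 = 1 ∧
      s₁ ^ 2 + 2 * s₀ * s₂ - 6 * s₁ * s₂ + 6 * s₂ ^ 2 = 0 := by
  set f : k[X] := X ^ 3 + 3 * X ^ 2 + 3 * X - 9 with hfdef
  have hfC : f = X ^ 3 + C 3 * X ^ 2 + C 3 * X + C (-9) := by
    simp only [hfdef, map_neg, map_ofNat]; ring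
  have hdeg : f.natDegree = 3 := by rw [hfC]; compute_degree!
  have hmonic : f.Monic := by rw [hfC]; monicity!
  have hsep : f.Separable := by
    have h10 : (C (1 / 10 : k)) * 10 = 1 := by
      rw [← map_ofNat (C : k →+* k[X]), ← C_mul]; norm_num
    refine ⟨-C (1 / 10), C (1 / 10) * C (1 / 3) * (X + 1), ?_⟩
    have h3 : (C (1 / 3 : k)) * 3 = 1 := by
      rw [← map_ofNat (C : k →+* k[X]), ← C_mul]; norm_num
    have hder : derivative f = 3 * (X + 1) ^ 2 := by
      rw [hfC]
      simp only [derivative_add, derivative_mul, derivative_X_pow, derivative_C, derivative_X,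
        map_ofNat]
      norm_num [map_ofNat (C : k →+* k[X])]; ring
    rw [hder, hfdef]
    linear_combination (C (1 / 10 : k)) * (X + 1) ^ 3 * h3 + h10
  obtain ⟨S, hS⟩ := exists_dvd_sq_sub_X hsep fun g hg hgf => by
    have : Fact (Irreducible g) := ⟨hg⟩
    have : FiniteDimensional k (AdjoinRoot g) := (AdjoinRoot.powerBasis hg.ne_zero).finite
    have hroot : (AdjoinRoot.root g) ^ 3 + 3 * (AdjoinRoot.root g) ^ 2
        + 3 * AdjoinRoot.root g - 9 = 0 := by
      have := AdjoinRoot.mk_eq_zero.mpr hgf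
      simpa only [hfdef, map_sub, map_add, map_mul, map_pow, map_ofNat, AdjoinRoot.mk_X] using this
    obtain ⟨s, hs⟩ := h (AdjoinRoot g) (AdjoinRoot.root g) hroot AdjoinRoot.adjoinRoot_eq_top
    obtain ⟨S, rfl⟩ := AdjoinRoot.mk_surjective s
    exact ⟨S, AdjoinRoot.mk_eq_zero.mp (by simp [hs])⟩
  have hlt : (S %ₘ f).natDegree < 3 := by
    rw [← hdeg]; exact natDegree_modByMonic_lt S hmonic (by intro h1; simp [h1] at hdeg)
  set s₀ := (S %ₘ f).coeff 0
  set s₁ := (S %ₘ f).coeff 1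
  set s₂ := (S %ₘ f).coeff 2
  have hrep : S %ₘ f = C s₀ + C s₁ * X + C s₂ * X ^ 2 := by
    rw [(S %ₘ f).as_sum_range' 3 hlt]
    simp [Finset.sum_range_succ, ← C_mul_X_pow_eq_monomial, s₀, s₁, s₂]
  have hdvd : f ∣ C (s₁ ^ 2 + 2 * s₀ * s₂ - 6 * s₁ * s₂ + 6 * s₂ ^ 2) * X ^ 2 +
      C (2 * s₀ * s₁ - 6 * s₁ * s₂ + 18 * s₂ ^ 2 - 1) * X +
      C (s₀ ^ 2 + 18 * s₁ * s₂ - 27 * s₂ ^ 2) := by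
    obtain ⟨q, hq⟩ := hS
    have hdiv := modByMonic_add_div S f
    rw [hrep] at hdiv
    refine ⟨q - (S /ₘ f) * (S + (C s₀ + C s₁ * X + C s₂ * X ^ 2))
      - (2 * C s₁ * C s₂ + C s₂ ^ 2 * (X - 3)), ?_⟩
    simp only [map_add, map_sub, map_mul, map_pow, map_ofNat, map_one]
    rw [hfdef] at *
    linear_combination hq - (S + (C s₀ + C s₁ * X + C s₂ * X ^ 2)) * (-hdiv)
  have hzero := eq_zero_of_dvd_of_natDegree_lt hdvd (by
    rw [hdeg]; exact lt_of_le_of_lt natDegree_quadratic_le (by norm_num))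
  have hc := fun n => congrArg (fun P : k[X] => P.coeff n) hzero
  refine ⟨s₀, s₁, s₂, ?_, ?_, ?_⟩
  · have := hc 0
    simp only [coeff_add, coeff_C_mul, coeff_X_pow, coeff_X, coeff_C, coeff_zero] at this
    norm_num at this
    linear_combination this
  · have := hc 1
    simp only [coeff_add, coeff_C_mul, coeff_X_pow, coeff_X, coeff_C, coeff_zero] at this
    norm_num at this
    linear_combination this
  · have := hc 2
    simp only [coeff_add, coeff_C_mul, coeff_X_pow, coeff_X, coeff_C, coeff_zero] at this
    norm_num at this
    linear_combination this

section Forms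

variable {R : Type*} [CommRing R]

/-- The form `Q₀` over a commutative ring, with a parameter `d` from that ring. -/
def formZero (d : R) (u : Fin 5 → R) : R :=
  d * (u 0 ^ 2 - 3 * u 1 ^ 2) + 6 * u 2 ^ 2 + 6 * u 2 * u 3 - 6 * u 3 * u 4

/-- The form `Q∞` over a commutative ring, with a parameter `d` from that ring. -/
def formInf (d : R) (u : Fin 5 → R) : R :=
  -2 * d * u 0 * u 1 + u 2 ^ 2 - 2 * u 2 * u 4 - 3 * u 3 ^ 2 - u 4 ^ 2

/-- The polar form of `formZero`. -/
def polarZero (d : R) (u v : Fin 5 → R) : R :=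
  2 * d * (u 0 * v 0 - 3 * u 1 * v 1) + 12 * u 2 * v 2 + 6 * (u 2 * v 3 + u 3 * v 2)
    - 6 * (u 3 * v 4 + u 4 * v 3)

/-- The polar form of `formInf`. -/
def polarInf (d : R) (u v : Fin 5 → R) : R :=
  -2 * d * (u 0 * v 1 + u 1 * v 0) + 2 * u 2 * v 2 - 2 * (u 2 * v 4 + u 4 * v 2)
    - 6 * u 3 * v 3 - 2 * u 4 * v 4

/-- The member `l Q₀ + m Q∞` of the pencil. -/
def pencil (d l m : R) (u : Fin 5 → R) : R := l * formZero d u + m * formInf d u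

lemma formZero_add (d a b : R) (u v : Fin 5 → R) :
    formZero d (fun i => a * u i + b * v i) =
      a ^ 2 * formZero d u + a * b * polarZero d u v + b ^ 2 * formZero d v := by
  simp only [formZero, polarZero]; ring

lemma formInf_add (d a b : R) (u v : Fin 5 → R) :
    formInf d (fun i => a * u i + b * v i) =
      a ^ 2 * formInf d u + a * b * polarInf d u v + b ^ 2 * formInf d v := by
  simp only [formInf, polarInf]; ring

end Forms

lemma exists_linear_relation {k : Type*} [Field k] (p q : k) :
    ∃ l m : k, (l ≠ 0 ∨ m ≠ 0) ∧ l * p + m * q = 0 := by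
  by_cases h : q = 0
  · exact ⟨0, 1, by simp, by simp [h]⟩
  · exact ⟨q, -p, Or.inl h, by ring⟩

/-- Through a rational point of the intersection of the two quadrics there passes a line lying on
a member of the pencil. -/
lemma exists_line_of_point {k : Type*} [Field k] (d : k) (v : Fin 5 → k) (hv : v ≠ 0)
    (h₀ : formZero d v = 0) (h₁ : formInf d v = 0) :
    ∃ l m : k, (l ≠ 0 ∨ m ≠ 0) ∧ ∃ y z : Fin 5 → k, (∃ i j, y i * z j - y j * z i ≠ 0) ∧
      ∀ a b : k, pencil d l m (fun i => a * y i + b * z i) = 0 := by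
  obtain ⟨i, hi⟩ := Function.ne_iff.mp hv
  let T : (Fin 5 → k) →ₗ[k] (Fin 3 → k) :=
    { toFun := fun y => ![y i, polarZero d v y, polarInf d v y]
      map_add' := fun y z => by
        ext j; fin_cases j <;> simp [polarZero, polarInf] <;> ring
      map_smul' := fun c y => by
        ext j; fin_cases j <;> simp [polarZero, polarInf] <;> ring }
  have hker : LinearMap.ker T ≠ ⊥ := LinearMap.ker_ne_bot_of_finrank_lt (by simp)
  obtain ⟨y, hy, hy0⟩ := (Submodule.ne_bot_iff _).mp hker
  rw [LinearMap.mem_ker] at hy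
  have e0 : y i = 0 := congrFun hy 0
  have e1 : polarZero d v y = 0 := congrFun hy 1
  have e2 : polarInf d v y = 0 := congrFun hy 2
  obtain ⟨j, hj⟩ := Function.ne_iff.mp hy0
  obtain ⟨l, m, hlm, hrel⟩ := exists_linear_relation (formZero d y) (formInf d y)
  refine ⟨l, m, hlm, v, y, ⟨i, j, ?_⟩, fun a b => ?_⟩
  · rw [e0, mul_zero, sub_zero]; exact mul_ne_zero hi hj
  · rw [pencil, formZero_add, formInf_add, h₀, h₁, e1, e2]
    linear_combination b ^ 2 * hrel

lemma exists_generator_of_finrank_le_two {K : Type*} [Field K] [Algebra ℚ K]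
    [FiniteDimensional ℚ K] (hK : Module.finrank ℚ K ≤ 2) :
    ∃ ξ : K, ∀ c : K, ∃ a b : ℚ, c = algebraMap ℚ K a + algebraMap ℚ K b * ξ := by
  by_cases h : ∀ c : K, c ∈ Set.range (algebraMap ℚ K)
  · refine ⟨0, fun c => ?_⟩
    obtain ⟨a, rfl⟩ := h c
    exact ⟨a, 0, by simp⟩
  · push Not at h
    obtain ⟨ξ, hξ⟩ := h
    refine ⟨ξ, fun c => ?_⟩
    have hli : LinearIndependent ℚ ![(1 : K), ξ] := by
      rw [LinearIndependent.pair_iff]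
      intro s t hst
      have ht : t = 0 := by
        by_contra ht
        apply hξ
        refine ⟨-s / t, ?_⟩
        have ht' : algebraMap ℚ K t ≠ 0 := (map_ne_zero _).mpr ht
        rw [Algebra.smul_def, Algebra.smul_def] at hst
        rw [map_div₀, div_eq_iff ht', map_neg]
        linear_combination -hst
      subst ht
      simpa using hst
    have hspan := hli.span_eq_top_of_card_eq_finrank' (by
      refine le_antisymm ?_ ?_
      · simpa using hli.fintype_card_le_finrank
      · simpa using hK)
    have hc : c ∈ Submodule.span ℚ (Set.range ![(1 : K), ξ]) := hspan ▸ Submodule.mem_top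
    rw [Matrix.range_cons_cons_empty, Submodule.mem_span_pair] at hc
    obtain ⟨a, b, rfl⟩ := hc
    exact ⟨a, b, by simp [Algebra.smul_def]⟩

/-- A point of degree at most two yields a rational line on a member of the pencil. -/
lemma exists_line_of_quadratic_point (d : ℤ) {K : Type*} [Field K] [Algebra ℚ K]
    [FiniteDimensional ℚ K] (hK : Module.finrank ℚ K ≤ 2) (x : Fin 5 → K) (hx : x ≠ 0)
    (h₀ : Q0 d x = 0) (h₁ : Qinf d x = 0) :
    ∃ l m : ℚ, (l ≠ 0 ∨ m ≠ 0) ∧ ∃ y z : Fin 5 → ℚ, (∃ i j, y i * z j - y j * z i ≠ 0) ∧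
      ∀ a b : ℚ, pencil (d : ℚ) l m (fun i => a * y i + b * z i) = 0 := by
  obtain ⟨ξ, hξ⟩ := exists_generator_of_finrank_le_two hK
  set φ := algebraMap ℚ K
  have hφ : Function.Injective φ := φ.injective
  choose y z hyz using fun i => hξ (x i)
  obtain ⟨q, p, hpq⟩ := hξ (ξ ^ 2)
  have e0 : φ (formZero (d : ℚ) y + q * formZero (d : ℚ) z) +
      φ (polarZero (d : ℚ) y z + p * formZero (d : ℚ) z) * ξ = 0 := by
    simp only [Q0, hyz] at h₀
    simp only [formZero, polarZero, map_add, map_sub, map_mul, map_pow, map_ofNat, map_intCast]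
    linear_combination h₀ - (d * (φ (z 0) ^ 2 - 3 * φ (z 1) ^ 2) + 6 * φ (z 2) ^ 2 +
      6 * φ (z 2) * φ (z 3) - 6 * φ (z 3) * φ (z 4)) * hpq
  have e1 : φ (formInf (d : ℚ) y + q * formInf (d : ℚ) z) +
      φ (polarInf (d : ℚ) y z + p * formInf (d : ℚ) z) * ξ = 0 := by
    simp only [Qinf, hyz] at h₁
    simp only [formInf, polarInf, map_add, map_sub, map_mul, map_pow, map_ofNat, map_intCast,
      map_neg]
    linear_combination h₁ - (-2 * d * φ (z 0) * φ (z 1) + φ (z 2) ^ 2 - 2 * φ (z 2) * φ (z 4)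
      - 3 * φ (z 3) ^ 2 - φ (z 4) ^ 2) * hpq
  by_cases hrat : ∃ c, φ c = ξ
  · obtain ⟨c, rfl⟩ := hrat
    have hxv : ∀ i, x i = φ (y i + z i * c) := fun i => by rw [hyz, map_add, map_mul]
    refine exists_line_of_point (d : ℚ) (fun i => y i + z i * c) ?_ ?_ ?_
    · rintro h
      exact hx (funext fun i => by rw [hxv, congrFun h i]; simp)
    · apply hφ
      simp only [Q0, hxv] at h₀
      simpa only [formZero, map_add, map_sub, map_mul, map_pow, map_ofNat, map_intCast, map_zero]
        using h₀
    · apply hφ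
      simp only [Qinf, hxv] at h₁
      simpa only [formInf, map_add, map_sub, map_mul, map_pow, map_ofNat, map_intCast, map_neg,
        map_zero] using h₁
  · have hind : ∀ a b : ℚ, φ a + φ b * ξ = 0 → a = 0 ∧ b = 0 := by
      intro a b hab
      have hb : b = 0 := by
        by_contra hb
        have hb' : φ b ≠ 0 := (map_ne_zero _).mpr hb
        exact hrat ⟨-a / b, by rw [map_div₀, div_eq_iff hb', map_neg]; linear_combination -hab⟩
      subst hb
      exact ⟨(map_eq_zero φ).mp (by simpa only [map_zero, zero_mul, add_zero] using hab), rfl⟩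
    obtain ⟨e00, e01⟩ := hind _ _ e0
    obtain ⟨e10, e11⟩ := hind _ _ e1
    by_cases hm : ∃ i j, y i * z j - y j * z i ≠ 0
    · obtain ⟨l, m, hlm, hrel⟩ := exists_linear_relation (formZero (d : ℚ) z) (formInf (d : ℚ) z)
      refine ⟨l, m, hlm, y, z, hm, fun a b => ?_⟩
      rw [pencil, formZero_add, formInf_add]
      linear_combination (b ^ 2 - a * b * p - a ^ 2 * q) * hrel + a ^ 2 * (l * e00 + m * e10) +
        a * b * (l * e01 + m * e11)
    · push Not at hm
      obtain ⟨i, hi⟩ := Function.ne_iff.mp hx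
      obtain ⟨v, κ, hv⟩ : ∃ (v : Fin 5 → ℚ) (κ : K), ∀ j, x j = κ * φ (v j) := by
        by_cases hyi : y i = 0
        · refine ⟨z, x i * (φ (z i))⁻¹, fun j => ?_⟩
          have hzi : φ (z i) ≠ 0 := by
            intro h; apply hi; rw [hyz, hyi, h]; simp
          have : φ (y i * z j - y j * z i) = 0 := by rw [hm]; simp
          simp only [map_sub, map_mul] at this
          rw [hyz j, hyz i]
          field_simp
          linear_combination -this
        · refine ⟨y, x i * (φ (y i))⁻¹, fun j => ?_⟩
          have hzi : φ (y i) ≠ 0 := (map_ne_zero _).mpr hyi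
          have : φ (y i * z j - y j * z i) = 0 := by rw [hm]; simp
          simp only [map_sub, map_mul] at this
          rw [hyz j, hyz i]
          field_simp
          linear_combination ξ * this
      have hκ : κ ≠ 0 := by rintro rfl; exact hi (by simp [hv])
      refine exists_line_of_point (d : ℚ) v ?_ ?_ ?_
      · rintro rfl
        exact hi (by simp [hv])
      · apply hφ
        apply mul_left_cancel₀ (pow_ne_zero 2 hκ)
        simp only [Q0, hv] at h₀
        simp only [formZero, map_add, map_sub, map_mul, map_pow, map_ofNat, map_intCast, map_zero]
        linear_combination h₀
      · apply hφ
        apply mul_left_cancel₀ (pow_ne_zero 2 hκ)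
        simp only [Qinf, hv] at h₁
        simp only [formInf, map_add, map_sub, map_mul, map_pow, map_ofNat, map_intCast, map_zero,
          map_neg]
        linear_combination h₁

lemma exists_integral_multiple {ι : Type*} [Finite ι] (v : ι → ℚ) :
    ∃ N : ℤ, N ≠ 0 ∧ ∃ w : ι → ℤ, ∀ i, (w i : ℚ) = N * v i := by
  obtain ⟨b, hb⟩ := IsLocalization.exist_integer_multiples_of_finite (nonZeroDivisors ℤ) v
  choose w hw using hb
  refine ⟨b, nonZeroDivisors.coe_ne_zero b, w, fun i => ?_⟩
  simpa [Submonoid.smul_def] using hw i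

lemma exists_coprime_integral_multiple (l m : ℚ) (h : l ≠ 0 ∨ m ≠ 0) :
    ∃ c : ℚ, ∃ l' m' : ℤ, IsCoprime l' m' ∧ (l' : ℚ) = c * l ∧ (m' : ℚ) = c * m := by
  obtain ⟨N, hN, w, hw⟩ := exists_integral_multiple ![l, m]
  have h0 : (w 0 : ℚ) = N * l := hw 0
  have h1 : (w 1 : ℚ) = N * m := hw 1
  have hNQ : (N : ℚ) ≠ 0 := by exact_mod_cast hN
  have hne : GCDMonoid.gcd (w 0) (w 1) ≠ 0 := by
    intro hg
    rw [gcd_eq_zero_iff] at hg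
    rw [hg.1, Int.cast_zero, eq_comm, mul_eq_zero] at h0
    rw [hg.2, Int.cast_zero, eq_comm, mul_eq_zero] at h1
    rcases h with h | h
    · exact h (h0.resolve_left hNQ)
    · exact h (h1.resolve_left hNQ)
  have hgQ : ((GCDMonoid.gcd (w 0) (w 1) : ℤ) : ℚ) ≠ 0 := by exact_mod_cast hne
  refine ⟨N / (GCDMonoid.gcd (w 0) (w 1) : ℤ), _, _, isCoprime_div_gcd_div_gcd_of_gcd_ne_zero hne,
    ?_, ?_⟩
  · rw [Int.cast_div (GCDMonoid.gcd_dvd_left _ _) hgQ, h0]; ring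
  · rw [Int.cast_div (GCDMonoid.gcd_dvd_right _ _) hgQ, h1]; ring

/-- Integral form of `exists_line_of_quadratic_point`. -/
lemma exists_integral_line_of_quadratic_point (d : ℤ) {K : Type*} [Field K] [Algebra ℚ K]
    [FiniteDimensional ℚ K] (hK : Module.finrank ℚ K ≤ 2) (x : Fin 5 → K) (hx : x ≠ 0)
    (h₀ : Q0 d x = 0) (h₁ : Qinf d x = 0) :
    ∃ l m : ℤ, IsCoprime l m ∧ ∃ y z : Fin 5 → ℤ, (∃ i j, y i * z j - y j * z i ≠ 0) ∧
      ∀ a b : ℤ, pencil d l m (fun i => a * y i + b * z i) = 0 := by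
  obtain ⟨l, m, hlm, y, z, ⟨i, j, hij⟩, hiso⟩ :=
    exists_line_of_quadratic_point d hK x hx h₀ h₁
  obtain ⟨c, l', m', hcop, hl, hm⟩ := exists_coprime_integral_multiple l m hlm
  obtain ⟨N, hN, y', hy⟩ := exists_integral_multiple y
  obtain ⟨M, hM, z', hz⟩ := exists_integral_multiple z
  have hNQ : (N : ℚ) ≠ 0 := by exact_mod_cast hN
  have hMQ : (M : ℚ) ≠ 0 := by exact_mod_cast hM
  refine ⟨l', m', hcop, y', z', ⟨i, j, fun h => ?_⟩, fun a b => ?_⟩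
  · have : ((y' i * z' j - y' j * z' i : ℤ) : ℚ) = 0 := by rw [h]; simp
    push_cast at this
    rw [hy, hy, hz, hz] at this
    exact mul_ne_zero (mul_ne_zero hNQ hMQ) hij (by linear_combination this)
  · have h := hiso (a * N) (b * M)
    have : ((pencil d l' m' (fun i => a * y' i + b * z' i) : ℤ) : ℚ) = 0 := by
      simp only [pencil, formZero, formInf] at h ⊢
      push_cast
      simp only [hy, hz, hl, hm]
      linear_combination c * h
    exact_mod_cast this

/-- A rank two sublattice of `ℤⁿ` totally isotropic for a quadratic form can be replaced by one
which stays of rank two modulo `p`. -/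
lemma exists_isotropic_independent_mod {n : ℕ} (p : ℕ) [Fact p.Prime] (G : (Fin n → ℤ) → ℤ)
    (hG : ∀ (c : ℤ) (v : Fin n → ℤ), G (fun i => c * v i) = c ^ 2 * G v) (i j : Fin n) :
    ∀ (N : ℕ) (y z : Fin n → ℤ), (y i * z j - y j * z i).natAbs = N →
      y i * z j - y j * z i ≠ 0 → (∀ a b : ℤ, G (fun i => a * y i + b * z i) = 0) →
      ∃ y z : Fin n → ℤ, (∀ a b : ℤ, G (fun i => a * y i + b * z i) = 0) ∧
        ∀ a b : ℤ, (∀ i, (p : ℤ) ∣ a * y i + b * z i) → (p : ℤ) ∣ a ∧ (p : ℤ) ∣ b := by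
  have hp : (p : ℤ) ≠ 0 := by exact_mod_cast (Fact.out : p.Prime).ne_zero
  have hp1 : 1 < p := (Fact.out : p.Prime).one_lt
  have hprime : Prime (p : ℤ) := Nat.prime_iff_prime_int.mp Fact.out
  intro N
  induction N using Nat.strong_induction_on with
  | _ N ih =>
  have key : ∀ (y z : Fin n → ℤ), (y i * z j - y j * z i).natAbs = N →
      y i * z j - y j * z i ≠ 0 → (∀ a b : ℤ, G (fun i => a * y i + b * z i) = 0) →
      ∀ a b : ℤ, (∀ i, (p : ℤ) ∣ a * y i + b * z i) → ¬ (p : ℤ) ∣ a →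
      ∃ y z : Fin n → ℤ, (∀ a b : ℤ, G (fun i => a * y i + b * z i) = 0) ∧
        ∀ a b : ℤ, (∀ i, (p : ℤ) ∣ a * y i + b * z i) → (p : ℤ) ∣ a ∧ (p : ℤ) ∣ b := by
    intro y z hN hne hiso a b hab ha
    obtain ⟨u, v, huv⟩ := (hprime.coprime_iff_not_dvd.mpr ha)
    have hdvd : ∀ k, (p : ℤ) ∣ y k + v * b * z k := fun k => by
      obtain ⟨c, hc⟩ := hab k
      exact ⟨v * c + u * y k, by linear_combination v * hc - y k * huv⟩
    choose y' hy' using hdvd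
    have hmin : y i * z j - y j * z i = p * (y' i * z j - y' j * z i) := by
      linear_combination z j * hy' i - z i * hy' j
    have hne' : y' i * z j - y' j * z i ≠ 0 := fun h => hne (by rw [hmin, h, mul_zero])
    refine ih _ ?_ y' z rfl hne' fun s t => ?_
    · rw [← hN, hmin, Int.natAbs_mul, Int.natAbs_natCast]
      have := Int.natAbs_pos.mpr hne'
      nlinarith
    · have h1 := hiso s (s * (v * b) + p * t)
      have h2 : (fun k => s * y k + (s * (v * b) + p * t) * z k) =
          fun k => (p : ℤ) * (s * y' k + t * z k) := by
        funext k; linear_combination s * hy' k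
      rw [h2, hG] at h1
      exact (mul_eq_zero.mp h1).resolve_left (pow_ne_zero 2 hp)
  intro y z hN hne hiso
  by_cases h : ∀ a b : ℤ, (∀ i, (p : ℤ) ∣ a * y i + b * z i) → (p : ℤ) ∣ a ∧ (p : ℤ) ∣ b
  · exact ⟨y, z, hiso, h⟩
  · push Not at h
    obtain ⟨a, b, hab, hnot⟩ := h
    by_cases ha : (p : ℤ) ∣ a
    · refine key z y ?_ ?_ ?_ b a ?_ (hnot ha)
      · rw [← hN, ← Int.natAbs_neg]; congr 1; ring
      · intro h; exact hne (by linear_combination -h)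
      · intro s t; simpa only [add_comm] using hiso t s
      · intro k; simpa only [add_comm] using hab k
    · exact key y z hN hne hiso a b hab ha

/-- If `e v² + S` is a quadratic form in four variables, with `S` ternary, which admits a totally
isotropic plane, then its determinant is a square. -/
lemma isSquare_det_of_isotropic_plane {k : Type*} [Field k] [NeZero (2 : k)]
    (e A B C D E F : k) (he : e ≠ 0)
    (P Q : Fin 4 → k) (hind : ∀ a b : k, (∀ i, a * P i + b * Q i = 0) → a = 0 ∧ b = 0)
    (hiso : ∀ a b : k, e * (a * P 0 + b * Q 0) ^ 2 + A * (a * P 1 + b * Q 1) ^ 2 +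
      B * (a * P 2 + b * Q 2) ^ 2 + C * (a * P 3 + b * Q 3) ^ 2 +
      2 * (D * (a * P 1 + b * Q 1) * (a * P 2 + b * Q 2) +
        E * (a * P 1 + b * Q 1) * (a * P 3 + b * Q 3) +
        F * (a * P 2 + b * Q 2) * (a * P 3 + b * Q 3)) = 0) :
    IsSquare (e * (A * B * C + 2 * D * E * F - A * F ^ 2 - B * E ^ 2 - C * D ^ 2)) := by
  have h2 : (2 : k) ≠ 0 := NeZero.ne 2
  have hP := hiso 1 0
  have hQ := hiso 0 1
  have hPQ : e * P 0 * Q 0 + A * P 1 * Q 1 + B * P 2 * Q 2 + C * P 3 * Q 3 +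
      D * (P 1 * Q 2 + P 2 * Q 1) + E * (P 1 * Q 3 + P 3 * Q 1) +
      F * (P 2 * Q 3 + P 3 * Q 2) = 0 := by
    apply mul_left_cancel₀ h2
    linear_combination hiso 1 1 - hP - hQ
  set Δ := A * B * C + 2 * D * E * F - A * F ^ 2 - B * E ^ 2 - C * D ^ 2 with hΔ
  -- the Gram determinant of `P`, `Q` and a third vector `x`
  have gram : ∀ x y z : k, IsSquare (e * Δ) ∨
      x * (P 2 * Q 3 - P 3 * Q 2) + y * (P 3 * Q 1 - P 1 * Q 3) +
        z * (P 1 * Q 2 - P 2 * Q 1) = 0 := by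
    intro x y z
    by_cases hx : x * (P 2 * Q 3 - P 3 * Q 2) + y * (P 3 * Q 1 - P 1 * Q 3) +
        z * (P 1 * Q 2 - P 2 * Q 1) = 0
    · exact Or.inr hx
    set δ := x * (P 2 * Q 3 - P 3 * Q 2) + y * (P 3 * Q 1 - P 1 * Q 3) +
        z * (P 1 * Q 2 - P 2 * Q 1) with hδ
    set b₁ := A * P 1 * x + B * P 2 * y + C * P 3 * z + D * (P 1 * y + P 2 * x) +
      E * (P 1 * z + P 3 * x) + F * (P 2 * z + P 3 * y) with hb₁
    set b₂ := A * Q 1 * x + B * Q 2 * y + C * Q 3 * z + D * (Q 1 * y + Q 2 * x) +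
      E * (Q 1 * z + Q 3 * x) + F * (Q 2 * z + Q 3 * y) with hb₂
    set c := A * x ^ 2 + B * y ^ 2 + C * z ^ 2 + 2 * (D * x * y + E * x * z + F * y * z) with hc
    set gP := A * P 1 ^ 2 + B * P 2 ^ 2 + C * P 3 ^ 2 +
      2 * (D * P 1 * P 2 + E * P 1 * P 3 + F * P 2 * P 3) with hgP
    set gQ := A * Q 1 ^ 2 + B * Q 2 ^ 2 + C * Q 3 ^ 2 +
      2 * (D * Q 1 * Q 2 + E * Q 1 * Q 3 + F * Q 2 * Q 3) with hgQ
    set gPQ := A * P 1 * Q 1 + B * P 2 * Q 2 + C * P 3 * Q 3 +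
      D * (P 1 * Q 2 + P 2 * Q 1) + E * (P 1 * Q 3 + P 3 * Q 1) +
      F * (P 2 * Q 3 + P 3 * Q 2) with hgPQ
    have hdet : δ ^ 2 * Δ = gP * gQ * c + 2 * gPQ * b₁ * b₂ - gP * b₂ ^ 2 - gQ * b₁ ^ 2 -
        c * gPQ ^ 2 := by
      rw [hδ, hΔ, hb₁, hb₂, hc, hgP, hgQ, hgPQ]; ring
    have e1 : gP = -(e * P 0 ^ 2) := by linear_combination hP
    have e2 : gQ = -(e * Q 0 ^ 2) := by linear_combination hQ
    have e3 : gPQ = -(e * P 0 * Q 0) := by linear_combination hPQ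
    clear_value δ b₁ b₂ c gP gQ gPQ Δ
    rw [e1, e2, e3] at hdet
    refine Or.inl ⟨e * (P 0 * b₂ - Q 0 * b₁) / δ, ?_⟩
    field_simp
    linear_combination hdet
  by_contra hns
  have c1 := (gram 1 0 0).resolve_left hns
  have c2 := (gram 0 1 0).resolve_left hns
  have c3 := (gram 0 0 1).resolve_left hns
  have hmul : ∀ a b : k, a * P 1 + b * Q 1 = 0 → a * P 2 + b * Q 2 = 0 →
      a * P 3 + b * Q 3 = 0 → a = 0 ∧ b = 0 := by
    intro a b h1 h2 h3
    apply hind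
    have h := hiso a b
    rw [h1, h2, h3] at h
    have h0 : a * P 0 + b * Q 0 = 0 := by
      have : e * (a * P 0 + b * Q 0) ^ 2 = 0 := by linear_combination h
      exact pow_eq_zero_iff two_ne_zero |>.mp ((mul_eq_zero.mp this).resolve_left he)
    intro i
    fin_cases i <;> assumption
  have r1 := (hmul (Q 1) (-P 1) (by ring) (by linear_combination -c3) (by linear_combination c2)).2
  have r2 := (hmul (Q 2) (-P 2) (by linear_combination c3) (by ring) (by linear_combination -c1)).2
  have r3 := (hmul (Q 3) (-P 3) (by linear_combination -c2) (by linear_combination c1) (by ring)).2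
  rw [neg_eq_zero] at r1 r2 r3
  exact one_ne_zero (hmul 1 0 (by simp [r1]) (by simp [r2]) (by simp [r3])).1

/-- The multiple `l * (l Q₀ + m Q∞)` in coordinates adapted to the norm form of its binary part,
where `m² + 3l² = t²a` for some `t`. -/
def twistedForm {R : Type*} [CommRing R] (d a l m : R) (v : Fin 5 → R) : R :=
  d * (v 0 ^ 2 - a * v 1 ^ 2) + l * (l * (6 * v 2 ^ 2 + 6 * v 2 * v 3 - 6 * v 3 * v 4) +
    m * (v 2 ^ 2 - 2 * v 2 * v 4 - 3 * v 3 ^ 2 - v 4 ^ 2))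

/-- A line on `l Q₀ + m Q∞` over `ℤ₃` forces `3 ∣ m`. -/
lemma three_dvd_of_isotropic_plane {d l m : ℤ} (hd : d ≡ 2 [ZMOD 3]) {y z : Fin 5 → ℤ}
    (hiso : ∀ a b : ℤ, pencil d l m (fun i => a * y i + b * z i) = 0)
    (hind : ∀ a b : ℤ, (∀ i, (3 : ℤ) ∣ a * y i + b * z i) → (3 : ℤ) ∣ a ∧ (3 : ℤ) ∣ b) :
    3 ∣ m := by
  by_contra hm
  have hm' : (m : ZMod 3) ≠ 0 := fun h => hm ((ZMod.intCast_zmod_eq_zero_iff_dvd m 3).mp h)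
  have hd' : (d : ZMod 3) = 2 := by
    have := (ZMod.intCast_eq_intCast_iff d 2 3).mpr hd
    simpa using this
  have h3 : (3 : ZMod 3) = 0 := by decide
  by_cases h : ∀ a b : ZMod 3, (∀ i : Fin 5, i ≠ 3 → a * (y i : ZMod 3) + b * (z i : ZMod 3) = 0) →
      a = 0 ∧ b = 0
  · have : NeZero (2 : ZMod 3) := ⟨by decide⟩
    have hsq := isSquare_det_of_isotropic_plane (k := ZMod 3) 2 m (-m) (-2) (-m) 0 0 (by decide)
      ![y 0 + (l * y 0 + m * y 1), y 2, y 4, y 0 - (l * y 0 + m * y 1)]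
      ![z 0 + (l * z 0 + m * z 1), z 2, z 4, z 0 - (l * z 0 + m * z 1)] ?_ ?_
    · revert hsq
      generalize (m : ZMod 3) = m at hm'
      revert hm' m
      decide
    · intro a b hab
      have e0 := hab 0
      have e1 := hab 1
      have e2 := hab 2
      have e3 := hab 3
      simp only [Matrix.cons_val] at e0 e1 e2 e3
      have hz : a * (y 0 : ZMod 3) + b * (z 0 : ZMod 3) = 0 := by
        linear_combination 2 * (e0 + e3) - (a * (y 0 : ZMod 3) + b * (z 0 : ZMod 3)) * h3
      apply h
      intro i hi
      fin_cases i
      · exact hz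
      · apply (mul_eq_zero.mp (?_ : (m : ZMod 3) * _ = 0)).resolve_left hm'
        change (m : ZMod 3) * (a * (y 1 : ZMod 3) + b * (z 1 : ZMod 3)) = 0
        linear_combination e0 - (1 + (l : ZMod 3)) * hz
      · exact e1
      · exact absurd rfl hi
      · exact e2
    · intro a b
      obtain ⟨a, rfl⟩ := ZMod.intCast_surjective a
      obtain ⟨b, rfl⟩ := ZMod.intCast_surjective b
      have hc := congrArg (Int.cast : ℤ → ZMod 3) (hiso a b)
      simp only [pencil, formZero, formInf] at hc
      push_cast at hc
      rw [hd'] at hc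
      simp only [Matrix.cons_val]
      set w : Fin 5 → ZMod 3 := fun i => a * (y i : ZMod 3) + b * (z i : ZMod 3) with hw
      have hc' : (l : ZMod 3) * (2 * (w 0 ^ 2 - 3 * w 1 ^ 2) + 6 * w 2 ^ 2 + 6 * w 2 * w 3 -
          6 * w 3 * w 4) + m * (-2 * 2 * w 0 * w 1 + w 2 ^ 2 - 2 * w 2 * w 4 - 3 * w 3 ^ 2 -
          w 4 ^ 2) = 0 := hc
      have hT : 2 * (w 0 + ((l : ZMod 3) * w 0 + m * w 1)) ^ 2 + m * w 2 ^ 2 + -m * w 4 ^ 2 +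
          -2 * (w 0 - (l * w 0 + m * w 1)) ^ 2 + 2 * (-m * w 2 * w 4) = 0 := by
        linear_combination hc' + (2 * l * w 0 ^ 2 + 4 * m * w 0 * w 1 + 2 * l * w 1 ^ 2
          - 2 * l * (w 2 ^ 2 + w 2 * w 3 - w 3 * w 4) + m * w 3 ^ 2) * h3
      simp only [hw] at hT
      linear_combination hT
  · push Not at h
    obtain ⟨a, b, hab, hne⟩ := h
    obtain ⟨a, rfl⟩ := ZMod.intCast_surjective a
    obtain ⟨b, rfl⟩ := ZMod.intCast_surjective b
    have hdvd : ∀ i : Fin 5, i ≠ 3 → (3 : ℤ) ∣ a * y i + b * z i := fun i hi => by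
      have := hab i hi
      exact (ZMod.intCast_zmod_eq_zero_iff_dvd _ 3).mp (by push_cast; exact this)
    have hw := hiso a b
    simp only [pencil, formZero, formInf] at hw
    obtain ⟨k0, h0⟩ := hdvd 0 (by decide)
    obtain ⟨k1, h1⟩ := hdvd 1 (by decide)
    obtain ⟨k2, h2⟩ := hdvd 2 (by decide)
    obtain ⟨k4, h4⟩ := hdvd 4 (by decide)
    rw [h0, h1, h2, h4] at hw
    have h3' : (3 : ℤ) ∣ m * (a * y 3 + b * z 3) ^ 2 := by
      refine ⟨l * (d * (k0 ^ 2 - 3 * k1 ^ 2) + 6 * k2 ^ 2 + 2 * k2 * (a * y 3 + b * z 3) -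
        2 * (a * y 3 + b * z 3) * k4) + m * (-2 * d * k0 * k1 + k2 ^ 2 - 2 * k2 * k4 - k4 ^ 2), ?_⟩
      apply mul_left_cancel₀ (three_ne_zero (α := ℤ))
      linear_combination -hw
    have h3'' : (3 : ℤ) ∣ a * y 3 + b * z 3 :=
      Int.prime_three.dvd_of_dvd_pow ((Int.prime_three.dvd_or_dvd h3').resolve_left hm)
    obtain ⟨ha, hb⟩ := hind a b fun i => by
      by_cases hi : i = 3
      · rw [hi]; exact h3''
      · exact hdvd i hi
    exact hne ((ZMod.intCast_zmod_eq_zero_iff_dvd a 3).mpr ha)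
      ((ZMod.intCast_zmod_eq_zero_iff_dvd b 3).mpr hb)

/-- A line on the twisted form over `ℤ_p` forces `d` to be a square modulo `p` when `p` divides
`a` exactly once and does not divide `6 * d * l`. -/
lemma isSquare_of_isotropic_plane_s4 {p : ℕ} [Fact p.Prime] (hp2 : p ≠ 2) (hp3 : p ≠ 3)
    {d a l m t : ℤ} (hpd : ¬ (p : ℤ) ∣ d) (hpa : (p : ℤ) ∣ a) (hpa2 : ¬ (p : ℤ) * p ∣ a)
    (hpl : ¬ (p : ℤ) ∣ l) (hnorm : m ^ 2 + 3 * l ^ 2 = t ^ 2 * a) {y z : Fin 5 → ℤ}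
    (hiso : ∀ b c : ℤ, twistedForm d a l m (fun i => b * y i + c * z i) = 0)
    (hind : ∀ b c : ℤ, (∀ i, (p : ℤ) ∣ b * y i + c * z i) → (p : ℤ) ∣ b ∧ (p : ℤ) ∣ c) :
    IsSquare (d : ZMod p) := by
  have hprime : Prime (p : ℤ) := Nat.prime_iff_prime_int.mp Fact.out
  have hp : (p : ℤ) ≠ 0 := hprime.ne_zero
  have cast_ne : ∀ c : ℤ, ¬ (p : ℤ) ∣ c → (c : ZMod p) ≠ 0 := fun c hc h =>
    hc ((ZMod.intCast_zmod_eq_zero_iff_dvd c p).mp h)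
  have nat_ne : ∀ q : ℕ, q.Prime → p ≠ q → (q : ZMod p) ≠ 0 := fun q hq hpq h =>
    hpq ((Nat.prime_dvd_prime_iff_eq Fact.out hq).mp ((ZMod.natCast_eq_zero_iff q p).mp h))
  have h2 : (2 : ZMod p) ≠ 0 := by simpa using nat_ne 2 Nat.prime_two hp2
  have h3 : (3 : ZMod p) ≠ 0 := by simpa using nat_ne 3 Nat.prime_three hp3
  have hd := cast_ne d hpd
  have hl := cast_ne l hpl
  have ha : (a : ZMod p) = 0 := (ZMod.intCast_zmod_eq_zero_iff_dvd a p).mpr hpa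
  have hml : (m : ZMod p) ^ 2 = -3 * l ^ 2 := by
    have := congrArg (Int.cast : ℤ → ZMod p) hnorm
    push_cast at this
    rw [ha] at this
    linear_combination this
  have hm : (m : ZMod p) ≠ 0 := by
    intro h
    rw [h] at hml
    exact mul_ne_zero (neg_ne_zero.mpr h3) (pow_ne_zero 2 hl) (by linear_combination -hml)
  by_cases h : ∀ b c : ZMod p, (∀ i : Fin 5, i ≠ 1 → b * (y i : ZMod p) + c * (z i : ZMod p) = 0) →
      b = 0 ∧ c = 0
  · have : NeZero (2 : ZMod p) := ⟨h2⟩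
    obtain ⟨s, hs⟩ := isSquare_det_of_isotropic_plane (k := ZMod p) d (l * (6 * l + m))
      (-3 * l * m) (-l * m) (3 * l ^ 2) (-l * m) (-3 * l ^ 2) hd
      ![y 0, y 2, y 3, y 4] ![z 0, z 2, z 3, z 4]
      (fun b c hbc => h b c fun i hi => by
        fin_cases i
        · exact hbc 0
        · exact absurd rfl hi
        · exact hbc 1
        · exact hbc 2
        · exact hbc 3)
      (fun b c => by
        obtain ⟨b, rfl⟩ := ZMod.intCast_surjective b
        obtain ⟨c, rfl⟩ := ZMod.intCast_surjective c
        have hc := congrArg (Int.cast : ℤ → ZMod p) (hiso b c)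
        simp only [twistedForm] at hc
        push_cast at hc
        rw [ha] at hc
        simp only [Matrix.cons_val]
        linear_combination hc)
    refine ⟨s / (6 * l ^ 2 * m), ?_⟩
    have h6 : (6 : ZMod p) ≠ 0 := by
      rw [show (6 : ZMod p) = 2 * 3 by norm_num]; exact mul_ne_zero h2 h3
    rw [div_mul_div_comm, eq_div_iff (by simp [h6, hl, hm]), ← hs]
    linear_combination (d * l ^ 3 * (18 * l * 1 - 6 * m)) * hml
  · push Not at h
    obtain ⟨b, c, hbc, hne⟩ := h
    exfalso
    obtain ⟨b, rfl⟩ := ZMod.intCast_surjective b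
    obtain ⟨c, rfl⟩ := ZMod.intCast_surjective c
    have hdvd : ∀ i : Fin 5, i ≠ 1 → (p : ℤ) ∣ b * y i + c * z i := fun i hi => by
      have := hbc i hi
      exact (ZMod.intCast_zmod_eq_zero_iff_dvd _ p).mp (by push_cast; exact this)
    have hw := hiso b c
    simp only [twistedForm] at hw
    obtain ⟨k0, e0⟩ := hdvd 0 (by decide)
    obtain ⟨k2, e2⟩ := hdvd 2 (by decide)
    obtain ⟨k3, e3⟩ := hdvd 3 (by decide)
    obtain ⟨k4, e4⟩ := hdvd 4 (by decide)
    rw [e0, e2, e3, e4] at hw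
    obtain ⟨a', rfl⟩ := hpa
    have h3' : (p : ℤ) ∣ d * a' * (b * y 1 + c * z 1) ^ 2 := by
      refine ⟨d * k0 ^ 2 + l * (l * (6 * k2 ^ 2 + 6 * k2 * k3 - 6 * k3 * k4) +
        m * (k2 ^ 2 - 2 * k2 * k4 - 3 * k3 ^ 2 - k4 ^ 2)), ?_⟩
      apply mul_left_cancel₀ hp
      linear_combination -hw
    have ha' : ¬ (p : ℤ) ∣ a' := fun h => hpa2 (mul_dvd_mul_left _ h)
    have h3'' : (p : ℤ) ∣ b * y 1 + c * z 1 :=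
      hprime.dvd_of_dvd_pow ((hprime.dvd_or_dvd h3').resolve_left fun h =>
        (hprime.dvd_or_dvd h).elim hpd ha')
    obtain ⟨hb, hc⟩ := hind b c fun i => by
      by_cases hi : i = 1
      · rw [hi]; exact h3''
      · exact hdvd i hi
    exact hne ((ZMod.intCast_zmod_eq_zero_iff_dvd b p).mpr hb)
      ((ZMod.intCast_zmod_eq_zero_iff_dvd c p).mpr hc)

/-- A line on the twisted form over a field in which the generic root of `T³ + 3T² + 3T - 9` is a
square produces a common value of the norm form of the binary part and its multiple by `d`. -/
lemma exists_norm_eq_of_isotropic_plane {k : Type*} [Field k] {d a l m t s₀ s₁ s₂ : k}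
    (hl : l ≠ 0) (ht : t ≠ 0) (hnorm : m ^ 2 + 3 * l ^ 2 = t ^ 2 * a) (h3 : (3 : k) ≠ 0)
    (hs₀ : s₀ ^ 2 + 18 * s₁ * s₂ - 27 * s₂ ^ 2 = 0)
    (hs₁ : 2 * s₀ * s₁ - 6 * s₁ * s₂ + 18 * s₂ ^ 2 = 1)
    (hs₂ : s₁ ^ 2 + 2 * s₀ * s₂ - 6 * s₁ * s₂ + 6 * s₂ ^ 2 = 0)
    {y z : Fin 5 → k} (hyz : ∃ i j, y i * z j - y j * z i ≠ 0)
    (hiso : ∀ b c : k, twistedForm d a l m (fun i => b * y i + c * z i) = 0) :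
    ∃ x : Fin 4 → k, x ≠ 0 ∧ d * (x 0 ^ 2 - a * x 1 ^ 2) = x 2 ^ 2 - a * x 3 ^ 2 := by
  let T : (Fin 4 → k) →ₗ[k] (Fin 3 → k) :=
    { toFun := fun c => ![c 0 * y 2 + c 1 * z 2 - (c 2 * (3 * s₂) + c 3 * (3 * s₁ - 9 * s₂)),
        c 0 * y 3 + c 1 * z 3 - (c 2 * (-s₁) + c 3 * (-s₀ + 3 * s₂)),
        c 0 * y 4 + c 1 * z 4 - (c 2 * s₀ + c 3 * (9 * s₂))]
      map_add' := fun c e => by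
        ext j; fin_cases j <;> simp <;> ring
      map_smul' := fun c e => by
        ext j; fin_cases j <;> simp <;> ring }
  have hker : LinearMap.ker T ≠ ⊥ := LinearMap.ker_ne_bot_of_finrank_lt (by simp)
  obtain ⟨c, hc, hc0⟩ := (Submodule.ne_bot_iff _).mp hker
  rw [LinearMap.mem_ker] at hc
  have e2 : c 0 * y 2 + c 1 * z 2 - (c 2 * (3 * s₂) + c 3 * (3 * s₁ - 9 * s₂)) = 0 := congrFun hc 0
  have e3 : c 0 * y 3 + c 1 * z 3 - (c 2 * (-s₁) + c 3 * (-s₀ + 3 * s₂)) = 0 := congrFun hc 1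
  have e4 : c 0 * y 4 + c 1 * z 4 - (c 2 * s₀ + c 3 * (9 * s₂)) = 0 := congrFun hc 2
  rw [sub_eq_zero] at e2 e3 e4
  refine ⟨![c 0 * y 0 + c 1 * z 0, c 0 * y 1 + c 1 * z 1, l * (3 * c 3) + m * c 2, t * c 2],
    fun h => hc0 ?_, ?_⟩
  · have w0 : c 0 * y 0 + c 1 * z 0 = 0 := congrFun h 0
    have w1 : c 0 * y 1 + c 1 * z 1 = 0 := congrFun h 1
    have n0 : l * (3 * c 3) + m * c 2 = 0 := congrFun h 2
    have n1 : t * c 2 = 0 := congrFun h 3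
    have c2 : c 2 = 0 := (mul_eq_zero.mp n1).resolve_left ht
    rw [c2, mul_zero, add_zero] at n0
    have c3 : c 3 = 0 :=
      (mul_eq_zero.mp ((mul_eq_zero.mp n0).resolve_left hl)).resolve_left h3
    rw [c2, c3, zero_mul, zero_mul, add_zero] at e2 e3 e4
    have hw : ∀ i, c 0 * y i + c 1 * z i = 0 := by
      intro i; fin_cases i <;> assumption
    obtain ⟨i, j, hij⟩ := hyz
    have c0 : c 0 = 0 := by
      refine (mul_eq_zero.mp (?_ : c 0 * (y i * z j - y j * z i) = 0)).resolve_right hij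
      linear_combination z j * hw i - z i * hw j
    have c1 : c 1 = 0 := by
      refine (mul_eq_zero.mp (?_ : c 1 * (y i * z j - y j * z i) = 0)).resolve_right hij
      linear_combination y i * hw j - y j * hw i
    funext i
    fin_cases i <;> assumption
  · have hw := hiso (c 0) (c 1)
    simp only [twistedForm] at hw
    rw [e2, e3, e4] at hw
    simp only [Matrix.cons_val]
    linear_combination hw - c 2 ^ 2 * hnorm
      - l ^ 2 * (c 2 ^ 2 * (3 * hs₁) + c 2 * c 3 * (6 * hs₀ - 18 * hs₂) +
        c 3 ^ 2 * (-9 * hs₁ + 54 * hs₂))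
      - l * m * (c 2 ^ 2 * (-hs₀ - 3 * hs₂) + c 2 * c 3 * (-6 * hs₁) +
        c 3 ^ 2 * (-3 * hs₀ + 9 * hs₂))

/-- A nonzero vector over `ℚ_p` is proportional to a primitive vector over `ℤ_p`. -/
lemma exists_primitive_multiple {p : ℕ} [Fact p.Prime] {n : ℕ} (x : Fin n → ℚ_[p]) (hx : x ≠ 0) :
    ∃ (c : ℚ_[p]) (w : Fin n → ℤ_[p]), (∀ i, (w i : ℚ_[p]) = c * x i) ∧
      ∃ i, ¬ (p : ℤ_[p]) ∣ w i := by
  obtain ⟨i₀, hi₀⟩ := Function.ne_iff.mp hx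
  have : Nonempty (Fin n) := ⟨i₀⟩
  obtain ⟨i, hi⟩ := Finite.exists_max fun i => ‖x i‖
  have hxi : x i ≠ 0 := by
    rw [← norm_pos_iff]
    exact (norm_pos_iff.mpr hi₀).trans_le (hi i₀)
  have hw : ∀ j, ∃ w : ℤ_[p], (w : ℚ_[p]) = (x i)⁻¹ * x j := fun j => by
    refine ⟨⟨(x i)⁻¹ * x j, ?_⟩, rfl⟩
    rw [norm_mul, norm_inv, inv_mul_le_iff₀ (norm_pos_iff.mpr hxi), mul_one]
    exact hi j
  choose w hw using hw
  refine ⟨(x i)⁻¹, w, hw, i, fun h => ?_⟩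
  have hwi : w i = 1 := by
    apply PadicInt.ext
    rw [hw, inv_mul_cancel₀ hxi, PadicInt.coe_one]
  exact PadicInt.prime_p.not_isUnit (isUnit_of_dvd_one (hwi ▸ h))

lemma padicInt_dvd_iff {p : ℕ} [Fact p.Prime] (x : ℤ_[p]) :
    (p : ℤ_[p]) ∣ x ↔ PadicInt.toZMod x = 0 := by
  rw [← RingHom.mem_ker, PadicInt.ker_toZMod, PadicInt.maximalIdeal_eq_span_p,
    Ideal.mem_span_singleton]

/-- A diagonal binary form which is anisotropic modulo `p` only represents multiples of `p`
trivially. -/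
lemma dvd_of_dvd_binary_form {p : ℕ} [Fact p.Prime] {e f : ℤ} (hf : ¬ (p : ℤ) ∣ f)
    (hef : ¬ IsSquare ((-(e * f) : ℤ) : ZMod p)) {x y : ℤ_[p]}
    (h : (p : ℤ_[p]) ∣ e * x ^ 2 + f * y ^ 2) : (p : ℤ_[p]) ∣ x ∧ (p : ℤ_[p]) ∣ y := by
  rw [padicInt_dvd_iff] at h ⊢
  rw [padicInt_dvd_iff]
  simp only [map_add, map_mul, map_pow, map_intCast] at h
  push_cast at hef
  have hf' : (f : ZMod p) ≠ 0 := fun h => hf ((ZMod.intCast_zmod_eq_zero_iff_dvd f p).mp h)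
  have hx : PadicInt.toZMod x = 0 := by
    by_contra hx
    refine hef ⟨f * PadicInt.toZMod y / PadicInt.toZMod x, ?_⟩
    field_simp
    linear_combination -h
  rw [hx] at h
  refine ⟨hx, ?_⟩
  simpa [hf'] using h

section PadicConditions

variable {p : ℕ} [Fact p.Prime] {d a l m t : ℤ}

/-- The integral, primitive version of the conclusion of `exists_norm_eq_of_isotropic_plane`. -/
lemma exists_primitive_norm_eq (hl : l ≠ 0) (ht : t ≠ 0)
    (hnorm : m ^ 2 + 3 * l ^ 2 = t ^ 2 * a)
    (hloc : ∀ (L : Type) [Field L] [Algebra ℚ_[p] L] [FiniteDimensional ℚ_[p] L],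
      ∀ θ : L, θ ^ 3 + 3 * θ ^ 2 + 3 * θ - 9 = 0 → Algebra.adjoin ℚ_[p] {θ} = ⊤ →
        ∃ s : L, s ^ 2 = θ)
    {y z : Fin 5 → ℤ} (hyz : ∃ i j, y i * z j - y j * z i ≠ 0)
    (hiso : ∀ b c : ℤ, twistedForm d a l m (fun i => b * y i + c * z i) = 0) :
    ∃ w : Fin 4 → ℤ_[p], (∃ i, ¬ (p : ℤ_[p]) ∣ w i) ∧
      (d : ℤ_[p]) * (w 0 ^ 2 - a * w 1 ^ 2) = w 2 ^ 2 - a * w 3 ^ 2 := by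
  obtain ⟨s₀, s₁, s₂, hs₀, hs₁, hs₂⟩ := exists_sqrt_coordinates hloc
  obtain ⟨i, j, hij⟩ := hyz
  have hQ : ∀ c : ℤ, c = 0 → (c : ℚ_[p]) = 0 := fun c hc => by rw [hc]; simp
  obtain ⟨x, hx, h⟩ := exists_norm_eq_of_isotropic_plane (k := ℚ_[p]) (d := d) (a := a) (l := l)
    (m := m) (t := t) (y := fun i => y i) (z := fun i => z i) (by exact_mod_cast hl)
    (by exact_mod_cast ht) (by exact_mod_cast hnorm) (by norm_num) hs₀ hs₁ hs₂
    ⟨i, j, by exact_mod_cast hij⟩ (fun b c => by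
      have h1 := hQ _ (hiso 1 0)
      have h2 := hQ _ (hiso 0 1)
      have h3 := hQ _ (hiso 1 1)
      simp only [twistedForm] at h1 h2 h3 ⊢
      push_cast at h1 h2 h3
      linear_combination (b ^ 2 - b * c) * h1 + (c ^ 2 - b * c) * h2 + b * c * h3)
  obtain ⟨c, w, hw, hi⟩ := exists_primitive_multiple x hx
  refine ⟨w, hi, ?_⟩
  apply PadicInt.ext
  push_cast
  rw [hw, hw, hw, hw]
  linear_combination c ^ 2 * h

lemma isSquare_of_primitive_norm_eq (hpd : (p : ℤ) ∣ d) (hpd2 : ¬ (p : ℤ) * p ∣ d)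
    (hpa : ¬ (p : ℤ) ∣ a)
    (h : ∃ w : Fin 4 → ℤ_[p], (∃ i, ¬ (p : ℤ_[p]) ∣ w i) ∧
      (d : ℤ_[p]) * (w 0 ^ 2 - a * w 1 ^ 2) = w 2 ^ 2 - a * w 3 ^ 2) :
    IsSquare (a : ZMod p) := by
  obtain ⟨w, ⟨i, hi⟩, h⟩ := h
  by_contra hns
  have hp : (p : ℤ_[p]) ≠ 0 := PadicInt.prime_p.ne_zero
  have hna : ¬ (p : ℤ) ∣ -a := fun h => hpa (by simpa using h)
  have hns' : ¬ IsSquare ((-(1 * -a) : ℤ) : ZMod p) := by simpa using hns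
  obtain ⟨d', rfl⟩ := hpd
  push_cast at h
  obtain ⟨⟨w2, h2⟩, ⟨w3, h3⟩⟩ := dvd_of_dvd_binary_form hna hns' (x := w 2) (y := w 3)
    ⟨d' * (w 0 ^ 2 - a * w 1 ^ 2), by push_cast; linear_combination -h⟩
  have hd' : ¬ (p : ℤ_[p]) ∣ d' := fun hd => hpd2 (mul_dvd_mul_left _ (by
    rw [padicInt_dvd_iff, map_intCast] at hd
    exact (ZMod.intCast_zmod_eq_zero_iff_dvd d' p).mp hd))
  obtain ⟨h0, h1⟩ := dvd_of_dvd_binary_form hna hns' (x := w 0) (y := w 1) (by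
    refine (PadicInt.prime_p.dvd_or_dvd (?_ : (p : ℤ_[p]) ∣ d' * _)).resolve_left hd'
    refine ⟨w2 ^ 2 - a * w3 ^ 2, ?_⟩
    apply mul_left_cancel₀ hp
    rw [h2, h3] at h
    push_cast
    linear_combination h)
  apply hi
  fin_cases i
  · exact h0
  · exact h1
  · exact ⟨_, h2⟩
  · exact ⟨_, h3⟩

lemma isSquare_neg_mul_of_primitive_norm_eq {d a : ℤ} (hpd : ¬ (p : ℤ) ∣ d) (hpa : ¬ (p : ℤ) ∣ a)
    (h : ∃ w : Fin 4 → ℤ_[p], (∃ i, ¬ (p : ℤ_[p]) ∣ w i) ∧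
      ((p * d : ℤ) : ℤ_[p]) * (w 0 ^ 2 - (p * a : ℤ) * w 1 ^ 2) =
        w 2 ^ 2 - (p * a : ℤ) * w 3 ^ 2) :
    IsSquare ((-(d * a) : ℤ) : ZMod p) := by
  obtain ⟨w, ⟨i, hi⟩, h⟩ := h
  by_contra hns
  have hp : (p : ℤ_[p]) ≠ 0 := PadicInt.prime_p.ne_zero
  push_cast at h
  obtain ⟨w2, h2⟩ : (p : ℤ_[p]) ∣ w 2 := by
    refine PadicInt.prime_p.dvd_of_dvd_pow (n := 2) ⟨d * (w 0 ^ 2 - p * a * w 1 ^ 2) +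
      a * w 3 ^ 2, ?_⟩
    linear_combination -h
  rw [h2] at h
  obtain ⟨⟨w0, h0⟩, ⟨w3, h3⟩⟩ := dvd_of_dvd_binary_form hpa hns (x := w 0) (y := w 3) (by
    refine ⟨w2 ^ 2 + d * a * w 1 ^ 2, ?_⟩
    apply mul_left_cancel₀ hp
    linear_combination h)
  rw [h0, h3] at h
  have hns' : ¬ IsSquare ((-(1 * (d * a)) : ℤ) : ZMod p) := by rwa [one_mul]
  obtain ⟨-, h1⟩ := dvd_of_dvd_binary_form (f := d * a) (fun hda =>
      (Int.Prime.dvd_mul' Fact.out hda).elim hpd hpa) hns' (x := w2) (y := w 1) (by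
    refine ⟨d * w0 ^ 2 + a * w3 ^ 2, ?_⟩
    apply mul_left_cancel₀ (pow_ne_zero 2 hp)
    push_cast
    linear_combination -h)
  apply hi
  fin_cases i
  · exact ⟨_, h0⟩
  · exact h1
  · exact ⟨_, h2⟩
  · exact ⟨_, h3⟩

end PadicConditions

open NumberTheorySymbols in
lemma jacobiSym_eq_one_of_isSquare {x : ℤ} {n : ℕ}
    (h : ∀ (p : ℕ) [Fact p.Prime], p ∣ n → IsSquare (x : ZMod p) ∧ ¬ (p : ℤ) ∣ x) :
    J(x | n) = 1 := by
  apply List.prod_eq_one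
  intro s hs
  obtain ⟨p, hp, rfl⟩ := List.mem_pmap.mp hs
  have : Fact p.Prime := ⟨Nat.prime_of_mem_primeFactorsList hp⟩
  obtain ⟨h1, h2⟩ := h p (Nat.dvd_of_mem_primeFactorsList hp)
  exact (legendreSym.eq_one_iff p fun h0 =>
    h2 ((ZMod.intCast_zmod_eq_zero_iff_dvd x p).mp h0)).mpr h1

open NumberTheorySymbols in
lemma jacobiSym_three_eq_neg_one {n : ℕ} (hn : n % 12 = 5 ∨ n % 12 = 7) : J(3 | n) = -1 := by
  have hodd : Odd n := Nat.odd_iff.mpr (by lia)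
  rw [jacobiSym.mod_right 3 hodd]
  rcases hn with hn | hn
  · norm_num [hn]
  · norm_num [hn]

open NumberTheorySymbols in
/-- Quadratic reciprocity excludes a system of simultaneous square conditions. -/
lemma jacobiSym_system_false {g a₁ : ℕ} {d₁ : ℤ} (ha : Odd a₁) (hd : g * d₁ ≡ 5 [ZMOD 12])
    (h₁ : J(g * d₁ | a₁) = 1) (h₂ : J(3 * (g * a₁) | d₁.natAbs) = 1)
    (h₃ : J(-(3 * (a₁ * d₁)) | g) = 1) : False := by
  obtain ⟨D, ε, hε, hd₁⟩ : ∃ (D : ℕ) (ε : ℤ), (ε = 1 ∨ ε = -1) ∧ d₁ = ε * D := by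
    rcases Int.natAbs_eq d₁ with h | h
    · exact ⟨d₁.natAbs, 1, Or.inl rfl, by lia⟩
    · exact ⟨d₁.natAbs, -1, Or.inr rfl, by lia⟩
  have hD : d₁.natAbs = D := by rcases hε with rfl | rfl <;> lia
  rw [hD] at h₂
  have hgD : (g * D) % 12 = 5 ∧ ε = 1 ∨ (g * D) % 12 = 7 ∧ ε = -1 := by
    have hcast : ((g * D : ℕ) : ℤ) = g * D := by push_cast; rfl
    rcases hε with rfl | rfl
    · refine Or.inl ⟨?_, rfl⟩
      rw [hd₁, one_mul, ← hcast] at hd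
      have := hd.eq
      lia
    · refine Or.inr ⟨?_, rfl⟩
      rw [hd₁, neg_one_mul, mul_neg, ← hcast] at hd
      have := hd.eq
      lia
  have hodd : Odd (g * D) := Nat.odd_iff.mpr (by lia)
  obtain ⟨hg, hDodd⟩ := Nat.odd_mul.mp hodd
  have h3 : J(3 | g) * J(3 | D) = -1 := by
    have : NeZero g := ⟨hg.pos.ne'⟩
    have : NeZero D := ⟨hDodd.pos.ne'⟩
    rw [← jacobiSym.mul_right]
    exact jacobiSym_three_eq_neg_one (by lia)
  have r1 := jacobiSym.quadratic_reciprocity_if (Nat.odd_iff.mp hg) (Nat.odd_iff.mp ha)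
  have r2 := jacobiSym.quadratic_reciprocity_if (Nat.odd_iff.mp hDodd) (Nat.odd_iff.mp ha)
  have r3 := jacobiSym.quadratic_reciprocity_if (Nat.odd_iff.mp hg) (Nat.odd_iff.mp hDodd)
  have hmod : (g * D) % 4 = (g % 4) * (D % 4) % 4 := Nat.mul_mod _ _ _
  rw [hd₁, ← neg_one_mul] at h₃
  rw [hd₁] at h₁
  simp only [jacobiSym.mul_left] at h₁ h₂ h₃
  have hm1 : J(-1 | g) = if g % 4 = 1 then 1 else -1 := by
    rw [jacobiSym.at_neg_one hg]
    rcases Nat.odd_mod_four_iff.mp (Nat.odd_iff.mp hg) with h | h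
    · rw [if_pos h, ZMod.χ₄_nat_one_mod_four h]
    · rw [if_neg (by lia), ZMod.χ₄_nat_three_mod_four h]
  have hm2 : J(-1 | a₁) = if a₁ % 4 = 1 then 1 else -1 := by
    rw [jacobiSym.at_neg_one ha]
    rcases Nat.odd_mod_four_iff.mp (Nat.odd_iff.mp ha) with h | h
    · rw [if_pos h, ZMod.χ₄_nat_one_mod_four h]
    · rw [if_neg (by lia), ZMod.χ₄_nat_three_mod_four h]
  have tri := fun (x : ℤ) (n : ℕ) => jacobiSym.trichotomy x n
  have t1 := tri g a₁
  have t2 := tri a₁ g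
  have t3 := tri D a₁
  have t4 := tri a₁ D
  have t5 := tri g D
  have t6 := tri D g
  have t7 := tri 3 g
  have t8 := tri 3 D
  generalize J((g : ℤ) | a₁) = x1 at *
  generalize J((a₁ : ℤ) | g) = x2 at *
  generalize J((D : ℤ) | a₁) = x3 at *
  generalize J((a₁ : ℤ) | D) = x4 at *
  generalize J((g : ℤ) | D) = x5 at *
  generalize J((D : ℤ) | g) = x6 at *
  generalize J(3 | g) = x7 at *
  generalize J(3 | D) = x8 at *
  rcases hgD with ⟨hr, rfl⟩ | ⟨hr, rfl⟩ <;>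
  rcases Nat.odd_mod_four_iff.mp (Nat.odd_iff.mp hg) with hg4 | hg4 <;>
  rcases Nat.odd_mod_four_iff.mp (Nat.odd_iff.mp hDodd) with hD4 | hD4 <;>
  rcases Nat.odd_mod_four_iff.mp (Nat.odd_iff.mp ha) with ha4 | ha4 <;>
  simp [hg4, hD4, ha4, jacobiSym.one_left, hm1, hm2] at * <;> subst_vars <;> grind

/-- The global contradiction: the local conditions at all primes are incompatible. -/
lemma square_conditions_false {d : ℤ} {a : ℕ} (hd : d ≡ 5 [ZMOD 12]) (hdsq : Squarefree d)
    (ha : Odd a) (hasq : Squarefree (3 * a))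
    (hC₁ : ∀ (p : ℕ) [Fact p.Prime], p ∣ a → ¬ (p : ℤ) ∣ d → IsSquare (d : ZMod p))
    (hC₂ : ∀ (p : ℕ) [Fact p.Prime], (p : ℤ) ∣ d → ¬ p ∣ a → IsSquare ((3 * a : ℤ) : ZMod p))
    (hC₃ : ∀ (p : ℕ) [Fact p.Prime] (d' a' : ℤ), d = p * d' → (a : ℤ) = p * a' →
      IsSquare ((-(d' * (3 * a')) : ℤ) : ZMod p)) : False := by
  have hdmod := hd.eq
  obtain ⟨a₁, ha₁⟩ := Nat.gcd_dvd_left a d.natAbs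
  obtain ⟨d₁, hd₁⟩ : ((a.gcd d.natAbs : ℕ) : ℤ) ∣ d :=
    Int.natCast_dvd.mpr (Nat.gcd_dvd_right a d.natAbs)
  have hgcd : ∀ p : ℕ, p ∣ a → (p : ℤ) ∣ d → p ∣ a.gcd d.natAbs := fun p h1 h2 =>
    Nat.dvd_gcd h1 (Int.natCast_dvd.mp h2)
  generalize a.gcd d.natAbs = g at *
  have hprime : ∀ (p : ℕ) [Fact p.Prime], Prime (p : ℤ) := fun p _ =>
    Nat.prime_iff_prime_int.mp Fact.out
  have hd3 : ∀ (p : ℕ) [Fact p.Prime], (p : ℤ) ∣ d → ¬ (p : ℤ) ∣ 3 := fun p _ hpd hp3 => by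
    have : p = 3 := (Nat.prime_dvd_prime_iff_eq Fact.out Nat.prime_three).mp (by exact_mod_cast hp3)
    subst this
    push_cast at hpd
    lia
  have hdd : ∀ (p : ℕ) [Fact p.Prime], ¬ (p : ℤ) * p ∣ d := fun p _ h =>
    (hprime p).not_isUnit (hdsq _ h)
  have haa : ∀ (p : ℕ) [Fact p.Prime], ¬ p * p ∣ a := fun p hp h =>
    hp.out.not_isUnit (hasq _ (h.mul_left 3))
  have hA : ∀ (p : ℕ) [Fact p.Prime], p ∣ a₁ → ¬ (p : ℤ) ∣ d := fun p _ h hpd =>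
    haa p (by
      rw [ha₁]
      exact mul_dvd_mul (hgcd p (ha₁ ▸ h.mul_left g) hpd) h)
  have hDg : ∀ (p : ℕ) [Fact p.Prime], (p : ℤ) ∣ d₁ → ¬ p ∣ g := fun p _ h hg =>
    hdd p (by
      rw [hd₁]
      exact mul_dvd_mul (by exact_mod_cast hg) h)
  have haZ : (a : ℤ) = g * a₁ := by exact_mod_cast ha₁
  refine jacobiSym_system_false (g := g) (a₁ := a₁) (d₁ := d₁) ?_ (hd₁ ▸ hd) ?_ ?_ ?_
  · rw [ha₁] at ha
    exact (Nat.odd_mul.mp ha).2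
  · refine jacobiSym_eq_one_of_isSquare fun p _ hp => ?_
    rw [← hd₁]
    exact ⟨hC₁ p (ha₁ ▸ hp.mul_left g) (hA p hp), hA p hp⟩
  · refine jacobiSym_eq_one_of_isSquare fun p _ hp => ?_
    have hp' : (p : ℤ) ∣ d₁ := Int.natCast_dvd.mpr hp
    have hpd : (p : ℤ) ∣ d := hd₁ ▸ hp'.mul_left _
    have hpa : ¬ p ∣ a := fun h => hDg p hp' (hgcd p h hpd)
    rw [← haZ]
    refine ⟨hC₂ p hpd hpa, fun h => ?_⟩
    exact ((hprime p).dvd_or_dvd h).elim (hd3 p hpd) fun h => hpa (by exact_mod_cast h)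
  · refine jacobiSym_eq_one_of_isSquare fun p _ hp => ?_
    obtain ⟨g', rfl⟩ := hp
    have hpd : (p : ℤ) ∣ d := ⟨g' * d₁, by rw [hd₁]; push_cast; ring⟩
    have hg' : ((g' : ℤ) : ZMod p) ≠ 0 := fun h => by
      obtain ⟨c, hc⟩ := (ZMod.intCast_zmod_eq_zero_iff_dvd _ p).mp h
      exact hdd p ⟨c * d₁, by rw [hd₁]; push_cast; rw [hc]; ring⟩
    constructor
    · obtain ⟨s, hs⟩ := hC₃ p (g' * d₁) (g' * a₁) (by rw [hd₁]; push_cast; ring)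
        (by rw [haZ]; push_cast; ring)
      refine ⟨s / (g' : ℤ), ?_⟩
      rw [div_mul_div_comm, eq_div_iff (mul_ne_zero hg' hg'), ← hs]
      push_cast
      ring
    · intro h
      rw [dvd_neg] at h
      rcases (hprime p).dvd_or_dvd h with h | h
      · exact hd3 p hpd h
      rcases (hprime p).dvd_or_dvd h with h | h
      · exact hA p (by exact_mod_cast h) hpd
      · exact hDg p h (dvd_mul_right _ _)

section AdaptedCoordinates

variable {R : Type*} [CommRing R]

/-- The linear change of variables taking a multiple of `l Q₀ + m Q∞` to `twistedForm`. -/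
def adaptedCoordinates (l m t : R) (v : Fin 5 → R) : Fin 5 → R :=
  ![l * v 0 - m * v 1, t * v 1, v 2, v 3, v 4]

lemma adaptedCoordinates_add (l m t b c : R) (y z : Fin 5 → R) :
    adaptedCoordinates l m t (fun i => b * y i + c * z i) =
      fun i => b * adaptedCoordinates l m t y i + c * adaptedCoordinates l m t z i := by
  funext i
  fin_cases i <;> simp [adaptedCoordinates] <;> ring

lemma twistedForm_adaptedCoordinates {d a l m t : R} (h : m ^ 2 + 3 * l ^ 2 = t ^ 2 * a)
    (v : Fin 5 → R) :
    twistedForm d a l m (adaptedCoordinates l m t v) = l * pencil d l m v := by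
  simp only [twistedForm, adaptedCoordinates, pencil, formZero, formInf, Matrix.cons_val]
  linear_combination (d * v 1 ^ 2) * h

lemma adaptedCoordinates_eq_zero [IsDomain R] {l m t : R} (hl : l ≠ 0) (ht : t ≠ 0)
    {v : Fin 5 → R} (h : adaptedCoordinates l m t v = 0) : v = 0 := by
  have h0 : l * v 0 - m * v 1 = 0 := congrFun h 0
  have h1 : t * v 1 = 0 := congrFun h 1
  have h1' : v 1 = 0 := (mul_eq_zero.mp h1).resolve_left ht
  rw [h1', mul_zero, sub_zero] at h0
  have h0' : v 0 = 0 := (mul_eq_zero.mp h0).resolve_left hl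
  funext i
  fin_cases i
  · exact h0'
  · exact h1'
  · exact congrFun h 2
  · exact congrFun h 3
  · exact congrFun h 4

lemma exists_minor_adaptedCoordinates_ne_zero [IsDomain R] {l m t : R} (hl : l ≠ 0) (ht : t ≠ 0)
    {y z : Fin 5 → R} (hyz : ∃ i j, y i * z j - y j * z i ≠ 0) :
    ∃ i j, adaptedCoordinates l m t y i * adaptedCoordinates l m t z j -
      adaptedCoordinates l m t y j * adaptedCoordinates l m t z i ≠ 0 := by
  obtain ⟨i, j, hij⟩ := hyz
  by_contra! h
  have key : ∀ b c : R, adaptedCoordinates l m t (fun k => b * y k + c * z k) = 0 → b = 0 := by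
    intro b c hbc
    have h0 := adaptedCoordinates_eq_zero hl ht hbc
    have hi : b * y i + c * z i = 0 := congrFun h0 i
    have hj : b * y j + c * z j = 0 := congrFun h0 j
    refine (mul_eq_zero.mp (?_ : b * (y i * z j - y j * z i) = 0)).resolve_right hij
    linear_combination z j * hi - z i * hj
  have hz : z = 0 := adaptedCoordinates_eq_zero (m := m) hl ht <| funext fun k => by
    refine key _ (-adaptedCoordinates l m t y k) ?_
    rw [adaptedCoordinates_add]
    funext n
    simp only [Pi.zero_apply]
    linear_combination h n k
  exact hij (by simp [hz])

end AdaptedCoordinates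

/-- The square class of a norm `m² + 3l²` with `3 ∣ m` is `3a` with `a` odd. -/
lemma exists_norm_eq_sq_mul_three {l m : ℤ} (hcop : IsCoprime l m) (hm : 3 ∣ m) :
    ∃ t a : ℕ, m ^ 2 + 3 * l ^ 2 = t ^ 2 * (3 * a) ∧ t ≠ 0 ∧ Odd a ∧ Squarefree (3 * a) := by
  have hl3 : ¬ 3 ∣ l := fun h => Int.prime_three.not_isUnit (hcop.isUnit_of_dvd' h hm)
  have hpos : 0 < m ^ 2 + 3 * l ^ 2 := by
    have : l ≠ 0 := fun h => hl3 (h ▸ dvd_zero _)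
    positivity
  obtain ⟨A, t, htA, hA⟩ := Nat.sq_mul_squarefree (m ^ 2 + 3 * l ^ 2).natAbs
  have h : m ^ 2 + 3 * l ^ 2 = t ^ 2 * A := by
    rw [← abs_of_pos hpos, Int.abs_eq_natAbs, ← htA]; push_cast; rfl
  obtain ⟨m', rfl⟩ := hm
  have ht3 : ¬ (3 : ℤ) ∣ t := by
    rintro ⟨t', ht'⟩
    refine hl3 (Int.prime_three.dvd_of_dvd_pow (n := 2) ⟨t' ^ 2 * A - m' ^ 2, ?_⟩)
    rw [ht'] at h
    linarith
  have hA3 : (3 : ℤ) ∣ A := by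
    refine (Int.prime_three.dvd_or_dvd (?_ : (3 : ℤ) ∣ t ^ 2 * A)).resolve_left
      fun h => ht3 (Int.prime_three.dvd_of_dvd_pow h)
    exact ⟨3 * m' ^ 2 + l ^ 2, by linarith⟩
  obtain ⟨a, rfl⟩ : 3 ∣ A := by exact_mod_cast hA3
  refine ⟨t, a, by rw [h]; push_cast; rfl, ?_, ?_, hA⟩
  · rintro rfl
    exact ht3 (dvd_zero _)
  · rw [← Nat.not_even_iff_odd]
    rintro ⟨c, rfl⟩
    have hc : ¬ 2 ∣ c := by
      rintro ⟨c, rfl⟩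
      exact Nat.prime_two.not_isUnit (hA 2 ⟨3 * c, by ring⟩)
    obtain ⟨e, rfl⟩ : ∃ e, c = 2 * e + 1 := ⟨c / 2, by lia⟩
    have h8 := congrArg (Int.cast : ℤ → ZMod 8) h
    push_cast at h8
    have key : ∀ s : ZMod 8, s = 6 ∨ s = 2 → ∀ x y t : ZMod 8, x ^ 2 + 3 * y ^ 2 = t ^ 2 * s →
        4 * x = 0 ∧ 4 * y = 0 := by
      rintro s (rfl | rfl) <;> decide
    have hs : ∀ e : ZMod 8, 3 * (2 * e + 1 + (2 * e + 1)) = 6 ∨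
        3 * (2 * e + 1 + (2 * e + 1)) = 2 := by decide
    obtain ⟨h1, h2⟩ := key _ (hs e) _ _ _ h8
    have hm2 : (8 : ℤ) ∣ 4 * (3 * m') :=
      (ZMod.intCast_zmod_eq_zero_iff_dvd _ 8).mp (by push_cast; exact h1)
    have hl2 : (8 : ℤ) ∣ 4 * l :=
      (ZMod.intCast_zmod_eq_zero_iff_dvd _ 8).mp (by push_cast; exact h2)
    exact Int.prime_two.not_isUnit (hcop.isUnit_of_dvd' (by lia) (by lia))

/-- For squarefree `d`, no member of the pencil contains a rational line. -/
lemma no_isotropic_plane_in_pencil {d l m : ℤ} (hd : d ≡ 5 [ZMOD 12]) (hdsq : Squarefree d)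
    (hloc : ∀ (p : ℕ) [Fact p.Prime], (p : ℤ) ∣ d →
      ∀ (L : Type) [Field L] [Algebra ℚ_[p] L] [FiniteDimensional ℚ_[p] L],
        ∀ θ : L, θ ^ 3 + 3 * θ ^ 2 + 3 * θ - 9 = 0 → Algebra.adjoin ℚ_[p] {θ} = ⊤ →
          ∃ s : L, s ^ 2 = θ)
    (hcop : IsCoprime l m) {y z : Fin 5 → ℤ} (hyz : ∃ i j, y i * z j - y j * z i ≠ 0)
    (hiso : ∀ a b : ℤ, pencil d l m (fun i => a * y i + b * z i) = 0) : False := by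
  have hm : 3 ∣ m := by
    obtain ⟨i, j, hij⟩ := hyz
    obtain ⟨y', z', hiso', hind⟩ := exists_isotropic_independent_mod 3 (pencil d l m)
      (fun c v => by simp only [pencil, formZero, formInf]; ring) i j _ y z rfl hij hiso
    refine three_dvd_of_isotropic_plane ?_ hiso' (by exact_mod_cast hind)
    have := hd.of_dvd (show (3 : ℤ) ∣ 12 by norm_num)
    exact this.trans (by decide)
  have hl : l ≠ 0 := by
    rintro rfl
    exact Int.prime_three.not_isUnit (hcop.isUnit_of_dvd' (dvd_zero 3) hm)
  obtain ⟨t, a, hnorm, ht, hodd, hasq⟩ := exists_norm_eq_sq_mul_three hcop hm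
  have htZ : (t : ℤ) ≠ 0 := by exact_mod_cast ht
  have hYZ := exists_minor_adaptedCoordinates_ne_zero (m := m) hl htZ hyz
  have hisoYZ : ∀ b c : ℤ, twistedForm d (3 * a) l m (fun i =>
      b * adaptedCoordinates l m t y i + c * adaptedCoordinates l m t z i) = 0 := fun b c => by
    rw [← adaptedCoordinates_add, twistedForm_adaptedCoordinates hnorm, hiso, mul_zero]
  generalize adaptedCoordinates l m t y = Y at hYZ hisoYZ
  generalize adaptedCoordinates l m t z = Z at hYZ hisoYZ
  have hprime : ∀ (p : ℕ) [Fact p.Prime], Prime (p : ℤ) := fun p _ =>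
    Nat.prime_iff_prime_int.mp Fact.out
  have hsqa : ∀ (p : ℕ) [Fact p.Prime], ¬ (p : ℤ) * p ∣ 3 * a := fun p hp h =>
    hp.out.not_isUnit (hasq p (by exact_mod_cast h))
  have hsqd : ∀ (p : ℕ) [Fact p.Prime], ¬ (p : ℤ) * p ∣ d := fun p _ h =>
    (hprime p).not_isUnit (hdsq _ h)
  have hd3 : ∀ (p : ℕ) [Fact p.Prime], (p : ℤ) ∣ d → ¬ (p : ℤ) ∣ 3 := fun p _ hpd hp3 => by
    have : p = 3 := (Nat.prime_dvd_prime_iff_eq Fact.out Nat.prime_three).mp (by exact_mod_cast hp3)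
    subst this
    have := hd.eq
    push_cast at hpd
    lia
  refine square_conditions_false hd hdsq hodd hasq (fun p _ hpa hpd => ?_) (fun p _ hpd hpa => ?_)
    (fun p _ d' a' hd' ha' => ?_)
  · have hpa' : (p : ℤ) ∣ 3 * a := dvd_mul_of_dvd_right (by exact_mod_cast hpa) _
    have hpl : ¬ (p : ℤ) ∣ l := fun h => by
      refine (hprime p).not_isUnit (hcop.isUnit_of_dvd' h
        ((hprime p).dvd_of_dvd_pow (n := 2) ?_))
      rw [eq_sub_of_add_eq hnorm]
      exact dvd_sub (hpa'.mul_left _) ((h.pow two_ne_zero).mul_left _)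
    obtain ⟨i, j, hij⟩ := hYZ
    obtain ⟨Y', Z', hiso', hind⟩ := exists_isotropic_independent_mod p (twistedForm d (3 * a) l m)
      (fun c v => by simp only [twistedForm]; ring) i j _ Y Z rfl hij hisoYZ
    refine isSquare_of_isotropic_plane_s4 ?_ ?_ hpd hpa' (hsqa p) hpl hnorm hiso' hind
    · rintro rfl
      exact Nat.not_even_iff_odd.mpr hodd (even_iff_two_dvd.mpr hpa)
    · rintro rfl
      exact hsqa 3 (mul_dvd_mul_left 3 (by exact_mod_cast hpa))
  · refine isSquare_of_primitive_norm_eq hpd (hsqd p) (fun h => ?_)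
      (exists_primitive_norm_eq hl htZ hnorm (hloc p hpd) hYZ hisoYZ)
    exact ((hprime p).dvd_or_dvd h).elim (hd3 p hpd) fun h => hpa (by exact_mod_cast h)
  · have hpd : (p : ℤ) ∣ d := ⟨d', hd'⟩
    have h3a : (3 * a : ℤ) = p * (3 * a') := by rw [ha']; ring
    rw [h3a] at hnorm hisoYZ
    refine isSquare_neg_mul_of_primitive_norm_eq (p := p) (d := d') (a := 3 * a') (fun h => ?_)
      (fun h => ?_) ?_
    · exact hsqd p (hd' ▸ mul_dvd_mul_left _ h)
    · exact hsqa p (h3a ▸ mul_dvd_mul_left _ h)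
    · rw [← hd']
      exact exists_primitive_norm_eq hl htZ hnorm (hloc p hpd) hYZ hisoYZ

/-- Reduction to a squarefree parameter. -/
lemma exists_squarefree_modEq_five {d : ℤ} (hd : d ≡ 5 [ZMOD 12]) :
    ∃ b d' : ℤ, b ≠ 0 ∧ d = b ^ 2 * d' ∧ Squarefree d' ∧ d' ≡ 5 [ZMOD 12] := by
  obtain ⟨a, b, hab, ha⟩ := Nat.sq_mul_squarefree d.natAbs
  obtain ⟨d', hd', hda⟩ : ∃ d' : ℤ, d = b ^ 2 * d' ∧ Squarefree d' := by
    rcases Int.natAbs_eq d with h | h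
    · exact ⟨a, by rw [h, ← hab]; push_cast; ring, Int.squarefree_natCast.mpr ha⟩
    · refine ⟨-a, by rw [h, ← hab]; push_cast; ring, ?_⟩
      rwa [← Int.squarefree_natAbs, Int.natAbs_neg, Int.natAbs_natCast]
  refine ⟨b, d', ?_, hd', hda, ?_⟩
  · intro hb
    rw [hb] at hd'
    have := hd.eq
    lia
  · have key : ∀ b d : ZMod 12, b ^ 2 * d = 5 → d = 5 := by decide
    have h := (ZMod.intCast_eq_intCast_iff d 5 12).mpr hd
    rw [hd'] at h
    refine (ZMod.intCast_eq_intCast_iff d' 5 12).mp ?_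
    push_cast at h ⊢
    exact key b d' h

/-- If `d ≡ 5 (mod 12)` and, for every prime `p ∣ d`, every root `θ` of
`T³ + 3T² + 3T - 9` lying in a finite extension `L/ℚ_p` that it generates is a square in `L`,
then the quartic del Pezzo surface `X_d = V(Q₀) ∩ V(Q∞)` has no closed points of degree
dividing `2`: for every field `K` with a `ℚ`-algebra structure of dimension at most `2`,
the forms `Q₀` and `Q∞` have no nonzero common zero in `K⁵`. -/
theorem stmt4 (d : ℤ) (hd : d ≡ 5 [ZMOD 12])
    (hloc : ∀ (p : ℕ) [Fact p.Prime], (p : ℤ) ∣ d →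
      ∀ (L : Type) [Field L] [Algebra ℚ_[p] L] [FiniteDimensional ℚ_[p] L],
        ∀ θ : L, θ ^ 3 + 3 * θ ^ 2 + 3 * θ - 9 = 0 → Algebra.adjoin ℚ_[p] {θ} = ⊤ →
          ∃ s : L, s ^ 2 = θ) :
    ∀ (K : Type) [Field K] [Algebra ℚ K] [FiniteDimensional ℚ K],
      Module.finrank ℚ K ≤ 2 →
        ∀ x : Fin 5 → K, Q0 d x = 0 → Qinf d x = 0 → x = 0 := by
  intro K _ _ _ hK x h₀ h₁
  by_contra hx
  obtain ⟨b, d', hb, rfl, hdsq, hd'⟩ := exists_squarefree_modEq_five hd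
  have hbK : (b : K) ≠ 0 := by
    have := algebraRat.charZero K
    exact_mod_cast hb
  obtain ⟨l, m, hcop, y, z, hyz, hiso⟩ := exists_integral_line_of_quadratic_point d' hK
    ![b * x 0, b * x 1, x 2, x 3, x 4] (fun h => hx (funext fun i => by
      have e0 : b * x 0 = 0 := congrFun h 0
      have e1 : b * x 1 = 0 := congrFun h 1
      fin_cases i
      · exact (mul_eq_zero.mp e0).resolve_left hbK
      · exact (mul_eq_zero.mp e1).resolve_left hbK
      · exact congrFun h 2
      · exact congrFun h 3
      · exact congrFun h 4))
    (by
      simp only [Q0, Matrix.cons_val] at h₀ ⊢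
      push_cast at h₀
      linear_combination h₀)
    (by
      simp only [Qinf, Matrix.cons_val] at h₁ ⊢
      push_cast at h₁
      linear_combination h₁)
  exact no_isotropic_plane_in_pencil hd' hdsq (fun p _ hp => hloc p (hp.mul_left _)) hcop hyz hiso
end

section
/- Let d and d' be nonzero integers such that neither d·d' nor -3·d·d' is the square of a rational number (equivalently, d·d' is not a square in ℚ(√-3)). Then there is no ℚ-linear automorphism g of ℚ^5 such that the 2-dimensional subspace of quadratic forms spanned by Q_0^{(d)}∘g and Q_∞^{(d)}∘g equals the subspace spanned by Q_0^{(d')} and Q_∞^{(d')}. (Consequently no linear change of coordinates of P^4 maps X_{d'} to X_d, and since X_d and X_{d'} are anticanonically embedded, the surfaces X_d and X_{d'} are not isomorphic.) -/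
open Matrix

/-- The symmetric Gram matrix of `x • Q₀⁽ᵈ⁾ + y • Q∞⁽ᵈ⁾`. -/
def pencilMatrix {R : Type*} [CommRing R] (d x y : R) : Matrix (Fin 5) (Fin 5) R :=
  !![d * x, -d * y, 0, 0, 0;
     -d * y, -3 * d * x, 0, 0, 0;
     0, 0, 6 * x + y, 3 * x, -y;
     0, 0, 3 * x, -3 * y, -3 * x;
     0, 0, -y, -3 * x, -y]

theorem pencilMatrix_isSymm {R : Type*} [CommRing R] (d x y : R) :
    (pencilMatrix d x y).IsSymm := by
  ext i j
  fin_cases i <;> fin_cases j <;> simp [pencilMatrix]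

theorem pencilMatrix_eq_add {R : Type*} [CommRing R] (d x y : R) :
    pencilMatrix d x y = x • pencilMatrix d 1 0 + y • pencilMatrix d 0 1 := by
  ext i j
  fin_cases i <;> fin_cases j <;> simp [pencilMatrix] <;> ring

theorem pencilMatrix_map {R S : Type*} [CommRing R] [CommRing S] (f : R →+* S) (d x y : R) :
    (pencilMatrix d x y).map f = pencilMatrix (f d) (f x) (f y) := by
  have h3 : f 3 = 3 := map_ofNat f 3
  have h6 : f 6 = 6 := map_ofNat f 6
  ext i j
  fin_cases i <;> fin_cases j <;> simp [pencilMatrix, h3, h6]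

theorem dotProduct_pencilMatrix {F : Type*} [Field F] (d : ℤ) (x y : F) (u : Fin 5 → F) :
    u ⬝ᵥ pencilMatrix (d : F) x y *ᵥ u = x * Q0 d u + y * Qinf d u := by
  simp [pencilMatrix, Q0, Qinf, dotProduct, mulVec, Fin.sum_univ_succ]
  ring

theorem det_pencilMatrix {R : Type*} [CommRing R] (d x y : R) :
    (pencilMatrix d x y).det =
      -6 * d ^ 2 * ((3 * x ^ 2 + y ^ 2) * ((x + y) ^ 3 - 10 * x ^ 3)) := by
  simp [pencilMatrix, det_succ_row_zero, Fin.sum_univ_succ, Fin.succAbove]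
  ring

theorem adjugate_pencilMatrix {F : Type*} [Field F] [CharZero F] {d s : F} (hd : d ≠ 0)
    (hs : s ^ 2 = -3) :
    (pencilMatrix d 1 s).adjugate = (-108 * d) • vecMulVec ![s, 1, 0, 0, 0] ![s, 1, 0, 0, 0] := by
  have h11 : (pencilMatrix d 1 s).adjugate 1 1 = -108 * d := by
    rw [adjugate_fin_succ_eq_det_submatrix]
    simp [pencilMatrix, det_succ_row_zero, Fin.sum_univ_succ, Fin.succAbove]
    linear_combination d * (18 + 6 * s) * hs
  have hsymm : ∀ i j, (pencilMatrix d 1 s).adjugate i j = (pencilMatrix d 1 s).adjugate j i := by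
    intro i j
    conv_lhs => rw [← (pencilMatrix_isSymm d 1 s).eq, ← adjugate_transpose, transpose_apply]
  have hmul : pencilMatrix d 1 s * (pencilMatrix d 1 s).adjugate = 0 := by
    rw [mul_adjugate, det_pencilMatrix, hs]
    simp
  generalize (pencilMatrix d 1 s).adjugate = A at *
  have hcol : ∀ j, A 0 j = s * A 1 j ∧ A 2 j = 0 ∧ A 3 j = 0 ∧ A 4 j = 0 := by
    intro j
    have h0 := congrFun (congrFun hmul 0) j
    have h2 := congrFun (congrFun hmul 2) j
    have h3 := congrFun (congrFun hmul 3) j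
    have h4 := congrFun (congrFun hmul 4) j
    simp [pencilMatrix, mul_apply, Fin.sum_univ_succ] at h0 h2 h3 h4
    have e4 : A 4 j = 0 := by
      refine (mul_eq_zero_iff_left (by norm_num : (6 : F) ≠ 0)).1 ?_
      linear_combination -h3 + s * h4 + (A 2 j + A 4 j) * hs
    refine ⟨mul_left_cancel₀ hd (by linear_combination h0), ?_, ?_, e4⟩
    · rw [e4] at h2 h4
      linear_combination (h2 + h4) / 6
    · rw [e4] at h2 h4
      linear_combination - h4 / 3 - s * (h2 + h4) / 18
  have hrow : ∀ i, A i 0 = s * A i 1 ∧ A i 2 = 0 ∧ A i 3 = 0 ∧ A i 4 = 0 := by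
    intro i
    simpa only [hsymm i] using hcol i
  ext i j
  fin_cases i <;> fin_cases j <;> simp [hcol, hrow, h11] <;> ring

theorem Matrix.IsSymm.eq_of_dotProduct_mulVec {n F : Type*} [Fintype n] [DecidableEq n] [Field F]
    [CharZero F] {A B : Matrix n n F} (hA : A.IsSymm) (hB : B.IsSymm)
    (h : ∀ u, u ⬝ᵥ A *ᵥ u = u ⬝ᵥ B *ᵥ u) : A = B := by
  ext i j
  have hij := h (Pi.single i 1 + Pi.single j 1)
  have hi := h (Pi.single i 1)
  have hj := h (Pi.single j 1)
  have hA' := hA.apply i j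
  have hB' := hB.apply i j
  simp [mulVec_add, add_dotProduct, dotProduct_add] at hij hi hj
  linear_combination hij / 2 - hi / 2 - hj / 2 - hA' / 2 + hB' / 2

theorem rat_pow_three_ne_hundred (r : ℚ) : r ^ 3 ≠ 100 := by
  intro h
  obtain ⟨n, rfl⟩ : ∃ n : ℤ, (n : ℚ) = r :=
    IsIntegrallyClosed.exists_algebraMap_eq_of_isIntegral_pow (R := ℤ) (n := 3) (by norm_num)
      (h ▸ isIntegral_algebraMap (x := (100 : ℤ)))
  have h' : n ^ 3 = 100 := by exact_mod_cast h
  have h1 : n < 5 := lt_of_pow_lt_pow_left₀ 3 (by norm_num) (by omega)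
  have h0 : 0 ≤ n := (Odd.pow_nonneg_iff (n := 3) (by decide)).1 (by omega)
  have h2 : 4 < n := lt_of_pow_lt_pow_left₀ 3 h0 (by omega)
  omega

/-- `10` is not a cube in `ℚ(√-3)`. -/
theorem eq_zero_of_cube_eq_ten_mul_cube {s : ℂ} (hs : s ^ 2 = -3) (hre : s.re = 0)
    {a c p q : ℚ} (h : ((p : ℂ) + q * s) ^ 3 = 10 * (a + c * s) ^ 3) : a = 0 ∧ c = 0 := by
  have him : s.im ^ 2 = 3 := by
    have := congrArg Complex.re hs
    simp [pow_two, hre] at this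
    linarith
  have key : ∀ x y : ℚ, Complex.normSq ((x : ℂ) + y * s) = ((x ^ 2 + 3 * y ^ 2 : ℚ) : ℝ) := by
    intro x y
    simp [Complex.normSq_apply, hre]
    linear_combination (y : ℝ) ^ 2 * him
  have hN := congrArg Complex.normSq h
  rw [map_pow, map_mul, map_pow, key, key,
    show Complex.normSq 10 = 100 by norm_num [Complex.normSq_apply]] at hN
  have hN' : (p ^ 2 + 3 * q ^ 2) ^ 3 = 100 * (a ^ 2 + 3 * c ^ 2) ^ 3 := by exact_mod_cast hN
  have h0 : a ^ 2 + 3 * c ^ 2 = 0 := by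
    by_contra hne
    refine rat_pow_three_ne_hundred ((p ^ 2 + 3 * q ^ 2) / (a ^ 2 + 3 * c ^ 2)) ?_
    rw [div_pow, hN']
    field_simp
  constructor <;> nlinarith [sq_nonneg a, sq_nonneg c]

/-- `1` and `√-3` are linearly independent over `ℚ`. -/
theorem rat_add_mul_eq_zero_iff {s : ℂ} (hs : s ^ 2 = -3) (hre : s.re = 0) {p q : ℚ} :
    (p : ℂ) + q * s = 0 ↔ p = 0 ∧ q = 0 := by
  have him : s.im ≠ 0 := by
    intro h0
    have := congrArg Complex.re hs
    simp [pow_two, hre, h0] at this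
  simp [Complex.ext_iff, hre, him]

/-- The only substitutions preserving the binary quintic
`(3x² + y²)((x + y)³ - 10x³)` up to a factor are the scalar ones. -/
theorem scalar_of_preserves_quintic {a b c e γ : ℚ} (hγ : γ ≠ 0)
    {s : ℂ} (hs : s ^ 2 = -3) (hre : s.re = 0)
    (h : ∀ x y : ℚ, γ * ((3 * x ^ 2 + y ^ 2) * ((x + y) ^ 3 - 10 * x ^ 3)) =
      (3 * (x * a + y * c) ^ 2 + (x * b + y * e) ^ 2) *
        (((x * a + y * c) + (x * b + y * e)) ^ 3 - 10 * (x * a + y * c) ^ 3))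
    (hC : (3 * ((a : ℂ) + c * s) ^ 2 + (b + e * s) ^ 2) *
        (((a + c * s) + (b + e * s)) ^ 3 - 10 * (a + c * s) ^ 3) = 0) :
    a ≠ 0 ∧ b = 0 ∧ c = 0 ∧ e = a := by
  have h10 := h 1 0
  have h01 := h 0 1
  have h11 := h 1 1
  have h1m := h 1 (-1)
  have hsign : b = -3 * c ∧ e = a ∨ b = 3 * c ∧ e = -a := by
    rcases mul_eq_zero.1 hC with hQ | hT
    · have hfac : ((b : ℂ) + e * s - s * (a + c * s)) * (b + e * s + s * (a + c * s)) = 0 := by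
        linear_combination hQ - ((a : ℂ) + c * s) ^ 2 * hs
      rcases mul_eq_zero.1 hfac with h' | h'
      · left
        have := (rat_add_mul_eq_zero_iff hs hre (p := b + 3 * c) (q := e - a)).1 (by
          push_cast; linear_combination h' + c * hs)
        constructor <;> linarith [this.1, this.2]
      · right
        have := (rat_add_mul_eq_zero_iff hs hre (p := b - 3 * c) (q := e + a)).1 (by
          push_cast; linear_combination h' - c * hs)
        constructor <;> linarith [this.1, this.2]
    · obtain ⟨rfl, rfl⟩ := eq_zero_of_cube_eq_ten_mul_cube hs hre (p := a + b) (q := c + e)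
        (a := a) (c := c) (by push_cast; linear_combination hT)
      have h3 : ((0 + b : ℚ) + (0 + e : ℚ) * s : ℂ) = 0 := by
        have : (((0 + b : ℚ) : ℂ) + (0 + e : ℚ) * s) ^ 3 = 0 := by
          push_cast; linear_combination hT
        exact pow_eq_zero_iff (by norm_num) |>.1 this
      have := (rat_add_mul_eq_zero_iff hs hre).1 h3
      simp_all
  have hN : a ^ 2 + 3 * c ^ 2 ≠ 0 := by
    intro h0
    have ha : a = 0 := by nlinarith [sq_nonneg a, sq_nonneg c]
    have hc : c = 0 := by nlinarith [sq_nonneg a, sq_nonneg c]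
    rcases hsign with ⟨rfl, rfl⟩ | ⟨rfl, rfl⟩ <;> simp [ha, hc] at h01 <;> exact hγ h01
  obtain ⟨γ', rfl⟩ : ∃ γ', γ = (a ^ 2 + 3 * c ^ 2) * γ' := ⟨γ / (a ^ 2 + 3 * c ^ 2), by field_simp⟩
  rcases hsign with ⟨rfl, he⟩ | ⟨rfl, rfl⟩
  · subst e
    have e10 : -9 * γ' = (a - 3 * c) ^ 3 - 10 * a ^ 3 :=
      mul_left_cancel₀ hN (by linear_combination h10 / 3)
    have e01 : γ' = (a + c) ^ 3 - 10 * c ^ 3 :=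
      mul_left_cancel₀ hN (by linear_combination h01)
    have e11 : -2 * γ' = (2 * a - 2 * c) ^ 3 - 10 * (a + c) ^ 3 :=
      mul_left_cancel₀ hN (by linear_combination h11 / 4)
    have e1m : -10 * γ' = (-4 * c) ^ 3 - 10 * (a - c) ^ 3 :=
      mul_left_cancel₀ hN (by linear_combination h1m / 4)
    have hc : c = 0 := by
      by_contra hc
      have i1 : 2 * a ^ 2 + 9 * a * c - 3 * c ^ 2 = 0 :=
        mul_left_cancel₀ hc (by linarith)
      have i2 : a ^ 2 - c ^ 2 = 0 := mul_left_cancel₀ hc (by linarith)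
      have i3 : a = c ∨ a = -c := sq_eq_sq_iff_eq_or_eq_neg.1 (by linarith)
      rcases i3 with rfl | rfl <;> exact hc (pow_eq_zero_iff two_ne_zero |>.1 (by linarith))
    subst hc
    refine ⟨?_, by ring, rfl, rfl⟩
    rintro rfl
    simp at hN
  · exfalso
    have e10 : -9 * γ' = (a + 3 * c) ^ 3 - 10 * a ^ 3 :=
      mul_left_cancel₀ hN (by linear_combination h10 / 3)
    have e01 : γ' = (c - a) ^ 3 - 10 * c ^ 3 :=
      mul_left_cancel₀ hN (by linear_combination h01)
    have e11 : -2 * γ' = (4 * c) ^ 3 - 10 * (a + c) ^ 3 :=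
      mul_left_cancel₀ hN (by linear_combination h11 / 4)
    have e1m : -10 * γ' = (2 * a + 2 * c) ^ 3 - 10 * (a - c) ^ 3 :=
      mul_left_cancel₀ hN (by linear_combination h1m / 4)
    have i1 : (a - c) * (a ^ 2 - 6 * c ^ 2) = 0 := by linarith
    have i2 : c * (a - c) * (a + c) = 0 := by linarith
    have hc : c = 0 := by
      by_contra hc
      rcases mul_eq_zero.1 i2 with h' | h'
      · have hac : a = c := by simpa [hc, sub_eq_zero] using h'
        subst hac
        refine hc (pow_eq_zero_iff three_ne_zero |>.1 ?_)
        linarith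
      · have hac : a = -c := by linarith
        subst hac
        refine hc (pow_eq_zero_iff three_ne_zero |>.1 ?_)
        linarith
    subst hc
    refine hN ?_
    have : a = 0 := pow_eq_zero_iff three_ne_zero |>.1 (by linarith)
    simp [this]

theorem exists_sq_of_pencil_scalar {d d' a : ℚ} (hd : d ≠ 0) (hd' : d' ≠ 0) (ha : a ≠ 0)
    {s : ℂ} (hs : s ^ 2 = -3) (hre : s.re = 0) {G : Matrix (Fin 5) (Fin 5) ℚ}
    (h : (G.map (Rat.castHom ℂ))ᵀ * pencilMatrix (d : ℂ) 1 s * G.map (Rat.castHom ℂ) =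
      (a : ℂ) • pencilMatrix (d' : ℂ) 1 s) :
    (∃ r : ℚ, r ^ 2 = d * d') ∨ ∃ r : ℚ, r ^ 2 = -3 * (d * d') := by
  have hadj := congrArg (fun A => adjugate A 1 1) h
  have hG : (G.map (Rat.castHom ℂ)).adjugate = G.adjugate.map (Rat.castHom ℂ) :=
    ((Rat.castHom ℂ).map_adjugate G).symm
  simp only [adjugate_mul_distrib, adjugate_smul, hG] at hadj
  rw [← adjugate_transpose, hG, adjugate_pencilMatrix (Rat.cast_ne_zero.2 hd) hs,
    adjugate_pencilMatrix (Rat.cast_ne_zero.2 hd') hs] at hadj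
  set p := G.adjugate 1 1
  set q := G.adjugate 1 0
  have key : (d : ℂ) * (p + q * s) ^ 2 = a ^ 4 * d' := by
    simp [mul_apply, Fin.sum_univ_succ] at hadj
    linear_combination - hadj / 108
  have hpq := (rat_add_mul_eq_zero_iff hs hre (p := d * (p ^ 2 - 3 * q ^ 2) - a ^ 4 * d')
    (q := d * (2 * p * q))).1 (by push_cast; linear_combination key - d * q ^ 2 * hs)
  obtain ⟨h1, h2⟩ := hpq
  have : p = 0 ∨ q = 0 := by simpa [hd] using h2
  rcases this with h0 | h0 <;> rw [h0] at h1
  · right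
    refine ⟨3 * d * q / a ^ 2, ?_⟩
    field_simp
    linear_combination -h1
  · left
    refine ⟨d * p / a ^ 2, ?_⟩
    field_simp
    linear_combination h1

/-- If `d·d'` is not a square in `ℚ(√-3)` (i.e. neither `d·d'` nor `-3·d·d'` is a rational
square), then no `ℚ`-linear automorphism `g` of `ℚ⁵` carries the pencil of quadratic forms
spanned by `Q₀⁽ᵈ⁾∘g, Q∞⁽ᵈ⁾∘g` onto the pencil spanned by `Q₀⁽ᵈ'⁾, Q∞⁽ᵈ'⁾`; consequently the
quartic del Pezzo surfaces `X_d` and `X_{d'}` are not isomorphic. -/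
theorem stmt5 (d d' : ℤ) (hd : d ≠ 0) (hd' : d' ≠ 0)
    (h1 : ¬ ∃ r : ℚ, r ^ 2 = ((d * d' : ℤ) : ℚ))
    (h2 : ¬ ∃ r : ℚ, r ^ 2 = -3 * ((d * d' : ℤ) : ℚ)) :
    ¬ ∃ g : (Fin 5 → ℚ) ≃ₗ[ℚ] (Fin 5 → ℚ),
        Submodule.span ℚ
            {(fun x => Q0 d (g x) : (Fin 5 → ℚ) → ℚ), (fun x => Qinf d (g x))} =
          Submodule.span ℚ
            {(fun x => Q0 d' x : (Fin 5 → ℚ) → ℚ), (fun x => Qinf d' x)} := by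
  rintro ⟨g, hg⟩
  have mem0 : (fun x => Q0 d (g x) : (Fin 5 → ℚ) → ℚ) ∈ Submodule.span ℚ
      {(fun x => Q0 d' x : (Fin 5 → ℚ) → ℚ), (fun x => Qinf d' x)} :=
    hg ▸ Submodule.subset_span (by simp)
  have memInf : (fun x => Qinf d (g x) : (Fin 5 → ℚ) → ℚ) ∈ Submodule.span ℚ
      {(fun x => Q0 d' x : (Fin 5 → ℚ) → ℚ), (fun x => Qinf d' x)} :=
    hg ▸ Submodule.subset_span (by simp)
  obtain ⟨a, b, hab⟩ := Submodule.mem_span_pair.1 mem0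
  obtain ⟨c, e, hce⟩ := Submodule.mem_span_pair.1 memInf
  let G : Matrix (Fin 5) (Fin 5) ℚ := LinearMap.toMatrix' g.toLinearMap
  have hGmul : ∀ u, G *ᵥ u = g u := fun u => LinearMap.toMatrix'_mulVec _ u
  have hdet : G.det ≠ 0 := by
    rw [LinearMap.det_toMatrix']
    exact g.isUnit_det'.ne_zero
  have hpencil : ∀ x y : ℚ, Gᵀ * pencilMatrix (d : ℚ) x y * G =
      pencilMatrix (d' : ℚ) (x * a + y * c) (x * b + y * e) := by
    intro x y
    refine Matrix.IsSymm.eq_of_dotProduct_mulVec ?_ (pencilMatrix_isSymm _ _ _) fun u => ?_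
    · simp [IsSymm, transpose_mul, Matrix.mul_assoc, (pencilMatrix_isSymm _ _ _).eq]
    · rw [← mulVec_mulVec, ← mulVec_mulVec, dotProduct_mulVec, vecMul_transpose, hGmul,
        dotProduct_pencilMatrix, dotProduct_pencilMatrix]
      have e0 := congrFun hab u
      have e1 := congrFun hce u
      simp at e0 e1
      linear_combination -x * e0 - y * e1
  obtain ⟨s, hs, hre⟩ : ∃ s : ℂ, s ^ 2 = -3 ∧ s.re = 0 := by
    refine ⟨Complex.I * (√3 : ℝ), ?_, by simp⟩
    rw [mul_pow, Complex.I_sq, ← Complex.ofReal_pow, Real.sq_sqrt (by norm_num)]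
    norm_num
  have hpencilC : (G.map (Rat.castHom ℂ))ᵀ * pencilMatrix (((d : ℚ)) : ℂ) 1 s *
      G.map (Rat.castHom ℂ) = pencilMatrix ((d' : ℚ) : ℂ) (a + c * s) (b + e * s) := by
    have hmap : ∀ x y : ℚ, (G.map (Rat.castHom ℂ))ᵀ * pencilMatrix ((d : ℚ) : ℂ) x y *
        G.map (Rat.castHom ℂ) =
          pencilMatrix ((d' : ℚ) : ℂ) ((x * a + y * c : ℚ) : ℂ) ((x * b + y * e : ℚ) : ℂ) := by
      intro x y
      have := congrArg (fun A => A.map (Rat.castHom ℂ)) (hpencil x y)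
      rw [pencilMatrix_map] at this
      rw [Matrix.map_mul, Matrix.map_mul, pencilMatrix_map] at this
      exact this
    have m0 := hmap 1 0
    have m1 := hmap 0 1
    simp only [Rat.cast_one, Rat.cast_zero, one_mul, zero_mul, add_zero, zero_add] at m0 m1
    rw [pencilMatrix_eq_add, Matrix.mul_add, Matrix.add_mul, Matrix.mul_smul, Matrix.mul_smul,
      Matrix.smul_mul, Matrix.smul_mul, m0, m1, pencilMatrix_eq_add _ (a : ℂ),
      pencilMatrix_eq_add _ (c : ℂ), pencilMatrix_eq_add _ ((a : ℂ) + c * s)]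
    module
  have hdQ : (d : ℚ) ≠ 0 := by exact_mod_cast hd
  have hdQ' : (d' : ℚ) ≠ 0 := by exact_mod_cast hd'
  obtain ⟨ha, rfl, rfl, rfl⟩ := scalar_of_preserves_quintic
    (γ := G.det ^ 2 * d ^ 2 / d' ^ 2) (by positivity) hs hre (a := a) (b := b) (c := c) (e := e)
    (fun x y => by
      have := congrArg det (hpencil x y)
      rw [det_mul, det_mul, det_transpose, det_pencilMatrix, det_pencilMatrix] at this
      field_simp
      linear_combination - this / 6)
    (by
      have := congrArg det hpencilC
      rw [det_mul, det_mul, det_pencilMatrix, det_pencilMatrix, hs] at this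
      have hdC' : ((d' : ℚ) : ℂ) ≠ 0 := by exact_mod_cast hdQ'
      refine mul_left_cancel₀ (mul_ne_zero (by norm_num) (pow_ne_zero 2 hdC') :
        (-6 : ℂ) * ((d' : ℚ) : ℂ) ^ 2 ≠ 0) ?_
      rw [← this]
      ring)
  rcases exists_sq_of_pencil_scalar hdQ hdQ' ha hs hre (G := G) (by
    rw [hpencilC, pencilMatrix_eq_add, pencilMatrix_eq_add _ 1 s]
    simp [smul_smul]) with h | h
  · exact h1 (by simpa using h)
  · exact h2 (by simpa using h)
end

section
/- Let ζ be a root of the polynomial T^3 + 3T^2 + 3T - 9, which is irreducible over ℚ, and let K = ℚ(ζ), a cubic number field. With d = -7, i.e., Q_0 = -7(u_0^2 - 3u_1^2) + 6u_2^2 + 6u_2u_3 - 6u_3u_4 and Q_∞ = 14u_0u_1 + u_2^2 - 2u_2u_4 - 3u_3^2 - u_4^2, there exists a 2-dimensional K-linear subspace of K^5 on which the quadratic form 7·Q_0 + (5ζ+3)·Q_∞ vanishes identically. (That is, the quadric V(7Q_0 + (5ζ+3)Q_∞) ⊂ P^4_K contains a K-rational line, so the surface X_{-7} lies on a quadric with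 a line over the cubic field K.) -/
/-- No rational number has cube `10`. -/
lemma rat_pow_three_ne_ten (r : ℚ) : r ^ 3 ≠ 10 := by
  intro hr
  have hint : IsIntegral ℤ r := by
    refine ⟨Polynomial.X ^ 3 - Polynomial.C 10,
      Polynomial.monic_X_pow_sub_C _ (by norm_num), ?_⟩
    simp [hr]
  obtain ⟨n, rfl⟩ := IsIntegrallyClosed.isIntegral_iff.mp hint
  have hn : n ^ 3 = 10 := by
    have : (n : ℚ) ^ 3 = 10 := by simpa using hr
    exact_mod_cast this
  have h0 : 0 < n := by
    by_contra! h
    nlinarith [Odd.pow_nonpos (by decide : Odd 3) h]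
  have h3 : n < 3 := by
    by_contra! h
    nlinarith [pow_le_pow_left₀ (by norm_num) h 3]
  interval_cases n <;> norm_num at hn

/-- The cubic is `(X + 1) ^ 3 - 10`, so it has no rational root. -/
lemma irreducible_cubic :
    Irreducible (Polynomial.X ^ 3 + 3 * Polynomial.X ^ 2 + 3 * Polynomial.X - 9 :
      Polynomial ℚ) := by
  have hdeg : (Polynomial.X ^ 3 + 3 * Polynomial.X ^ 2 + 3 * Polynomial.X - 9 :
      Polynomial ℚ).natDegree = 3 := by
    compute_degree!
  refine Polynomial.irreducible_of_degree_le_three_of_not_isRoot (by simp [hdeg]) ?_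
  intro r hr
  have hr' : r ^ 3 + 3 * r ^ 2 + 3 * r - 9 = 0 := by
    simpa [Polynomial.IsRoot] using hr
  exact rat_pow_three_ne_ten (r + 1) (by linear_combination hr')

/-- First spanning vector of the line. -/
def lineVec₁ {K : Type*} [Field K] (ζ : K) : Fin 5 → K :=
  ![810, 0, -1449 - 63 * ζ - 168 * ζ ^ 2, 63 + 630 * ζ + 273 * ζ ^ 2,
    -1113 - 525 * ζ - 350 * ζ ^ 2]

/-- Second spanning vector of the line. -/
def lineVec₂ {K : Type*} [Field K] (ζ : K) : Fin 5 → K :=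
  ![0, 270, 1035 + 549 * ζ - 150 * ζ ^ 2, -1017 - 36 * ζ + 27 * ζ ^ 2,
    2469 + 537 * ζ - 20 * ζ ^ 2]

lemma linearIndependent_lineVec {K : Type*} [Field K] [CharZero K] (ζ : K) :
    LinearIndependent K ![lineVec₁ ζ, lineVec₂ ζ] := by
  rw [LinearIndependent.pair_iff]
  intro s t hst
  have h0 := congrFun hst 0
  have h1 := congrFun hst 1
  simp [lineVec₁, lineVec₂] at h0 h1
  exact ⟨h0, h1⟩

lemma form_vanishes_on_line {K : Type*} [Field K] {ζ : K}
    (hζ : ζ ^ 3 + 3 * ζ ^ 2 + 3 * ζ - 9 = 0) (s t : K) :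
    7 * Q0 (-7) (s • lineVec₁ ζ + t • lineVec₂ ζ) +
      (5 * ζ + 3) * Qinf (-7) (s • lineVec₁ ζ + t • lineVec₂ ζ) = 0 := by
  simp [Q0, Qinf, lineVec₁, lineVec₂]
  linear_combination
    (s ^ 2 * (-5335071 + 503916 * ζ - 2177315 * ζ ^ 2) +
      s * t * (7690326 + 5021940 * ζ - 597730 * ζ ^ 2) +
      t ^ 2 * (-8582703 + 858984 * ζ + 69565 * ζ ^ 2)) * hζ

/-- The cubic `T³ + 3T² + 3T - 9` is irreducible over `ℚ`; let `K = ℚ(ζ)` be the cubic number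
field generated by a root `ζ`. With `d = -7`, the quadric `V(7Q₀ + (5ζ+3)Q∞) ⊂ ℙ⁴_K` contains
a `K`-rational line: there is a 2-dimensional `K`-linear subspace of `K⁵` on which the form
`7·Q₀ + (5ζ+3)·Q∞` vanishes identically. -/
theorem stmt8 :
    Irreducible (Polynomial.X ^ 3 + 3 * Polynomial.X ^ 2 + 3 * Polynomial.X - 9 :
      Polynomial ℚ) ∧
    ∀ (K : Type) [Field K] [Algebra ℚ K] (ζ : K),
      ζ ^ 3 + 3 * ζ ^ 2 + 3 * ζ - 9 = 0 → Algebra.adjoin ℚ {ζ} = ⊤ →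
        Module.finrank ℚ K = 3 →
          ∃ W : Submodule K (Fin 5 → K), Module.finrank K W = 2 ∧
            ∀ u ∈ W, 7 * Q0 (-7) u + (5 * ζ + 3) * Qinf (-7) u = 0 := by
  refine ⟨irreducible_cubic, fun K _ _ ζ hζ _ _ => ?_⟩
  have : CharZero K := algebraRat.charZero K
  refine ⟨Submodule.span K (Set.range ![lineVec₁ ζ, lineVec₂ ζ]), ?_, ?_⟩
  · simpa using finrank_span_eq_card (linearIndependent_lineVec ζ)
  · intro u hu
    rw [Matrix.range_cons_cons_empty, Submodule.mem_span_pair] at hu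
    obtain ⟨s, t, rfl⟩ := hu
    exact form_vanishes_on_line hζ s t
end
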